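/- arXiv:2312.06124 — 4 statements merged into one kernel-verified Lean document; each statement's English description precedes it below -/
import Mathlib

section
/- Let R be a Cohen-Macaulay normal local ring of dimension d ≥ 2 and M a finitely generated R-module such that Hom_R(M,R) has finite Gorenstein dimension. If Ext^i_R(M,R) = 0 for all 1 ≤ i ≤ d and Ext^j_R(M,M) = 0 for all 1 ≤ j ≤ d−1, then M is free. -/
open CategoryTheory Opposite

universe u

noncomputable section

/-- The Ext module `Ext^i_R(M,N)`. -/
def ExtMod (R : Type u) [CommRing R] (M N : ModuleCat.{u} R) (i : ℕ) : ModuleCat.{u} R :=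
  ((Ext R (ModuleCat.{u} R) i).obj (op M)).obj N

/-- The Tor module `Tor_i^R(M,N)`. -/
def TorMod (R : Type u) [CommRing R] (M N : ModuleCat.{u} R) (i : ℕ) : ModuleCat.{u} R :=
  ((Tor (ModuleCat.{u} R) i).obj M).obj N

/-- The depth of a module over a local ring, as the least `i` with
`Ext^i(k, M) ≠ 0`. -/
def moduleDepth (R : Type u) [CommRing R] [IsLocalRing R] (M : ModuleCat.{u} R) : ℕ∞ :=
  sInf {i : ℕ∞ | ∃ n : ℕ, i = n ∧
    Nontrivial (ExtMod R (ModuleCat.of R (IsLocalRing.ResidueField R)) M n)}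

/-- A Cohen-Macaulay local ring of dimension `d`. -/
def IsCMLocalOfDim (R : Type u) [CommRing R] [IsLocalRing R] [IsNoetherianRing R] (d : ℕ) : Prop :=
  ringKrullDim R = d ∧ moduleDepth R (ModuleCat.of R R) = d

/-- Totally reflexive modules. -/
def TotallyReflexive (R : Type u) [CommRing R] (M : Type u) [AddCommGroup M] [Module R M] : Prop :=
  Function.Bijective (Module.Dual.eval R M) ∧
  ∀ i : ℕ, 1 ≤ i →
    Subsingleton (ExtMod R (ModuleCat.of R M) (ModuleCat.of R R) i) ∧
    Subsingleton (ExtMod R (ModuleCat.of R (Module.Dual R M)) (ModuleCat.of R R) i)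

/-- `GdimLE R n M` : the Gorenstein dimension of `M` is at most `n`. -/
def GdimLE (R : Type u) [CommRing R] : ℕ → ModuleCat.{u} R → Prop
  | 0, M => TotallyReflexive R M
  | (n+1), M => ∃ (G : ModuleCat.{u} R) (g : G →ₗ[R] M), Module.Finite R G ∧
      TotallyReflexive R G ∧ Function.Surjective g ∧
      GdimLE R n (ModuleCat.of R (LinearMap.ker g))

/-- Finite Gorenstein dimension. -/
def FiniteGdim (R : Type u) [CommRing R] (M : Type u) [AddCommGroup M] [Module R M] : Prop :=
  ∃ n, GdimLE R n (ModuleCat.of R M)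

/-- `PdLE R n M` : the projective dimension of `M` is at most `n`. -/
def PdLE (R : Type u) [CommRing R] : ℕ → ModuleCat.{u} R → Prop
  | 0, M => Module.Projective R M
  | (n+1), M => ∃ (G : ModuleCat.{u} R) (g : G →ₗ[R] M), Module.Projective R G ∧
      Function.Surjective g ∧ PdLE R n (ModuleCat.of R (LinearMap.ker g))

/-- Finite projective dimension. -/
def FinitePd (R : Type u) [CommRing R] (M : Type u) [AddCommGroup M] [Module R M] : Prop :=
  ∃ n, PdLE R n (ModuleCat.of R M)

/-- A semidualizing module. -/
def Semidualizing (R : Type u) [CommRing R] (C : Type u) [AddCommGroup C] [Module R C] : Prop :=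
  Module.Finite R C ∧
  Function.Bijective (LinearMap.toSpanSingleton R (C →ₗ[R] C) LinearMap.id) ∧
  ∀ i : ℕ, 1 ≤ i → Subsingleton (ExtMod R (ModuleCat.of R C) (ModuleCat.of R C) i)

/-- Membership in the Auslander class with respect to `C`. -/
def InAuslanderClass (R : Type u) [CommRing R] (C : Type u) [AddCommGroup C] [Module R C]
    (X : Type u) [AddCommGroup X] [Module R X] : Prop :=
  Function.Bijective ((TensorProduct.mk R C X).flip) ∧
  (∀ i : ℕ, 1 ≤ i → Subsingleton (TorMod R (ModuleCat.of R C) (ModuleCat.of R X) i)) ∧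
  (∀ i : ℕ, 1 ≤ i →
    Subsingleton (ExtMod R (ModuleCat.of R C) (ModuleCat.of R (TensorProduct R C X)) i))

/-- Height of a prime ideal. -/
def primeHt (R : Type u) [CommRing R] (p : Ideal R) (hp : p.IsPrime) : ℕ∞ :=
  Order.height (⟨p, hp⟩ : PrimeSpectrum R)

/-- Finite injective dimension, via vanishing of `Ext` in high degrees. -/
def FiniteInjDim (R : Type u) [CommRing R] (M : Type u) [AddCommGroup M] [Module R M] : Prop :=
  ∃ n : ℕ, ∀ (N : ModuleCat.{u} R) (i : ℕ), n < i →
    Subsingleton (ExtMod R N (ModuleCat.of R M) i)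

/-- A canonical (dualizing) module over a Cohen-Macaulay local ring:
a semidualizing module of finite injective dimension. -/
def IsCanonicalModule (R : Type u) [CommRing R] (w : Type u) [AddCommGroup w] [Module R w] : Prop :=
  Semidualizing R w ∧ FiniteInjDim R w

end

namespace ARC

theorem extMod_iff (R : Type u) [CommRing R] (M N : ModuleCat.{u} R) (i : ℕ)
    (P : ProjectiveResolution M) :
    Subsingleton (ExtMod R M N i) ↔
    ∀ f : P.complex.X i ⟶ N, P.complex.d (i+1) i ≫ f = 0 →
      ∃ g : P.complex.X ((ComplexShape.up ℕ).prev i) ⟶ N, P.complex.d i _ ≫ g = f := by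
  have e := (P.isoExt (R := R) i N)
  have e' : ExtMod R M N i ≃ₗ[R] ((P.complex.linearYonedaObj R N).homology i : ModuleCat R) := e.toLinearEquiv
  rw [e'.toEquiv.subsingleton_congr, ← ModuleCat.isZero_iff_subsingleton,
    ← HomologicalComplex.exactAt_iff_isZero_homology,
    HomologicalComplex.exactAt_iff' _ _ i (i+1) rfl (by simp), ShortComplex.moduleCat_exact_iff]
  rfl

theorem ext_of_extMod (R : Type u) [CommRing R] (M N : ModuleCat.{u} R) (i : ℕ)
    (h : Subsingleton (ExtMod R M N i)) : Subsingleton (Abelian.Ext M N i) := by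
  let P := ProjectiveResolution.of M
  rw [extMod_iff R M N i P] at h
  refine subsingleton_of_forall_eq 0 fun α => ?_
  obtain ⟨f, hf, rfl⟩ := P.extMk_surjective α (i+1) rfl
  obtain ⟨g, hg⟩ := h f hf
  cases i with
  | zero =>
    have : f = 0 := by
      rw [← hg, P.complex.shape _ _ (by simp), Limits.zero_comp]
    subst this
    simp
  | succ i =>
    rw [P.extMk_eq_zero_iff _ _ _ _ i rfl]
    have : (ComplexShape.up ℕ).prev (i+1) = i := by simp
    revert g
    rw [this]
    exact fun g hg => ⟨g, hg⟩

theorem extMod_of_ext (R : Type u) [CommRing R] (M N : ModuleCat.{u} R) (i : ℕ) (hi : 1 ≤ i)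
    (h : Subsingleton (Abelian.Ext M N i)) : Subsingleton (ExtMod R M N i) := by
  let P := ProjectiveResolution.of M
  rw [extMod_iff R M N i P]
  intro f hf
  obtain ⟨i, rfl⟩ : ∃ j, i = j + 1 := ⟨i - 1, by lia⟩
  have := (P.extMk_eq_zero_iff f _ rfl hf i rfl).1 (Subsingleton.elim _ _)
  rw [show (ComplexShape.up ℕ).prev (i+1) = i by simp]
  exact this

/-- Vanishing of the `i`-th Ext module. -/
def EV (R : Type u) [CommRing R] (M N : Type u) [AddCommGroup M] [Module R M] [AddCommGroup N]
    [Module R N] (i : ℕ) : Prop :=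
  Subsingleton (Abelian.Ext (ModuleCat.of R M) (ModuleCat.of R N) i)

section
variable {R : Type u} [CommRing R] {A B C Z : Type u} [AddCommGroup A] [Module R A]
  [AddCommGroup B] [Module R B] [AddCommGroup C] [Module R C] [AddCommGroup Z] [Module R Z]

theorem EV_iff {i : ℕ} (hi : 1 ≤ i) : EV R A B i ↔
    Subsingleton (ExtMod R (ModuleCat.of R A) (ModuleCat.of R B) i) :=
  ⟨extMod_of_ext R _ _ i hi, ext_of_extMod R _ _ i⟩

theorem EV_congr_left (e : A ≃ₗ[R] B) {i : ℕ} (h : EV R A C i) : EV R B C i := by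
  refine subsingleton_of_forall_eq 0 fun x => ?_
  have h' : (Abelian.Ext.mk₀ (ModuleCat.ofHom e.toLinearMap)).comp x (zero_add i) = 0 := h.elim _ _
  have h2 := congrArg (fun y => (Abelian.Ext.mk₀ (ModuleCat.ofHom e.symm.toLinearMap)).comp y (zero_add i)) h'
  simp only [Abelian.Ext.mk₀_comp_mk₀_assoc, Abelian.Ext.comp_zero] at h2
  rw [← ModuleCat.ofHom_comp] at h2
  simpa using h2

theorem EV_projective [Module.Projective R A] {i : ℕ} (hi : 1 ≤ i) : EV R A B i := by
  obtain ⟨i, rfl⟩ : ∃ j, i = j + 1 := ⟨i - 1, by lia⟩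
  have : Projective (ModuleCat.of R A) := by
    rw [← IsProjective.iff_projective]; infer_instance
  exact Abelian.Ext.subsingleton_of_projective _ _ i

variable {f : A →ₗ[R] B} {g : B →ₗ[R] C}

/-- The short complex of a short exact sequence. -/
noncomputable def sc (he : Function.Exact f g) : ShortComplex (ModuleCat.{u} R) :=
  ModuleCat.shortComplexOfCompEqZero f g he.linearMap_comp_eq_zero

theorem sc_se (hf : Function.Injective f) (he : Function.Exact f g) (hg : Function.Surjective g) :
    (sc he).ShortExact where
  exact := ModuleCat.shortComplex_exact _ he
  mono_f := (ModuleCat.mono_iff_injective _).2 hf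
  epi_g := (ModuleCat.epi_iff_surjective _).2 hg

theorem lift_of_EV (hf : Function.Injective f) (he : Function.Exact f g)
    (hg : Function.Surjective g) (h : EV R Z A 1) (φ : Z →ₗ[R] C) : ∃ ψ : Z →ₗ[R] B, g ∘ₗ ψ = φ := by
  have H := sc_se hf he hg
  obtain ⟨x, hx⟩ := Abelian.Ext.covariant_sequence_exact₃ (ModuleCat.of R Z) H
    (Abelian.Ext.mk₀ (ModuleCat.ofHom φ)) (n₁ := 1) rfl (h.elim _ _)
  obtain ⟨y, rfl⟩ := (Abelian.Ext.mk₀_bijective _ _).2 x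
  rw [Abelian.Ext.mk₀_comp_mk₀] at hx
  have := (Abelian.Ext.mk₀_bijective _ _).1 hx
  refine ⟨y.hom, ?_⟩
  exact congrArg ModuleCat.Hom.hom this

theorem extend_of_EV (hf : Function.Injective f) (he : Function.Exact f g)
    (hg : Function.Surjective g) (h : EV R C Z 1) (φ : A →ₗ[R] Z) : ∃ ψ : B →ₗ[R] Z, ψ ∘ₗ f = φ := by
  have H := sc_se hf he hg
  obtain ⟨x, hx⟩ := Abelian.Ext.contravariant_sequence_exact₁ H (ModuleCat.of R Z)
    (Abelian.Ext.mk₀ (ModuleCat.ofHom φ)) (n₁ := 1) rfl (h.elim _ _)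
  obtain ⟨y, rfl⟩ := (Abelian.Ext.mk₀_bijective _ _).2 x
  rw [Abelian.Ext.mk₀_comp_mk₀] at hx
  have := (Abelian.Ext.mk₀_bijective _ _).1 hx
  refine ⟨y.hom, ?_⟩
  exact congrArg ModuleCat.Hom.hom this

theorem EV_cov3 (hf : Function.Injective f) (he : Function.Exact f g)
    (hg : Function.Surjective g) {i : ℕ} (h2 : EV R Z B i) (h1 : EV R Z A (i+1)) : EV R Z C i := by
  have H := sc_se hf he hg
  refine subsingleton_of_forall_eq 0 fun x => ?_
  obtain ⟨y, hy⟩ := Abelian.Ext.covariant_sequence_exact₃ (ModuleCat.of R Z) H x rfl (h1.elim _ _)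
  have hy0 : y = 0 := h2.elim _ _
  rw [← hy, hy0, Abelian.Ext.zero_comp]
  rfl

theorem EV_con1 (hf : Function.Injective f) (he : Function.Exact f g)
    (hg : Function.Surjective g) {i : ℕ} (h2 : EV R B Z i) (h1 : EV R C Z (i+1)) : EV R A Z i := by
  have H := sc_se hf he hg
  refine subsingleton_of_forall_eq 0 fun x => ?_
  obtain ⟨y, hy⟩ := Abelian.Ext.contravariant_sequence_exact₁ H (ModuleCat.of R Z) x (add_comm 1 i) (h1.elim _ _)
  have hy0 : y = 0 := h2.elim _ _
  rw [← hy, hy0, Abelian.Ext.comp_zero]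
  rfl

theorem EV_con3 (hf : Function.Injective f) (he : Function.Exact f g)
    (hg : Function.Surjective g) {i : ℕ} (h2 : EV R B Z (i+1)) (h1 : EV R A Z i) : EV R C Z (i+1) := by
  have H := sc_se hf he hg
  refine subsingleton_of_forall_eq 0 fun x => ?_
  obtain ⟨y, hy⟩ := Abelian.Ext.contravariant_sequence_exact₃ H (ModuleCat.of R Z) x (h2.elim _ _) (add_comm 1 i)
  have hy0 : y = 0 := h1.elim _ _
  rw [← hy, hy0, Abelian.Ext.comp_zero]
  rfl

theorem EV_one_of_extend (hf : Function.Injective f) (he : Function.Exact f g)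
    (hg : Function.Surjective g) (h2 : EV R B Z 1)
    (h : ∀ φ : A →ₗ[R] Z, ∃ ψ : B →ₗ[R] Z, ψ ∘ₗ f = φ) : EV R C Z 1 := by
  have H := sc_se hf he hg
  refine subsingleton_of_forall_eq 0 fun x => ?_
  obtain ⟨y, hy⟩ := Abelian.Ext.contravariant_sequence_exact₃ H (ModuleCat.of R Z) x (h2.elim _ _)
    (add_comm 1 0)
  obtain ⟨y, rfl⟩ := (Abelian.Ext.mk₀_bijective _ _).2 y
  obtain ⟨ψ, hψ⟩ := h y.hom
  obtain ⟨ψ', hψ'⟩ : ∃ ψ' : (sc he).X₂ ⟶ ModuleCat.of R Z, y = (sc he).f ≫ ψ' :=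
    ⟨ModuleCat.ofHom ψ, ModuleCat.hom_ext hψ.symm⟩
  rw [← hy, hψ', ← Abelian.Ext.mk₀_comp_mk₀, ← Abelian.Ext.comp_assoc_of_second_deg_zero,
    H.extClass_comp, Abelian.Ext.zero_comp]
  rfl
end
end ARC

namespace ARC
section
open RingTheory.Sequence Pointwise
variable {R : Type u} [CommRing R]

theorem mem_cons_iff {N : Type u} [AddCommGroup N] [Module R N] (r : R) (rs : List R) (x : N) :
    x ∈ Ideal.ofList (r :: rs) • (⊤ : Submodule R N) ↔
      (Submodule.Quotient.mk x : QuotSMulTop r N) ∈ Ideal.ofList rs • (⊤ : Submodule R (QuotSMulTop r N)) := by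
  have h1 : Ideal.ofList rs • (⊤ : Submodule R (QuotSMulTop r N)) =
      Submodule.map (Submodule.mkQ (r • (⊤ : Submodule R N))) (Ideal.ofList rs • ⊤) := by
    rw [Submodule.map_smul'', Submodule.map_top, Submodule.range_mkQ]
  rw [h1, Ideal.ofList_cons_smul]
  change _ ↔ (Submodule.mkQ (r • (⊤ : Submodule R N))) x ∈ _
  rw [← Submodule.mem_comap, Submodule.comap_map_eq, Submodule.ker_mkQ, sup_comm]

variable {N Z : Type u} [AddCommGroup N] [Module R N] [AddCommGroup Z] [Module R Z]

theorem smul_exact (r : R) :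
    Function.Exact (LinearMap.lsmul R N r) (Submodule.mkQ (r • (⊤ : Submodule R N))) := by
  rw [LinearMap.exact_iff, Submodule.ker_mkQ]
  ext x
  simp [Submodule.mem_smul_pointwise_iff_exists]

/-- Hom(Z,N)/r → Hom(Z,N/r). -/
noncomputable def Phi (R : Type u) [CommRing R] (N Z : Type u) [AddCommGroup N] [Module R N]
    [AddCommGroup Z] [Module R Z] (r : R) :
    QuotSMulTop r (Z →ₗ[R] N) →ₗ[R] (Z →ₗ[R] QuotSMulTop r N) :=
  Submodule.liftQ _ (LinearMap.compRight R (Submodule.mkQ (r • (⊤ : Submodule R N)))) (by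
    intro h hh
    rw [Submodule.mem_smul_pointwise_iff_exists] at hh
    obtain ⟨h, -, rfl⟩ := hh
    rw [LinearMap.mem_ker]
    ext z
    change (Submodule.Quotient.mk (r • h z) : QuotSMulTop r N) = 0
    rw [Submodule.Quotient.mk_eq_zero, Submodule.mem_smul_pointwise_iff_exists]
    exact ⟨h z, trivial, rfl⟩)

theorem Phi_mk (r : R) (h : Z →ₗ[R] N) :
    Phi R N Z r (Submodule.Quotient.mk h) = (Submodule.mkQ (r • (⊤ : Submodule R N))) ∘ₗ h := rfl

theorem Phi_inj {r : R} (hr : IsSMulRegular N r) : Function.Injective (Phi R N Z r) := by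
  rw [← LinearMap.ker_eq_bot, LinearMap.ker_eq_bot']
  intro x hx
  obtain ⟨h, rfl⟩ := Submodule.Quotient.mk_surjective _ x
  rw [Phi_mk] at hx
  have h1 : ∀ z, ∃ y, r • y = h z := by
    intro z
    have := LinearMap.congr_fun hx z
    simpa [Submodule.mem_smul_pointwise_iff_exists] using this
  choose y hy using h1
  rw [Submodule.Quotient.mk_eq_zero, Submodule.mem_smul_pointwise_iff_exists]
  refine ⟨⟨⟨y, ?_⟩, ?_⟩, trivial, ?_⟩
  · intro a b; apply hr; simp only [smul_add]; rw [hy, hy, hy, map_add]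
  · intro c a; apply hr; simp only [RingHom.id_apply]; rw [hy, smul_comm, hy, map_smul]
  · ext z; exact hy z

theorem Phi_bij {r : R} (hr : IsSMulRegular N r) (h : EV R Z N 1) :
    Function.Bijective (Phi R N Z r) := by
  refine ⟨Phi_inj hr, fun φ => ?_⟩
  obtain ⟨ψ, hψ⟩ := lift_of_EV (f := LinearMap.lsmul R N r) hr (smul_exact r)
    (Submodule.mkQ_surjective _) h φ
  exact ⟨Submodule.Quotient.mk ψ, hψ⟩

theorem EV_quot {r : R} (hr : IsSMulRegular N r) {i : ℕ} (h : EV R Z N i) (h' : EV R Z N (i+1)) :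
    EV R Z (QuotSMulTop r N) i :=
  EV_cov3 (f := LinearMap.lsmul R N r) hr (smul_exact r) (Submodule.mkQ_surjective _) h h'

theorem hom_smulRegular {r : R} (hr : IsSMulRegular N r) : IsSMulRegular (Z →ₗ[R] N) r := by
  intro a b hab
  ext z
  exact hr (LinearMap.congr_fun hab z)

theorem P1 (rs : List R) : ∀ (N : Type u) [AddCommGroup N] [Module R N], IsWeaklyRegular N rs →
    (∀ i, 1 ≤ i → i + 2 ≤ rs.length → EV R Z N i) → IsWeaklyRegular (Z →ₗ[R] N) rs := by
  induction rs with
  | nil => intro N _ _ _ _; exact IsWeaklyRegular.nil R _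
  | cons r rs ih =>
    intro N _ _ hN hE
    rw [isWeaklyRegular_cons_iff] at hN ⊢
    obtain ⟨hr, hN⟩ := hN
    refine ⟨hom_smulRegular hr, ?_⟩
    have ih' := ih (QuotSMulTop r N) hN (fun i h1 h2 => EV_quot hr
      (hE i h1 (by simp; lia)) (hE (i+1) (by lia) (by simp; lia)))
    match rs, ih', hE with
    | [], _, _ => exact IsWeaklyRegular.nil R _
    | [s], ih', _ =>
      rw [isWeaklyRegular_singleton_iff] at ih' ⊢
      exact ih'.of_injective (Phi R N Z r) (Phi_inj hr)
    | s :: t :: l, ih', hE =>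
      exact ((LinearEquiv.ofBijective _ (Phi_bij hr (hE 1 le_rfl (by simp)))).isWeaklyRegular_congr _).2 ih'

theorem equiv_mem {A B : Type u} [AddCommGroup A] [Module R A] [AddCommGroup B] [Module R B]
    (f : A →ₗ[R] B) (hf : Function.Bijective f) (I : Ideal R) {x : A} (h : f x ∈ I • (⊤ : Submodule R B)) :
    x ∈ I • (⊤ : Submodule R A) := by
  have h1 : I • (⊤ : Submodule R B) = Submodule.map f (I • ⊤) := by
    rw [Submodule.map_smul'', Submodule.map_top, LinearMap.range_eq_top.2 hf.2]
  rw [h1] at h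
  obtain ⟨y, hy, hxy⟩ := h
  exact hf.1 hxy ▸ hy

theorem map_mem {A B : Type u} [AddCommGroup A] [Module R A] [AddCommGroup B] [Module R B]
    (f : A →ₗ[R] B) (I : Ideal R) {x : A} (h : x ∈ I • (⊤ : Submodule R A)) :
    f x ∈ I • (⊤ : Submodule R B) := by
  have : f x ∈ Submodule.map f (I • ⊤) := ⟨x, h, rfl⟩
  rw [Submodule.map_smul''] at this
  exact Submodule.smul_mono le_rfl le_top this

theorem P2 (rs : List R) : ∀ (N : Type u) [AddCommGroup N] [Module R N], IsWeaklyRegular N rs →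
    (∀ i, 1 ≤ i → i + 1 ≤ rs.length → EV R Z N i) → ∀ h : Z →ₗ[R] N,
      (∀ z, h z ∈ Ideal.ofList rs • (⊤ : Submodule R N)) →
      h ∈ Ideal.ofList rs • (⊤ : Submodule R (Z →ₗ[R] N)) := by
  induction rs with
  | nil =>
    intro N _ _ _ _ h hz
    have : h = 0 := by ext z; simpa using hz z
    simp [this]
  | cons r rs ih =>
    intro N _ _ hN hE h hz
    rw [isWeaklyRegular_cons_iff] at hN
    obtain ⟨hr, hN⟩ := hN
    have ih' := ih (QuotSMulTop r N) hN (fun i h1 h2 => EV_quot hr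
      (hE i h1 (by simp; lia)) (hE (i+1) (by lia) (by simp; lia))) (Phi R N Z r (Submodule.Quotient.mk h))
      (fun z => (mem_cons_iff _ _ _).1 (hz z))
    rw [mem_cons_iff]
    match rs, ih', hE with
    | [], ih', _ =>
      simp only [Ideal.ofList_nil, Submodule.bot_smul, Submodule.mem_bot] at ih' ⊢
      apply Phi_inj hr
      rw [ih', map_zero]
    | s :: l, ih', hE =>
      exact equiv_mem _ (Phi_bij hr (hE 1 le_rfl (by simp))) _ ih'

theorem P3 (rs : List R) {W : Type u} [AddCommGroup W] [Module R W] :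
    ∀ (N : Type u) [AddCommGroup N] [Module R N], IsWeaklyRegular N rs →
    (∀ i, 1 ≤ i → i ≤ rs.length → EV R Z N i) → ∀ π : N →ₗ[R] W, Function.Surjective π →
      (∀ x, π x = 0 ↔ x ∈ Ideal.ofList rs • (⊤ : Submodule R N)) → ∀ φ : Z →ₗ[R] W,
      ∃ ψ : Z →ₗ[R] N, π ∘ₗ ψ = φ := by
  induction rs with
  | nil =>
    intro N _ _ _ _ π hπ hk φ
    have : Function.Injective π := by
      rw [← LinearMap.ker_eq_bot, LinearMap.ker_eq_bot']
      intro x hx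
      simpa using (hk x).1 hx
    refine ⟨(LinearEquiv.ofBijective π ⟨this, hπ⟩).symm.toLinearMap ∘ₗ φ, ?_⟩
    ext z
    exact (LinearEquiv.ofBijective π ⟨this, hπ⟩).apply_symm_apply (φ z)
  | cons r rs ih =>
    intro N _ _ hN hE π hπ hk φ
    rw [isWeaklyRegular_cons_iff] at hN
    obtain ⟨hr, hN⟩ := hN
    let π' : QuotSMulTop r N →ₗ[R] W := Submodule.liftQ _ π (by
      intro x hx
      rw [LinearMap.mem_ker, hk, Ideal.ofList_cons_smul]
      exact Submodule.mem_sup_left hx)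
    obtain ⟨ψ, hψ⟩ := ih (QuotSMulTop r N) hN (fun i h1 h2 => EV_quot hr
      (hE i h1 (by simp; lia)) (hE (i+1) (by lia) (by simp; lia))) π'
      (fun w => let ⟨x, hx⟩ := hπ w; ⟨Submodule.Quotient.mk x, hx⟩)
      (fun x => by
        obtain ⟨x, rfl⟩ := Submodule.Quotient.mk_surjective _ x
        rw [← mem_cons_iff, ← hk]; rfl) φ
    obtain ⟨χ, hχ⟩ := (Phi_bij hr (hE 1 le_rfl (by simp))).2 ψ
    obtain ⟨χ, rfl⟩ := Submodule.Quotient.mk_surjective _ χ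
    refine ⟨χ, ?_⟩
    rw [← hψ, ← hχ]
    rfl

theorem quot_ses {A B C : Type u} [AddCommGroup A] [Module R A] [AddCommGroup B] [Module R B]
    [AddCommGroup C] [Module R C] {f : A →ₗ[R] B} {g : B →ₗ[R] C} (hf : Function.Injective f)
    (he : Function.Exact f g) {r : R} (hr : IsSMulRegular C r) :
    Function.Injective (QuotSMulTop.map r f) := by
  rw [← LinearMap.ker_eq_bot, LinearMap.ker_eq_bot']
  intro x hx
  obtain ⟨a, rfl⟩ := Submodule.Quotient.mk_surjective _ x
  rw [QuotSMulTop.map_apply_mk, Submodule.Quotient.mk_eq_zero, Submodule.mem_smul_pointwise_iff_exists] at hx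
  obtain ⟨b, -, hb⟩ := hx
  have : g b = 0 := by
    apply hr
    simp only [smul_zero]
    rw [← map_smul, hb, he.apply_apply_eq_zero]
  obtain ⟨a', rfl⟩ := (he b).1 this
  rw [Submodule.Quotient.mk_eq_zero, Submodule.mem_smul_pointwise_iff_exists]
  refine ⟨a', trivial, hf ?_⟩
  rw [map_smul, hb]

theorem S1 (rs : List R) : ∀ {A B C : Type u} [AddCommGroup A] [Module R A] [AddCommGroup B] [Module R B]
    [AddCommGroup C] [Module R C] {f : A →ₗ[R] B} {g : B →ₗ[R] C}, Function.Injective f →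
    Function.Exact f g → Function.Surjective g → IsWeaklyRegular C rs → ∀ a : A,
    f a ∈ Ideal.ofList rs • (⊤ : Submodule R B) → a ∈ Ideal.ofList rs • (⊤ : Submodule R A) := by
  induction rs with
  | nil =>
    intro A B C _ _ _ _ _ _ f g hf he hg _ a ha
    simp only [Ideal.ofList_nil, Submodule.bot_smul, Submodule.mem_bot] at ha ⊢
    exact hf (by rw [ha, map_zero])
  | cons r rs ih =>
    intro A B C _ _ _ _ _ _ f g hf he hg hC a ha
    rw [isWeaklyRegular_cons_iff] at hC
    rw [mem_cons_iff] at ha ⊢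
    exact ih (quot_ses hf he hC.1) (QuotSMulTop.map_exact r he hg) (QuotSMulTop.map_surjective r hg) hC.2 _ ha

theorem S2 (rs : List R) : ∀ {A B C : Type u} [AddCommGroup A] [Module R A] [AddCommGroup B] [Module R B]
    [AddCommGroup C] [Module R C] {f : A →ₗ[R] B} {g : B →ₗ[R] C}, Function.Injective f →
    Function.Exact f g → Function.Surjective g → IsWeaklyRegular C rs → IsWeaklyRegular B rs →
    IsWeaklyRegular A rs := by
  induction rs with
  | nil =>
    intro A B C _ _ _ _ _ _ f g hf he hg _ _
    exact IsWeaklyRegular.nil R _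
  | cons r rs ih =>
    intro A B C _ _ _ _ _ _ f g hf he hg hC hB
    rw [isWeaklyRegular_cons_iff] at hC hB ⊢
    exact ⟨hB.1.of_injective f hf, ih (quot_ses hf he hC.1) (QuotSMulTop.map_exact r he hg)
      (QuotSMulTop.map_surjective r hg) hC.2 hB.2⟩
end
end ARC

namespace ARC
section
open RingTheory.Sequence Pointwise
variable {R : Type u} [CommRing R]

theorem TR_iff {M : Type u} [AddCommGroup M] [Module R M] : TotallyReflexive R M ↔
    Function.Bijective (Module.Dual.eval R M) ∧ ∀ i : ℕ, 1 ≤ i → EV R M R i ∧ EV R (Module.Dual R M) R i := by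
  refine and_congr Iff.rfl (forall_congr' fun i => forall_congr' fun hi => ?_)
  rw [EV_iff hi, EV_iff hi]

variable {K G M : Type u} [AddCommGroup K] [Module R K] [AddCommGroup G] [Module R G]
  [AddCommGroup M] [Module R M] {f : K →ₗ[R] G} {g : G →ₗ[R] M}

theorem dual_inj (hg : Function.Surjective g) : Function.Injective g.dualMap :=
  LinearMap.dualMap_injective_of_surjective hg

theorem dual_exact (he : Function.Exact f g) (hg : Function.Surjective g) :
    Function.Exact g.dualMap f.dualMap := by
  intro φ
  constructor
  · intro h
    have hk : LinearMap.ker g ≤ LinearMap.ker φ := by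
      intro x hx
      obtain ⟨a, rfl⟩ := (he x).1 hx
      exact LinearMap.congr_fun h a
    let e := g.quotKerEquivOfSurjective hg
    refine ⟨(LinearMap.ker g).liftQ φ hk ∘ₗ e.symm.toLinearMap, ?_⟩
    ext x
    have : e.symm (g x) = Submodule.Quotient.mk x := by
      rw [LinearEquiv.symm_apply_eq]; rfl
    simp [LinearMap.dualMap_apply, this]
  · rintro ⟨ψ, rfl⟩
    ext a
    simp [LinearMap.dualMap_apply, he.apply_apply_eq_zero]

theorem dual_surj (hf : Function.Injective f) (he : Function.Exact f g) (hg : Function.Surjective g)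
    (h : EV R M R 1) : Function.Surjective f.dualMap := by
  intro φ
  obtain ⟨ψ, hψ⟩ := extend_of_EV hf he hg h φ
  exact ⟨ψ, hψ⟩

theorem bid_surj (hf : Function.Injective f) (he : Function.Exact f g) (hg : Function.Surjective g)
    (h : EV R M R 1) (hG : Function.Surjective (Module.Dual.eval R G)) (hK : EV R (Module.Dual R K) R 1) :
    Function.Surjective (Module.Dual.eval R M) := by
  intro Φ
  obtain ⟨Ψ, hΨ⟩ := extend_of_EV (dual_inj hg) (dual_exact he hg) (dual_surj hf he hg h) hK Φ
  obtain ⟨x, rfl⟩ := hG Ψ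
  refine ⟨g x, ?_⟩
  rw [← hΨ]
  rfl

theorem bid_inj (hf : Function.Injective f) (he : Function.Exact f g) (hg : Function.Surjective g)
    (h : EV R M R 1) (hG : Function.Injective (Module.Dual.eval R G))
    (hK : Function.Surjective (Module.Dual.eval R K)) :
    Function.Injective (Module.Dual.eval R M) := by
  rw [← LinearMap.ker_eq_bot, LinearMap.ker_eq_bot']
  intro m hm
  obtain ⟨x, rfl⟩ := hg m
  have h2 : Function.Exact f.dualMap.dualMap g.dualMap.dualMap :=
    dual_exact (dual_exact he hg) (dual_surj hf he hg h)
  obtain ⟨θ, hθ⟩ := (h2 (Module.Dual.eval R G x)).1 (by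
    rw [← hm]; rfl)
  obtain ⟨k, rfl⟩ := hK θ
  have : f k = x := hG (by rw [← hθ]; rfl)
  rw [← this, he.apply_apply_eq_zero]

theorem refl_reg {rs : List R} (hR : IsWeaklyRegular R rs) (hM : Function.Bijective (Module.Dual.eval R M))
    (hE : ∀ i, 1 ≤ i → EV R (Module.Dual R M) R i) : IsWeaklyRegular M rs :=
  ((LinearEquiv.ofBijective _ hM).isWeaklyRegular_congr rs).2 (P1 rs R hR (fun i hi _ => hE i hi))

theorem refl_mem {rs : List R} (hR : IsWeaklyRegular R rs) (hM : Function.Bijective (Module.Dual.eval R M))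
    (hE : ∀ i, 1 ≤ i → EV R (Module.Dual R M) R i) {m : M}
    (hm : ∀ φ : Module.Dual R M, φ m ∈ Ideal.ofList rs) : m ∈ Ideal.ofList rs • (⊤ : Submodule R M) := by
  refine equiv_mem _ hM _ (P2 rs R hR (fun i hi _ => hE i hi) _ fun φ => ?_)
  simpa using hm φ

theorem finite_dual [IsNoetherianRing R] (X : Type u) [AddCommGroup X] [Module R X] [Module.Finite R X] :
    Module.Finite R (Module.Dual R X) := by
  exact inferInstanceAs (Module.Finite R (X →ₗ[R] R))

theorem TR_of_ses [IsNoetherianRing R] {rs : List R} (hR : IsWeaklyRegular R rs)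
    (hH : ∀ (T : Type u) [AddCommGroup T] [Module R T] [Module.Finite R T],
      (∀ φ : T →ₗ[R] (R ⧸ Ideal.ofList rs), φ = 0) → Subsingleton T)
    [Module.Finite R K]
    (hf : Function.Injective f) (he : Function.Exact f g) (hg : Function.Surjective g)
    (hG : TotallyReflexive R G) (hK : TotallyReflexive R K) (hM : IsWeaklyRegular M rs) :
    TotallyReflexive R M := by
  rw [TR_iff] at hG hK ⊢
  have := finite_dual (R := R) K
  have hT : Subsingleton (Module.Dual R K ⧸ LinearMap.range f.dualMap) := by
    refine hH _ fun φ => ?_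
    obtain ⟨Ψ, hΨ⟩ := P3 rs R hR (fun i hi _ => (hK.2 i hi).2) (Submodule.mkQ (Ideal.ofList rs))
      (Submodule.mkQ_surjective _) (fun x => by simpa using Ideal.Quotient.eq_zero_iff_mem) (φ ∘ₗ Submodule.mkQ _)
    obtain ⟨a, rfl⟩ := hK.1.2 Ψ
    have h1 : f a ∈ Ideal.ofList rs • (⊤ : Submodule R G) := by
      refine refl_mem hR hG.1 (fun i hi => (hG.2 i hi).2) fun ψ => ?_
      have h3 := LinearMap.congr_fun hΨ (f.dualMap ψ)
      have h4 : (Submodule.mkQ (LinearMap.range f.dualMap)) (f.dualMap ψ) = 0 := by simp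
      rw [LinearMap.comp_apply, LinearMap.comp_apply, h4, map_zero] at h3
      exact (Submodule.Quotient.mk_eq_zero _).1 h3
    have h2 := S1 rs hf he hg hM a h1
    refine Submodule.linearMap_qext _ ?_
    rw [← hΨ]
    ext ψ
    refine (Submodule.Quotient.mk_eq_zero _).2 ?_
    simpa using map_mem ψ _ h2
  have hs : Function.Surjective f.dualMap := by
    rw [← LinearMap.range_eq_top]
    exact Submodule.Quotient.subsingleton_iff.1 hT
  have hE1 : EV R M R 1 := EV_one_of_extend hf he hg (hG.2 1 le_rfl).1 fun φ => hs φ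
  refine ⟨⟨bid_inj hf he hg hE1 hG.1.1 hK.1.2, bid_surj hf he hg hE1 hG.1.2 (hK.2 1 le_rfl).2⟩,
    fun i hi => ⟨?_, EV_con1 (dual_inj hg) (dual_exact he hg) hs (hG.2 i hi).2 (hK.2 (i+1) (by lia)).2⟩⟩
  obtain rfl | hi' := eq_or_ne i 1
  · exact hE1
  · obtain ⟨j, rfl⟩ : ∃ j, i = j + 1 := ⟨i - 1, by lia⟩
    exact EV_con3 hf he hg (hG.2 (j+1) hi).1 (hK.2 j (by lia)).1

theorem AB [IsNoetherianRing R] {rs : List R} (hR : IsWeaklyRegular R rs)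
    (hH : ∀ (T : Type u) [AddCommGroup T] [Module R T] [Module.Finite R T],
      (∀ φ : T →ₗ[R] (R ⧸ Ideal.ofList rs), φ = 0) → Subsingleton T) (n : ℕ) :
    ∀ X : ModuleCat.{u} R, GdimLE R n X → IsWeaklyRegular X rs → TotallyReflexive R X := by
  induction n with
  | zero => intro X h _; exact h
  | succ n ih =>
    rintro X ⟨G, g, hfin, hG, hg, hn⟩ hX
    have hG' := TR_iff.1 hG
    have he : Function.Exact (LinearMap.ker g).subtype g := LinearMap.exact_subtype_ker_map g
    have hf := (LinearMap.ker g).injective_subtype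
    have hK := ih _ hn (S2 rs hf he hg hX (refl_reg hR hG'.1 fun i hi => (hG'.2 i hi).2))
    exact TR_of_ses hR hH hf he hg hG hK hX

end
end ARC

namespace ARC
section
open RingTheory.Sequence Pointwise IsLocalRing
variable {R : Type u} [CommRing R] [IsLocalRing R] [IsNoetherianRing R]

theorem exists_rs {d : ℕ} (h : moduleDepth R (ModuleCat.of R R) = d) :
    ∃ rs : List R, rs.length = d ∧ (∀ r ∈ rs, r ∈ maximalIdeal R) ∧ IsRegular R rs := by
  refine ModuleCat.exists_isRegular_of_exists_subsingleton_ext (maximalIdeal R) d (ModuleCat.of R R) ?_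
    (ModuleCat.of R (ResidueField R)) ?_ ?_
  · rw [lt_top_iff_ne_top]
    change maximalIdeal R • (⊤ : Submodule R R) ≠ ⊤
    simpa using (maximalIdeal.isMaximal R).ne_top
  · change Module.support R (R ⧸ maximalIdeal R) = _
    rw [Module.support_of_algebra]
    simp [Ideal.Quotient.algebraMap_eq]
  · intro i hi
    apply ext_of_extMod
    by_contra hc
    have : moduleDepth R (ModuleCat.of R R) ≤ i := sInf_le ⟨i, rfl, not_subsingleton_iff_nontrivial.1 hc⟩
    rw [h] at this
    exact absurd (Nat.cast_le.1 this) (by lia)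

theorem pow_le {rs : List R} (hreg : IsRegular R rs) (hdim : ringKrullDim R = rs.length) :
    ∃ N, maximalIdeal R ^ N ≤ Ideal.ofList rs := by
  have h := ringKrullDim_add_length_eq_ringKrullDim_of_isRegular rs hreg
  have h0 : Ring.KrullDimLE 0 (R ⧸ Ideal.ofList rs) := by
    rw [Ring.krullDimLE_iff]
    rw [hdim] at h
    generalize ringKrullDim (R ⧸ Ideal.ofList rs) = x at h ⊢
    induction x with
    | bot => exact bot_le
    | coe x =>
      induction x with
      | top =>
        exfalso
        have h' : ((⊤ + (rs.length : ℕ∞) : ℕ∞) : WithBot ℕ∞) = ((rs.length : ℕ∞) : WithBot ℕ∞) := h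
        rw [top_add] at h'
        exact ENat.natCast_ne_top _ (WithBot.coe_injective h').symm
      | coe n =>
        have h' : (((n : ℕ∞) + (rs.length : ℕ∞) : ℕ∞) : WithBot ℕ∞) = ((rs.length : ℕ∞) : WithBot ℕ∞) := h
        have h2 := WithBot.coe_injective h'
        norm_cast at h2
        have : n = 0 := by lia
        simp [this]
  have hr : maximalIdeal R ≤ (Ideal.ofList rs).radical := by
    rw [Ideal.radical_eq_sInf]
    refine le_sInf fun P ⟨hP, hPp⟩ => ?_
    have hprime : (P.map (Ideal.Quotient.mk (Ideal.ofList rs))).IsPrime :=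
      Ideal.map_isPrime_of_surjective Ideal.Quotient.mk_surjective (by simpa using hP)
    have hmax : (P.map (Ideal.Quotient.mk (Ideal.ofList rs))).IsMaximal := hprime.isMaximal'
    have h3 := Ideal.comap_isMaximal_of_surjective (Ideal.Quotient.mk (Ideal.ofList rs))
      Ideal.Quotient.mk_surjective (H := hmax)
    rw [Ideal.comap_map_of_surjective _ Ideal.Quotient.mk_surjective] at h3
    have h4 : P ⊔ Ideal.comap (Ideal.Quotient.mk (Ideal.ofList rs)) ⊥ = P := by
      rw [sup_eq_left]
      intro x hx
      rw [Ideal.mem_comap, Ideal.mem_bot, Ideal.Quotient.eq_zero_iff_mem] at hx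
      exact hP hx
    rw [h4] at h3
    exact (eq_maximalIdeal h3).ge
  obtain ⟨N, hN⟩ := Ideal.exists_radical_pow_le_of_fg (Ideal.ofList rs) (IsNoetherian.noetherian _)
  exact ⟨N, (Ideal.pow_right_mono hr N).trans hN⟩

theorem propH {I : Ideal R} (hI : I ≠ ⊤) {N : ℕ} (hN : maximalIdeal R ^ N ≤ I)
    (T : Type u) [AddCommGroup T] [Module R T] [Module.Finite R T]
    (h : ∀ φ : T →ₗ[R] (R ⧸ I), φ = 0) : Subsingleton T := by
  obtain ⟨r, hr, hreg⟩ := IsSMulRegular.subsingleton_linearMap_iff.1 (subsingleton_of_forall_eq 0 h)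
  by_cases hu : IsUnit r
  · refine subsingleton_of_forall_eq 0 fun t => ?_
    exact hu.smul_eq_zero.1 (Module.mem_annihilator.1 hr t)
  · exfalso
    have h1 := hreg.pow N
    apply hI
    rw [Ideal.eq_top_iff_one, ← Ideal.Quotient.eq_zero_iff_mem]
    apply h1
    simp only [smul_zero]
    change Ideal.Quotient.mk I (r ^ N • 1) = 0
    rw [Ideal.Quotient.eq_zero_iff_mem, smul_eq_mul, mul_one]
    exact hN (Ideal.pow_mem_pow ((mem_maximalIdeal r).2 hu) N)
end
end ARC

namespace ARC
section
open Polynomial TensorProduct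

theorem integral_matrix_trace {R L : Type*} [CommRing R] [Field L] [IsAlgClosed L] [Algebra R L]
    {n : ℕ} (A : Matrix (Fin n) (Fin n) L) (p : R[X]) (hp : p.Monic)
    (hA : aeval A (p.map (algebraMap R L)) = 0) : IsIntegral R A.trace := by
  rw [Matrix.trace_eq_sum_roots_charpoly]
  refine IsIntegral.multiset_sum fun x hx => ?_
  rcases subsingleton_or_nontrivial (Matrix (Fin n) (Fin n) L) with hs | hs
  · exfalso
    rw [mem_roots (Matrix.charpoly_monic A).ne_zero, ← Matrix.mem_spectrum_iff_isRoot_charpoly] at hx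
    rw [spectrum.of_subsingleton] at hx
    exact hx
  · rw [mem_roots (Matrix.charpoly_monic A).ne_zero, ← Matrix.mem_spectrum_iff_isRoot_charpoly] at hx
    have h1 := spectrum.subset_polynomial_aeval A (p.map (algebraMap R L)) ⟨x, hx, rfl⟩
    rw [hA, spectrum.zero_eq] at h1
    refine ⟨p, hp, ?_⟩
    have h2 : (p.map (algebraMap R L)).eval x = 0 := h1
    rwa [Polynomial.eval_map] at h2

theorem integral_trace {R K V : Type*} [CommRing R] [Field K] [Algebra R K] [AddCommGroup V] [Module K V]
    [FiniteDimensional K V] (φ : Module.End K V) (p : R[X]) (hp : p.Monic)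
    (hA : aeval φ (p.map (algebraMap R K)) = 0) : IsIntegral R (LinearMap.trace K V φ) := by
  let b := Module.finBasis K V
  let L := AlgebraicClosure K
  let A := LinearMap.toMatrix b b φ
  rw [← isIntegral_algebraMap_iff (algebraMap K L).injective, LinearMap.trace_eq_matrix_trace K b]
  have h0 : aeval A (p.map (algebraMap R K)) = 0 := by
    have : A = LinearMap.toMatrixAlgEquiv b φ := rfl
    rw [this, aeval_algHom_apply (LinearMap.toMatrixAlgEquiv b) φ, hA, map_zero]
  have h1 := integral_matrix_trace (R := R) (A.map (algebraMap K L)) p hp (by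
    have h2 := congrArg (Algebra.ofId K L).mapMatrix h0
    rw [map_zero, ← aeval_algHom_apply] at h2
    rw [IsScalarTower.algebraMap_eq R K L, ← Polynomial.map_map, aeval_map_algebraMap]
    exact h2)
  convert h1
  exact AddMonoidHom.map_trace (algebraMap K L) A

theorem exists_trace (R : Type u) [CommRing R] [IsDomain R] [IsIntegrallyClosed R]
    (M : Type u) [AddCommGroup M] [Module R M] [Module.Finite R M] :
    ∃ tr : (M →ₗ[R] M) →ₗ[R] R, ∀ (f : M →ₗ[R] R) (m : M), tr (f.smulRight m) = f m := by
  let K := FractionRing R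
  let t : (M →ₗ[R] M) →ₗ[R] K :=
    (LinearMap.trace K (K ⊗[R] M)).restrictScalars R ∘ₗ LinearMap.baseChangeHom R K M M
  have ht : ∀ h, t h = LinearMap.trace K (K ⊗[R] M) (h.baseChange K) := fun h => rfl
  have hint : ∀ h, t h ∈ LinearMap.range (Algebra.linearMap R K) := by
    intro h
    obtain ⟨p, hp, hph⟩ := Algebra.IsIntegral.isIntegral (R := R) (h : Module.End R M)
    have : IsIntegral R (t h) := by
      rw [ht]
      refine integral_trace _ p hp ?_
      rw [aeval_map_algebraMap]
      have h3 := aeval_algHom_apply (Module.End.baseChangeHom R K M) h p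
      have h4 : aeval (h : Module.End R M) p = 0 := hph
      rw [h4, map_zero] at h3
      exact h3
    obtain ⟨y, hy⟩ := IsIntegrallyClosed.isIntegral_iff.1 this
    exact ⟨y, hy⟩
  have hinj : Function.Injective (Algebra.linearMap R K) := IsFractionRing.injective R K
  let e := LinearEquiv.ofInjective _ hinj
  refine ⟨e.symm.toLinearMap ∘ₗ t.codRestrict _ hint, fun f m => ?_⟩
  apply hinj
  have h1 : Algebra.linearMap R K (e.symm (t.codRestrict _ hint (f.smulRight m))) = t (f.smulRight m) := by
    have := congrArg Subtype.val (e.apply_symm_apply (t.codRestrict _ hint (f.smulRight m)))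
    exact this
  refine h1.trans ?_
  rw [ht]
  let f' : K ⊗[R] M →ₗ[K] K := (TensorProduct.AlgebraTensorModule.rid R K K).toLinearMap ∘ₗ f.baseChange K
  have h2 : (f.smulRight m).baseChange K = f'.smulRight (1 ⊗ₜ m) := by
    ext x
    simp [f', TensorProduct.smul_tmul']
  rw [h2, LinearMap.trace_smulRight]
  simp [f', Algebra.algebraMap_eq_smul_one]
end
end ARC

namespace ARC
section
open IsLocalRing
variable {R : Type u} [CommRing R] [IsLocalRing R] [IsNoetherianRing R] [IsDomain R] [IsIntegrallyClosed R]

theorem zero_case {I : Ideal R} (hI : I ≤ maximalIdeal R) {N : ℕ} (hN : maximalIdeal R ^ N ≤ I)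
    (M : Type u) [AddCommGroup M] [Module R M] [Module.Finite R M]
    (ha : ∀ h : M →ₗ[R] M, (∀ m, h m ∈ I • (⊤ : Submodule R M)) → h ∈ I • (⊤ : Submodule R (M →ₗ[R] M)))
    (hb : ∀ m : M, (∀ f : M →ₗ[R] R, f m ∈ I) → m ∈ I • (⊤ : Submodule R M))
    (hu : ∀ (f : M →ₗ[R] R) (m : M), f m ∈ maximalIdeal R) : Subsingleton M := by
  obtain ⟨tr, htr⟩ := exists_trace R M
  have key : ∀ h : M →ₗ[R] M, (∀ (f : M →ₗ[R] R) (m : M),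
      f.smulRight (h m) ∈ I • (⊤ : Submodule R (M →ₗ[R] M))) → h ∈ I • (⊤ : Submodule R (M →ₗ[R] M)) := by
    intro h hh
    refine ha h fun m => hb _ fun f => ?_
    rw [← htr]
    simpa using map_mem tr I (hh f m)
  have desc : ∀ k, k ≤ N → ∀ s ∈ maximalIdeal R ^ (N - k), ∀ (f : M →ₗ[R] R) (m : M),
      s • f.smulRight m ∈ I • (⊤ : Submodule R (M →ₗ[R] M)) := by
    intro k
    induction k with
    | zero => intro _ s hs f m; exact Submodule.smul_mem_smul (hN hs) trivial
    | succ k ih =>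
      intro hk s hs f m
      refine key _ fun f' m' => ?_
      have h1 := ih (by lia) (s * f m') (by
        rw [show N - k = N - (k+1) + 1 by lia, pow_succ]
        exact Ideal.mul_mem_mul hs (hu f m')) f' m
      convert h1 using 1
      ext x
      simp only [LinearMap.smulRight_apply, LinearMap.smul_apply, smul_smul]
      ring_nf
  have h1 : (LinearMap.id : M →ₗ[R] M) ∈ I • (⊤ : Submodule R (M →ₗ[R] M)) := by
    refine key _ fun f m => ?_
    have := desc N le_rfl 1 (by simp) f m
    simpa using this
  have h2 : (⊤ : Submodule R M) ≤ I • ⊤ := by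
    intro m _
    exact map_mem (LinearMap.applyₗ m) I h1
  have h3 : (⊤ : Submodule R M) = ⊥ := Submodule.eq_bot_of_le_smul_of_le_jacobson_bot I ⊤
    (Module.Finite.fg_top) h2 (hI.trans (jacobson_eq_maximalIdeal ⊥ bot_ne_top).ge)
  exact (Submodule.subsingleton_iff R).1 (subsingleton_of_bot_eq_top h3.symm)

theorem range_add_ker {M : Type u} [AddCommGroup M] [Module R M] [Module.Finite R M] (f : M →ₗ[R] R) :
    Module.finrank R (LinearMap.range f) + Module.finrank R (LinearMap.ker f) = Module.finrank R M := by
  rw [← Submodule.finrank_quotient_add_finrank (LinearMap.ker f), f.quotKerEquivRange.finrank_eq]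

theorem free_of_ab {I : Ideal R} (hI : I ≤ maximalIdeal R) {N : ℕ} (hN : maximalIdeal R ^ N ≤ I) (n : ℕ) :
    ∀ (M : Type u) [AddCommGroup M] [Module R M] [Module.Finite R M],
    (∀ h : M →ₗ[R] M, (∀ m, h m ∈ I • (⊤ : Submodule R M)) → h ∈ I • (⊤ : Submodule R (M →ₗ[R] M))) →
    (∀ m : M, (∀ f : M →ₗ[R] R, f m ∈ I) → m ∈ I • (⊤ : Submodule R M)) →
    Module.finrank R M ≤ n → Module.Free R M := by
  induction n with
  | zero =>
    intro M _ _ _ ha hb hn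
    have : Subsingleton M := by
      refine zero_case hI hN M ha hb fun f m => ?_
      have h0 : f = 0 := by
        by_contra hf
        obtain ⟨m, hm⟩ : ∃ m, f m ≠ 0 := by
          by_contra! hc
          exact hf (LinearMap.ext hc)
        have h1 := range_add_ker f
        have h2 : 0 < Module.finrank R (LinearMap.range f) := by
          rw [Module.finrank_pos_iff_exists_ne_zero]
          exact ⟨⟨f m, m, rfl⟩, fun h => hm (congrArg Subtype.val h)⟩
        lia
      simp [h0]
    infer_instance
  | succ n ih =>
    intro M _ _ _ ha hb hn
    by_cases hu : ∀ (f : M →ₗ[R] R) (m : M), f m ∈ maximalIdeal R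
    · have := zero_case hI hN M ha hb hu
      infer_instance
    push Not at hu
    obtain ⟨f₀, m, hm⟩ := hu
    obtain ⟨u, hu⟩ : IsUnit (f₀ m) := by simpa using hm
    let f : M →ₗ[R] R := (↑u⁻¹ : R) • f₀
    have hf : f m = 1 := by simp [f, ← hu]
    let ι : LinearMap.ker f →ₗ[R] M := (LinearMap.ker f).subtype
    let p : M →ₗ[R] LinearMap.ker f := LinearMap.codRestrict _ (LinearMap.id - f.smulRight m) (by
      intro x; simp [hf])
    have hp : ∀ x, (p x : M) = x - f x • m := fun x => rfl
    have hpι : ∀ x, p (ι x) = x := by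
      intro x
      apply Subtype.ext
      have : f (x : M) = 0 := x.2
      rw [hp]
      simp [ι, this]
    have hK : Module.Free R (LinearMap.ker f) := by
      refine ih _ ?_ ?_ ?_
      · intro h hh
        have h1 := ha (ι ∘ₗ h ∘ₗ p) (fun x => map_mem ι I (hh _))
        have h2 := map_mem (LinearMap.lcomp R (LinearMap.ker f) ι ∘ₗ LinearMap.compRight R p) I h1
        convert h2
        refine LinearMap.ext fun x => ?_
        change h x = p (ι (h (p (ι x))))
        rw [hpι, hpι]
      · intro k hk
        have h1 := map_mem p I (hb (ι k) fun g => hk (g ∘ₗ ι))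
        rwa [hpι] at h1
      · have h1 := range_add_ker f
        have h2 : LinearMap.range f = ⊤ := by
          rw [LinearMap.range_eq_top]
          intro y
          exact ⟨y • m, by rw [map_smul, hf, smul_eq_mul, mul_one]⟩
        rw [h2, finrank_top, Module.finrank_self] at h1
        lia
    let e : M ≃ₗ[R] LinearMap.ker f × R := LinearEquiv.ofLinearMap (p.prod f)
      (LinearMap.coprod ι (LinearMap.toSpanSingleton R M m)) (by
        refine LinearMap.ext fun x => ?_
        have : f (x.1 : M) = 0 := x.1.2
        refine Prod.ext (Subtype.ext ?_) ?_
        · simp [hp, ι, this, hf]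
        · simp [ι, this, hf]) (by
        refine LinearMap.ext fun x => ?_
        simp [hp, ι])
    exact Module.Free.of_equiv e.symm
end
end ARC

namespace ARC
section
open RingTheory.Sequence Pointwise IsLocalRing
variable {R : Type u} [CommRing R]

theorem TR_free (F : Type u) [AddCommGroup F] [Module R F] [Module.Free R F] [Module.Finite R F] :
    TotallyReflexive R F := by
  rw [TR_iff]
  exact ⟨Module.bijective_dual_eval R F, fun i hi => ⟨EV_projective hi, EV_projective hi⟩⟩

theorem TR_congr {X Y : Type u} [AddCommGroup X] [Module R X] [AddCommGroup Y] [Module R Y] (e : X ≃ₗ[R] Y)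
    (h : TotallyReflexive R X) : TotallyReflexive R Y := by
  rw [TR_iff] at h ⊢
  refine ⟨?_, fun i hi => ⟨EV_congr_left e (h.2 i hi).1, EV_congr_left e.symm.dualMap (h.2 i hi).2⟩⟩
  have : Module.IsReflexive R X := ⟨h.1⟩
  have := Module.equiv e
  exact Module.bijective_dual_eval R Y

theorem Gdim_congr (n : ℕ) : ∀ (X Y : ModuleCat.{u} R), (X ≃ₗ[R] Y) → GdimLE R n X → GdimLE R n Y := by
  induction n with
  | zero => intro X Y e h; exact TR_congr e h
  | succ n ih =>
    rintro X Y e ⟨G, g, hfin, hG, hg, hn⟩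
    refine ⟨G, e.toLinearMap ∘ₗ g, hfin, hG, e.surjective.comp hg, ih _ _ (LinearEquiv.ofEq _ _ ?_) hn⟩
    exact (LinearEquiv.ker_comp e g).symm

theorem Gdim_ses {A B C : Type u} [AddCommGroup A] [Module R A] [AddCommGroup B] [Module R B]
    [AddCommGroup C] [Module R C] {f : A →ₗ[R] B} {g : B →ₗ[R] C} (hf : Function.Injective f)
    (he : Function.Exact f g) (hg : Function.Surjective g) [Module.Finite R B] (hB : TotallyReflexive R B)
    {n : ℕ} (hA : GdimLE R n (ModuleCat.of R A)) : GdimLE R (n+1) (ModuleCat.of R C) := by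
  refine ⟨ModuleCat.of R B, g, inferInstanceAs (Module.Finite R B), hB, hg, Gdim_congr n _ _ ?_ hA⟩
  exact LinearEquiv.ofInjective f hf ≪≫ₗ LinearEquiv.ofEq _ _ (LinearMap.exact_iff.1 he).symm

theorem exists_pres [IsNoetherianRing R] (M : Type u) [AddCommGroup M] [Module R M] [Module.Finite R M] :
    ∃ (n : ℕ) (g : (Fin n → R) →ₗ[R] M), Function.Surjective g := Module.Finite.exists_fin' R M

theorem main (R : Type u) [CommRing R] [IsLocalRing R] [IsNoetherianRing R]
    [IsDomain R] [IsIntegrallyClosed R] (d : ℕ)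
    (hCM : IsCMLocalOfDim R d)
    (M : Type u) [AddCommGroup M] [Module R M] [Module.Finite R M]
    (hG : FiniteGdim R (M →ₗ[R] R)) (hd : 2 ≤ d)
    (h1 : ∀ i : ℕ, 1 ≤ i → i ≤ d → EV R M R i)
    (h2 : ∀ j : ℕ, 1 ≤ j → j ≤ d - 1 → EV R M M j) :
    Module.Free R M := by
  obtain ⟨rs, hlen, hmem, hreg⟩ := exists_rs hCM.2
  have hIm : Ideal.ofList rs ≤ maximalIdeal R := Ideal.span_le.2 fun r hr => hmem r hr
  have hItop : Ideal.ofList rs ≠ ⊤ := fun h => (maximalIdeal.isMaximal R).ne_top (top_le_iff.1 (h ▸ hIm))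
  obtain ⟨N, hN⟩ := pow_le hreg (by rw [hCM.1, hlen])
  have hR := hreg.toIsWeaklyRegular
  -- syzygies
  obtain ⟨n0, g0, hg0⟩ := exists_pres (R := R) M
  obtain ⟨n1, g1, hg1⟩ := exists_pres (R := R) (LinearMap.ker g0)
  have he0 : Function.Exact (LinearMap.ker g0).subtype g0 := LinearMap.exact_subtype_ker_map g0
  have hf0 := (LinearMap.ker g0).injective_subtype
  have he1 : Function.Exact (LinearMap.ker g1).subtype g1 := LinearMap.exact_subtype_ker_map g1
  have hf1 := (LinearMap.ker g1).injective_subtype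
  have hK : ∀ i, 1 ≤ i → i + 1 ≤ d → EV R (LinearMap.ker g0) R i := fun i hi hi' =>
    EV_con1 hf0 he0 hg0 (EV_projective hi) (h1 (i+1) (by lia) hi')
  have hK2 : ∀ i, 1 ≤ i → i + 2 ≤ d → EV R (LinearMap.ker g1) R i := fun i hi hi' =>
    EV_con1 hf1 he1 hg1 (EV_projective hi) (hK (i+1) (by lia) hi')
  have hs0 := dual_surj hf0 he0 hg0 (h1 1 le_rfl (by lia))
  have hs1 := dual_surj hf1 he1 hg1 (hK 1 le_rfl (by lia))
  obtain ⟨n, hn⟩ := hG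
  have hn1 := Gdim_ses (dual_inj hg0) (dual_exact he0 hg0) hs0 (TR_free _) hn
  have hn2 := Gdim_ses (dual_inj hg1) (dual_exact he1 hg1) hs1 (TR_free _) hn1
  have hregK2 : IsWeaklyRegular (Module.Dual R (LinearMap.ker g1)) rs :=
    P1 rs R hR (fun i hi hi' => hK2 i hi (by lia))
  have hTR := TR_iff.1 (AB hR (fun T _ _ _ h => propH hItop hN T h) _ _ hn2 hregK2)
  have hE2 : ∀ i, 1 ≤ i → EV R (Module.Dual R (LinearMap.ker g1)) R i := fun i hi => (hTR.2 i hi).1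
  have hE1 : ∀ i, 1 ≤ i → EV R (Module.Dual R (LinearMap.ker g0)) R i := fun i hi =>
    EV_con1 (dual_inj hg1) (dual_exact he1 hg1) hs1 (EV_projective hi) (hE2 (i+1) (by lia))
  have hE0 : ∀ i, 1 ≤ i → EV R (Module.Dual R M) R i := fun i hi =>
    EV_con1 (dual_inj hg0) (dual_exact he0 hg0) hs0 (EV_projective hi) (hE1 (i+1) (by lia))
  have hbF0 := Module.bijective_dual_eval R (Fin n0 → R)
  have hbF1 := Module.bijective_dual_eval R (Fin n1 → R)
  have hKs := bid_surj hf1 he1 hg1 (hK 1 le_rfl (by lia)) hbF1.2 (hE2 1 le_rfl)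
  have hMb : Function.Bijective (Module.Dual.eval R M) :=
    ⟨bid_inj hf0 he0 hg0 (h1 1 le_rfl (by lia)) hbF0.1 hKs,
      bid_surj hf0 he0 hg0 (h1 1 le_rfl (by lia)) hbF0.2 (hE1 1 le_rfl)⟩
  have hregM := refl_reg hR hMb hE0
  exact free_of_ab hIm hN _ M
    (P2 rs M hregM fun i hi hi' => h2 i hi (by lia))
    (fun m hm => refl_mem hR hMb hE0 hm) le_rfl
end
end ARC

theorem stmt8 (R : Type u) [CommRing R] [IsLocalRing R] [IsNoetherianRing R]
    [IsDomain R] [IsIntegrallyClosed R] (d : ℕ)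
    (hd : 2 ≤ d) (hCM : IsCMLocalOfDim R d)
    (M : Type u) [AddCommGroup M] [Module R M] [Module.Finite R M]
    (hG : FiniteGdim R (M →ₗ[R] R))
    (h1 : ∀ i : ℕ, 1 ≤ i → i ≤ d →
      Subsingleton (ExtMod R (ModuleCat.of R M) (ModuleCat.of R R) i))
    (h2 : ∀ j : ℕ, 1 ≤ j → j ≤ d - 1 →
      Subsingleton (ExtMod R (ModuleCat.of R M) (ModuleCat.of R M) j)) :
    Module.Free R M := by
  exact ARC.main R d hCM M hG hd (fun i hi hi' => ARC.ext_of_extMod R _ _ i (h1 i hi hi'))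
    (fun j hj hj' => ARC.ext_of_extMod R _ _ j (h2 j hj hj'))
end

section
/- Let R be a Cohen-Macaulay local ring. If M is a finitely generated R-module with G-dim_R(Hom_R(M,R)) < ∞ and pd_R(Hom_R(M,M)) < ∞, and Ext^i_R(M,M) = Ext^i_R(M,R) = 0 for all i ≥ 1, then M is free. -/
open CategoryTheory Opposite

universe u

/-- Comparison of the two notions of Ext, at the level of vanishing. -/
theorem subsingleton_extMod_iff (R : Type u) [CommRing R] (X Y : ModuleCat.{u} R) (n : ℕ) :
    Subsingleton (ExtMod R X Y n) ↔ Subsingleton (Abelian.Ext X Y n) := by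
  let P : ProjectiveResolution X := (inferInstance : HasProjectiveResolution X).out.some
  have h1 : ∀ p, (ComplexShape.up ℕ).prev n = p → (Subsingleton (ExtMod R X Y n) ↔
      ∀ f : P.complex.X n ⟶ Y, P.complex.d (n+1) n ≫ f = 0 →
        ∃ g : P.complex.X p ⟶ Y, P.complex.d n p ≫ g = f) := by
    intro p hp
    have e := P.isoExt (R := R) n Y
    rw [ExtMod, ← ModuleCat.isZero_iff_subsingleton, e.isZero_iff,
      ← HomologicalComplex.exactAt_iff_isZero_homology,
      HomologicalComplex.exactAt_iff' _ p n (n+1) hp (by simp),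
      ShortComplex.moduleCat_exact_iff]
    rfl
  cases n with
  | zero =>
    rw [h1 0 (by simp)]
    have hex := P.exact₀
    have he : Epi (ShortComplex.mk _ _ P.complex_d_comp_π_f_zero).g :=
      (inferInstance : Epi (P.π.f 0))
    constructor
    · intro H
      have : Subsingleton (X ⟶ Y) := by
        refine subsingleton_of_forall_eq 0 fun x => ?_
        obtain ⟨g, hg⟩ := H ((ShortComplex.mk _ _ P.complex_d_comp_π_f_zero).g ≫ x)
          ((ShortComplex.mk _ _ P.complex_d_comp_π_f_zero).zero_assoc x |>.trans Limits.zero_comp)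
        rw [P.complex.shape 0 0 (by simp), Limits.zero_comp] at hg
        exact (cancel_epi (ShortComplex.mk _ _ P.complex_d_comp_π_f_zero).g).1
          (hg.symm.trans Limits.comp_zero.symm)
      exact Abelian.Ext.addEquiv₀.toEquiv.subsingleton
    · intro H f hf
      have : Subsingleton (X ⟶ Y) := Abelian.Ext.addEquiv₀.symm.toEquiv.subsingleton
      refine ⟨0, ?_⟩
      have h3 := P.exact₀.g_desc f hf
      rw [Limits.comp_zero, ← h3]
      have : P.exact₀.desc f hf = 0 := Subsingleton.elim (α := X ⟶ Y) _ _
      rw [this, Limits.comp_zero]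
  | succ n =>
    rw [h1 n (by simp)]
    constructor
    · intro H
      refine subsingleton_of_forall_eq 0 fun x => ?_
      obtain ⟨f, hf, rfl⟩ := P.extMk_surjective x (n+2) rfl
      exact (P.extMk_eq_zero_iff f _ rfl hf n rfl).2 (H f hf)
    · intro H f hf
      exact (P.extMk_eq_zero_iff f _ rfl hf n rfl).1 (Subsingleton.elim _ _)

section Unbundled

open CategoryTheory.Abelian

variable {R : Type u} [CommRing R]
variable {X A B C Y : Type u} [AddCommGroup X] [Module R X] [AddCommGroup A] [Module R A]
  [AddCommGroup B] [Module R B] [AddCommGroup C] [Module R C] [AddCommGroup Y] [Module R Y]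

/-- Unbundled Ext. -/
abbrev EX (R : Type u) [CommRing R] (A B : Type u) [AddCommGroup A] [Module R A]
    [AddCommGroup B] [Module R B] (n : ℕ) : Type u :=
  Abelian.Ext (ModuleCat.of R A) (ModuleCat.of R B) n

/-- Functoriality in the second variable. -/
noncomputable def push {n : ℕ} (f : A →ₗ[R] B) (x : EX R X A n) : EX R X B n :=
  x.comp (Ext.mk₀ (ModuleCat.ofHom f)) (add_zero n)

theorem push_push {n : ℕ} (f : A →ₗ[R] B) (g : B →ₗ[R] C) (x : EX R X A n) :
    push g (push f x) = push (g ∘ₗ f) x := by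
  unfold push
  rw [Ext.comp_assoc_of_third_deg_zero, Ext.mk₀_comp_mk₀]
  rfl

theorem push_id {n : ℕ} (x : EX R X A n) : push LinearMap.id x = x := by
  unfold push
  rw [ModuleCat.ofHom_id, Ext.comp_mk₀_id]

theorem push_zero {n : ℕ} (f : A →ₗ[R] B) : push f (0 : EX R X A n) = 0 := by
  unfold push
  rw [Ext.zero_comp]

theorem zero_push {n : ℕ} (x : EX R X A n) : push (0 : A →ₗ[R] B) x = 0 := by
  unfold push
  rw [ModuleCat.ofHom_zero, Ext.mk₀_zero, Ext.comp_zero]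

theorem add_push {n : ℕ} (f g : A →ₗ[R] B) (x : EX R X A n) :
    push (f + g) x = push f x + push g x := by
  unfold push
  rw [ModuleCat.ofHom_add, Ext.mk₀_add, Ext.comp_add]

theorem smul_push {n : ℕ} (a : R) (ha : ∀ y : X, a • y = 0) (f : A →ₗ[R] B) (x : EX R X A n) :
    push (a • f) x = 0 := by
  unfold push
  rw [show ModuleCat.ofHom (a • f) = a • ModuleCat.ofHom f from rfl, Ext.mk₀_smul, Ext.comp_smul, ← Ext.smul_comp]
  have h : a • x = 0 := by
    rw [show a • x = (Ext.mk₀ (a • 𝟙 (ModuleCat.of R X))).comp x (zero_add n) by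
      simp [Ext.mk₀_smul]]
    have : a • 𝟙 (ModuleCat.of R X) = 0 := by
      ext y
      exact ha y
    rw [this, Ext.mk₀_zero, Ext.zero_comp]
  rw [h, Ext.zero_comp]

theorem sexact {f : A →ₗ[R] B} {g : B →ₗ[R] C} (hf : Function.Injective f)
    (hg : Function.Surjective g) (hfg : Function.Exact f g) :
    (ShortComplex.mk (ModuleCat.ofHom f) (ModuleCat.ofHom g)
      (by ext x; exact hfg.apply_apply_eq_zero x)).ShortExact :=
  ModuleCat.shortComplex_shortExact _ hfg hf hg

section
variable {f : A →ₗ[R] B} {g : B →ₗ[R] C} (hf : Function.Injective f)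
    (hg : Function.Surjective g) (hfg : Function.Exact f g)
include hf hg hfg

theorem cov_inj {m : ℕ} (h : ∀ n, n + 1 = m → Subsingleton (EX R X C n)) (x : EX R X A m)
    (hx : push f x = 0) : x = 0 := by
  cases m with
  | zero =>
    have : Mono (ModuleCat.ofHom f) := (sexact hf hg hfg).mono_f
    have := Ext.postcomp_mk₀_injective_of_mono (ModuleCat.of R X) (ModuleCat.ofHom f)
    apply this
    rw [map_zero]
    exact hx
  | succ m =>
    obtain ⟨y, hy⟩ := Ext.covariant_sequence_exact₁ _ (sexact hf hg hfg) x hx rfl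
    have := h m rfl
    have h0 : y = 0 := @Subsingleton.elim _ (h m rfl) _ _
    rw [← hy, h0, Ext.zero_comp]

theorem cov_mid {m : ℕ} (x : EX R X B m) (hx : push g x = 0) : ∃ y : EX R X A m, push f y = x :=
  Ext.covariant_sequence_exact₂ _ (sexact hf hg hfg) x hx

theorem cov_vanish {m : ℕ} (h : ∀ n, n + 1 = m → Subsingleton (EX R X C n))
    (h' : Subsingleton (EX R X B m)) : Subsingleton (EX R X A m) :=
  subsingleton_of_forall_eq 0 fun x => cov_inj hf hg hfg h x (Subsingleton.elim _ _)

theorem con_vanish_left {n : ℕ} (h : Subsingleton (EX R B Y n))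
    (h' : Subsingleton (EX R C Y (n+1))) : Subsingleton (EX R A Y n) := by
  refine subsingleton_of_forall_eq 0 fun x => ?_
  obtain ⟨y, hy⟩ := Ext.contravariant_sequence_exact₁ (sexact hf hg hfg) _ x
    (add_comm 1 n) (@Subsingleton.elim _ h' _ _)
  rw [← hy, show y = 0 from @Subsingleton.elim _ h _ _, Ext.comp_zero]

theorem con_vanish_right {n : ℕ} (h : Subsingleton (EX R A Y n))
    (h' : Subsingleton (EX R B Y (n+1))) : Subsingleton (EX R C Y (n+1)) := by
  refine subsingleton_of_forall_eq 0 fun x => ?_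
  obtain ⟨y, hy⟩ := Ext.contravariant_sequence_exact₃ (sexact hf hg hfg) _ x
    (@Subsingleton.elim _ h' _ _) (add_comm 1 n)
  rw [← hy, show y = 0 from @Subsingleton.elim _ h _ _, Ext.comp_zero]

theorem con_extend (h : Subsingleton (EX R C Y 1)) (φ : A →ₗ[R] Y) :
    ∃ ψ : B →ₗ[R] Y, ψ ∘ₗ f = φ := by
  obtain ⟨y, hy⟩ := Ext.contravariant_sequence_exact₁ (sexact hf hg hfg) _
    (Ext.mk₀ (ModuleCat.ofHom φ)) (add_zero 1) (@Subsingleton.elim _ h _ _)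
  obtain ⟨ψ, rfl⟩ := Ext.addEquiv₀.symm.surjective y
  refine ⟨ψ.hom, ?_⟩
  have h2 : ModuleCat.ofHom f ≫ ψ = ModuleCat.ofHom φ := by
    apply Ext.addEquiv₀.symm.injective
    simpa using hy
  simpa using congrArg ModuleCat.Hom.hom h2

theorem con_ext_one (h : ∀ φ : A →ₗ[R] Y, ∃ ψ : B →ₗ[R] Y, ψ ∘ₗ f = φ)
    (h' : Subsingleton (EX R B Y 1)) : Subsingleton (EX R C Y 1) := by
  refine subsingleton_of_forall_eq 0 fun x => ?_
  obtain ⟨y, hy⟩ := Ext.contravariant_sequence_exact₃ (sexact hf hg hfg) _ x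
    (@Subsingleton.elim _ h' _ _) (add_zero 1)
  obtain ⟨φ, rfl⟩ := Ext.addEquiv₀.symm.surjective y
  obtain ⟨ψ, hψ⟩ := h φ.hom
  have : φ = (ShortComplex.mk (ModuleCat.ofHom f) (ModuleCat.ofHom g)
      (by ext x; exact hfg.apply_apply_eq_zero x)).f ≫ ModuleCat.ofHom ψ := by
    ext a
    exact (LinearMap.congr_fun hψ a).symm
  rw [← hy, Ext.addEquiv₀_symm_apply, this, ← Ext.mk₀_comp_mk₀]
  exact (sexact hf hg hfg).extClass_comp_assoc _
end

/-- Vanishing of all higher Ext. -/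
def XV (R : Type u) [CommRing R] (A Y : Type u) [AddCommGroup A] [Module R A]
    [AddCommGroup Y] [Module R Y] : Prop :=
  ∀ i, 1 ≤ i → Subsingleton (EX R A Y i)

theorem XV_proj [Module.Projective R A] : XV R A Y := by
  intro i hi
  obtain ⟨n, rfl⟩ := Nat.exists_eq_add_of_le' hi
  exact subsingleton_of_forall_eq 0 fun x => Ext.eq_zero_of_projective x

theorem XV_ker {f : A →ₗ[R] B} {g : B →ₗ[R] C} (hf : Function.Injective f)
    (hg : Function.Surjective g) (hfg : Function.Exact f g) (hB : XV R B Y) (hC : XV R C Y) :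
    XV R A Y := fun i hi =>
  con_vanish_left hf hg hfg (hB i hi) (hC (i+1) (by lia))

end Unbundled

section LocalPart

variable {R : Type u} [CommRing R]
variable {X A B C Y : Type u} [AddCommGroup X] [Module R X] [AddCommGroup A] [Module R A]
  [AddCommGroup B] [Module R B] [AddCommGroup C] [Module R C] [AddCommGroup Y] [Module R Y]

theorem sum_push {n : ℕ} {ι : Type*} (s : Finset ι) (f : ι → (A →ₗ[R] B)) (x : EX R X A n) :
    push (∑ i ∈ s, f i) x = ∑ i ∈ s, push (f i) x := by
  classical
  induction s using Finset.induction_on with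
  | empty => simp [zero_push]
  | insert a s ha ih => rw [Finset.sum_insert ha, Finset.sum_insert ha, add_push, ih]

theorem hom_exact {f : A →ₗ[R] B} {g : B →ₗ[R] C} (hf : Function.Injective f)
    (hg : Function.Surjective g) (hfg : Function.Exact f g) (h : Subsingleton (EX R C Y 1)) :
    Function.Injective (LinearMap.lcomp R Y g) ∧ Function.Surjective (LinearMap.lcomp R Y f) ∧
      Function.Exact (LinearMap.lcomp R Y g) (LinearMap.lcomp R Y f) := by
  refine ⟨?_, fun φ => con_extend hf hg hfg h φ, ?_⟩
  · intro a b hab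
    ext c
    obtain ⟨b', rfl⟩ := hg c
    exact LinearMap.congr_fun hab b'
  · intro φ
    constructor
    · intro hφ
      refine ⟨(LinearMap.ker g).liftQ φ ?_ ∘ₗ (g.quotKerEquivOfSurjective hg).symm.toLinearMap, ?_⟩
      · intro b hb
        obtain ⟨a, rfl⟩ := (hfg b).1 hb
        exact LinearMap.congr_fun hφ a
      · ext b
        have : (g.quotKerEquivOfSurjective hg).symm (g b) = Submodule.Quotient.mk b := by
          rw [LinearEquiv.symm_apply_eq]; rfl
        simp [this]
    · rintro ⟨ψ, rfl⟩
      ext a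
      simp [hfg.apply_apply_eq_zero]

theorem ker_exact (g : B →ₗ[R] C) :
    Function.Injective (LinearMap.ker g).subtype ∧ Function.Exact (LinearMap.ker g).subtype g :=
  ⟨Subtype.val_injective, LinearMap.exact_subtype_ker_map g⟩

variable [IsLocalRing R]

/-- `Ext^i(k, K) = 0` for `i < j`. -/
def DV (R : Type u) [CommRing R] [IsLocalRing R] (j : ℕ) (K : Type u) [AddCommGroup K]
    [Module R K] : Prop :=
  ∀ i, i < j → Subsingleton (EX R (IsLocalRing.ResidueField R) K i)

theorem DV_ker {f : A →ₗ[R] B} {g : B →ₗ[R] C} (hf : Function.Injective f)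
    (hg : Function.Surjective g) (hfg : Function.Exact f g) {j : ℕ} (hB : DV R (j+1) B)
    (hC : DV R j C) : DV R (j+1) A := fun i hi =>
  cov_vanish hf hg hfg (fun n hn => hC n (by lia)) (hB i hi)

theorem DV_mono {i j : ℕ} (hij : i ≤ j) (h : DV R j A) : DV R i A :=
  fun n hn => h n (by lia)

theorem DV_ker' {f : A →ₗ[R] B} {g : B →ₗ[R] C} (hf : Function.Injective f)
    (hg : Function.Surjective g) (hfg : Function.Exact f g) {j : ℕ} (hB : DV R j B)
    (hC : DV R j C) : DV R j A := by
  cases j with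
  | zero => intro i hi; lia
  | succ j => exact DV_ker hf hg hfg hB (DV_mono (by lia) hC)

theorem DV_equiv (e : A ≃ₗ[R] B) {j : ℕ} (h : DV R j A) : DV R j B := by
  intro i hi
  refine subsingleton_of_forall_eq 0 fun x => ?_
  have := h i hi
  rw [← push_id x, show (LinearMap.id : B →ₗ[R] B) = e.toLinearMap ∘ₗ e.symm.toLinearMap by
    ext; simp, ← push_push, show push e.symm.toLinearMap x = 0 from Subsingleton.elim _ _,
    push_zero]

theorem DV_pi {n : ℕ} {j : ℕ} (h : DV R j A) : DV R j (Fin n → A) := by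
  intro i hi
  refine subsingleton_of_forall_eq 0 fun x => ?_
  have := h i hi
  rw [← push_id x, show (LinearMap.id : (Fin n → A) →ₗ[R] (Fin n → A)) =
    ∑ i, LinearMap.single R (fun _ => A) i ∘ₗ LinearMap.proj i by
      refine LinearMap.ext fun v => ?_
      simp [LinearMap.sum_apply, Finset.univ_sum_single], sum_push]
  refine Finset.sum_eq_zero fun i _ => ?_
  rw [← push_push, show push (LinearMap.proj i) x = 0 from Subsingleton.elim _ _, push_zero]

theorem DV_hom_pi {n : ℕ} {j : ℕ} (h : DV R j Y) : DV R j ((Fin n → R) →ₗ[R] Y) :=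
  DV_equiv ((Pi.basisFun R (Fin n)).constr R) (DV_pi h)

theorem DV_hom [IsNoetherianRing R] {j : ℕ} (hY : DV R j Y) (A : Type u) [AddCommGroup A]
    [Module R A] [Module.Finite R A] (h : XV R A Y) : DV R j (A →ₗ[R] Y) := by
  induction j generalizing A with
  | zero => intro i hi; lia
  | succ j ih =>
    obtain ⟨n, g, hg⟩ := Module.Finite.exists_fin' R A
    obtain ⟨h1, h2⟩ := ker_exact g
    obtain ⟨e1, e2, e3⟩ := hom_exact h1 hg h2 (h 1 le_rfl)
    exact DV_ker e1 e2 e3 (DV_hom_pi hY)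
      (ih (DV_mono (by lia) hY) _ (XV_ker h1 hg h2 XV_proj h))

theorem push_residue {n j : ℕ} (μ : (Fin n → R) →ₗ[R] R)
    (hμ : ∀ v, μ v ∈ IsLocalRing.maximalIdeal R) (e : EX R (IsLocalRing.ResidueField R) R j) :
    push (LinearMap.toSpanSingleton R ((Fin n → R) →ₗ[R] R) μ) e = 0 := by
  have : LinearMap.toSpanSingleton R ((Fin n → R) →ₗ[R] R) μ =
      ∑ i, μ (Pi.single i 1) • LinearMap.toSpanSingleton R ((Fin n → R) →ₗ[R] R)
        (LinearMap.proj i) := by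
    ext i
    simp [LinearMap.sum_apply, Pi.single_apply]
  rw [this, sum_push]
  refine Finset.sum_eq_zero fun i _ => smul_push _ (fun y => ?_) _ _
  rw [Algebra.smul_def, IsLocalRing.ResidueField.algebraMap_eq,
    (IsLocalRing.residue_eq_zero_iff _).2 (hμ _), zero_mul]

theorem exists_functional [Module.Finite R B] (φ : A →ₗ[R] B) (hφ : ¬ Function.Surjective φ) :
    ∃ α : B →ₗ[R] IsLocalRing.ResidueField R, α ≠ 0 ∧ α ∘ₗ φ = 0 := by
  have : Nontrivial (B ⧸ LinearMap.range φ) := by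
    rw [Submodule.Quotient.nontrivial_iff]
    rwa [Ne, LinearMap.range_eq_top]
  have hT : Nontrivial (TensorProduct R (IsLocalRing.ResidueField R) (B ⧸ LinearMap.range φ)) := by
    rw [← not_subsingleton_iff_nontrivial, IsLocalRing.subsingleton_tensorProduct,
      not_subsingleton_iff_nontrivial]
    exact this
  obtain ⟨x, hx⟩ := exists_ne (0 : TensorProduct R (IsLocalRing.ResidueField R)
    (B ⧸ LinearMap.range φ))
  have hf : ∃ f : Module.Dual (IsLocalRing.ResidueField R) (TensorProduct R
      (IsLocalRing.ResidueField R) (B ⧸ LinearMap.range φ)), f x ≠ 0 := by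
    by_contra! H
    exact hx ((Module.forall_dual_apply_eq_zero_iff _ x).1 H)
  obtain ⟨f, hf⟩ := hf
  refine ⟨f.restrictScalars R ∘ₗ TensorProduct.mk R _ _ 1 ∘ₗ (LinearMap.range φ).mkQ, ?_, ?_⟩
  · intro H
    apply hf
    have : f = 0 := by
      refine LinearMap.ext fun t => ?_
      induction t using TensorProduct.induction_on with
      | zero => simp
      | add a b ha hb => simp [ha, hb]
      | tmul c q =>
        obtain ⟨b, rfl⟩ := Submodule.mkQ_surjective _ q
        have := LinearMap.congr_fun H b
        rw [show c ⊗ₜ[R] (LinearMap.range φ).mkQ b = c • ((1 : IsLocalRing.ResidueField R) ⊗ₜ[R]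
          (LinearMap.range φ).mkQ b) by rw [TensorProduct.smul_tmul']; simp, map_smul]
        simp at this
        simp [this]
    rw [this]; rfl
  · ext a
    have : (LinearMap.range φ).mkQ (φ a) = 0 := by simp
    simp only [LinearMap.comp_apply, this, map_zero]
    rfl

end LocalPart

section Key

variable {R : Type u} [CommRing R] [IsLocalRing R] [IsNoetherianRing R]

theorem lift_residue {n : ℕ} (α : (Fin n → R) →ₗ[R] IsLocalRing.ResidueField R) :
    ∃ lam : (Fin n → R) →ₗ[R] R, ∀ v, IsLocalRing.residue R (lam v) = α v := by
  obtain ⟨l, hl⟩ := Module.projective_lifting_property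
    (Algebra.linearMap R (IsLocalRing.ResidueField R)) α IsLocalRing.residue_surjective
  exact ⟨l, fun v => LinearMap.congr_fun hl v⟩

theorem key {d : ℕ} (hR : DV R d R) (hne : Nontrivial (EX R (IsLocalRing.ResidueField R) R d))
    {A B C : Type u} [AddCommGroup A] [Module R A] [Module.Finite R A]
    [AddCommGroup B] [Module R B] [Module.Finite R B] [AddCommGroup C] [Module R C]
    (hA : XV R A R) (hB : XV R B R) (φ : A →ₗ[R] B)
    (π : (A →ₗ[R] R) →ₗ[R] C) (hinj : Function.Injective (LinearMap.lcomp R R φ))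
    (hsurj : Function.Surjective π) (hex : Function.Exact (LinearMap.lcomp R R φ) π)
    (hC : DV R d C) : Function.Surjective φ := by
  by_contra hφ
  obtain ⟨α, hα0, hαφ⟩ := exists_functional φ hφ
  -- free covers
  obtain ⟨b, p, hp⟩ := Module.Finite.exists_fin' R B
  obtain ⟨a, q, hq⟩ := Module.Finite.exists_fin' R A
  obtain ⟨p1, p2⟩ := ker_exact p
  obtain ⟨q1, q2⟩ := ker_exact q
  have hB' : XV R (LinearMap.ker p) R := XV_ker p1 hp p2 XV_proj hB
  have hA' : XV R (LinearMap.ker q) R := XV_ker q1 hq q2 XV_proj hA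
  obtain ⟨c, r, hr⟩ := Module.Finite.exists_fin' R (LinearMap.ker p)
  obtain ⟨r1, r2⟩ := ker_exact r
  have hB'' : XV R (LinearMap.ker r) R := XV_ker r1 hr r2 XV_proj hB'
  obtain ⟨s1, s2, s3⟩ := hom_exact (Y := R) p1 hp p2 (hB 1 le_rfl)
  obtain ⟨t1, t2, t3⟩ := hom_exact (Y := R) r1 hr r2 (hB' 1 le_rfl)
  obtain ⟨u1, u2, u3⟩ := hom_exact (Y := R) q1 hq q2 (hA 1 le_rfl)
  obtain ⟨lam, hlam⟩ := lift_residue (α ∘ₗ p)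
  obtain ⟨e, he⟩ := exists_ne (0 : EX R (IsLocalRing.ResidueField R) R d)
  -- the functional `lam` takes a unit value
  have hv : ∃ v, lam v = 1 := by
    obtain ⟨w, hw⟩ : ∃ w, α w ≠ 0 := by
      by_contra! H
      exact hα0 (LinearMap.ext H)
    obtain ⟨v, rfl⟩ := hp w
    have hu : IsUnit (lam v) := by
      rw [← IsLocalRing.residue_ne_zero_iff_isUnit, hlam]
      exact hw
    obtain ⟨u, hu⟩ := hu
    exact ⟨(↑u⁻¹ : R) • v, by rw [map_smul, ← hu]; simp⟩
  obtain ⟨v, hv⟩ := hv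
  let j := LinearMap.toSpanSingleton R ((Fin b → R) →ₗ[R] R) lam
  have hjne : push j e ≠ 0 := by
    intro H
    apply he
    have := congrArg (push (LinearMap.applyₗ v : ((Fin b → R) →ₗ[R] R) →ₗ[R] R)) H
    rw [push_push, push_zero] at this
    rw [← push_id e, ← this]
    congr 1
    ext
    simp [j, hv]
  -- it comes from `Ext (k, B*)`
  have h1 : push (LinearMap.lcomp R R (LinearMap.ker p).subtype) (push j e) = 0 := by
    refine cov_inj t1 t2 t3 (fun n hn => DV_hom hR _ hB'' n (by lia)) _ ?_
    rw [push_push, push_push]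
    have : LinearMap.lcomp R R r ∘ₗ LinearMap.lcomp R R (LinearMap.ker p).subtype ∘ₗ j =
      LinearMap.toSpanSingleton R ((Fin c → R) →ₗ[R] R)
        (lam ∘ₗ (LinearMap.ker p).subtype ∘ₗ r) := by
      ext; simp [j]
    rw [LinearMap.comp_assoc, this]
    refine push_residue _ (fun w => ?_) e
    rw [← IsLocalRing.residue_eq_zero_iff]
    simp only [LinearMap.comp_apply, hlam, Submodule.subtype_apply]
    rw [LinearMap.mem_ker.1 (r w).2, map_zero]
  obtain ⟨x, hx⟩ := cov_mid s1 s2 s3 _ h1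
  have hx0 : push (LinearMap.lcomp R R φ) x = 0 := by
    refine cov_inj u1 u2 u3 (fun n hn => DV_hom hR _ hA' n (by lia)) _ ?_
    obtain ⟨l, hl⟩ := Module.projective_lifting_property p (φ ∘ₗ q) hp
    rw [push_push, show LinearMap.lcomp R R q ∘ₗ LinearMap.lcomp R R φ =
      LinearMap.lcomp R R l ∘ₗ LinearMap.lcomp R R p by
        ext f : 1
        change (f ∘ₗ φ) ∘ₗ q = (f ∘ₗ p) ∘ₗ l
        rw [LinearMap.comp_assoc, LinearMap.comp_assoc, hl], ← push_push, hx, push_push]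
    have : LinearMap.lcomp R R l ∘ₗ j =
      LinearMap.toSpanSingleton R ((Fin a → R) →ₗ[R] R) (lam ∘ₗ l) := by
      ext; simp [j]
    rw [this]
    refine push_residue _ (fun w => ?_) e
    rw [← IsLocalRing.residue_eq_zero_iff]
    have h2 : p (l w) = φ (q w) := LinearMap.congr_fun hl w
    simp only [LinearMap.comp_apply, hlam, h2]
    exact LinearMap.congr_fun hαφ (q w)
  have hx00 : x = 0 := cov_inj hinj hsurj hex (fun n hn => hC n (by lia)) x hx0
  rw [hx00, push_zero] at hx
  exact hjne hx.symm

end Key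

section Final

open CategoryTheory.Abelian

variable {R : Type u} [CommRing R]
variable {A B C Y : Type u} [AddCommGroup A] [Module R A]
  [AddCommGroup B] [Module R B] [AddCommGroup C] [Module R C] [AddCommGroup Y] [Module R Y]

/-- Functoriality in the first variable. -/
noncomputable def pull {n : ℕ} (f : A →ₗ[R] B) (x : EX R B Y n) : EX R A Y n :=
  (Ext.mk₀ (ModuleCat.ofHom f)).comp x (zero_add n)

theorem pull_pull {n : ℕ} (f : A →ₗ[R] B) (g : B →ₗ[R] C) (x : EX R C Y n) :
    pull f (pull g x) = pull (g ∘ₗ f) x := by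
  unfold pull
  rw [Ext.mk₀_comp_mk₀_assoc]
  rfl

theorem pull_id {n : ℕ} (x : EX R A Y n) : pull LinearMap.id x = x := by
  unfold pull
  rw [ModuleCat.ofHom_id, Ext.mk₀_id_comp]

theorem pull_zero {n : ℕ} (f : A →ₗ[R] B) : pull f (0 : EX R B Y n) = 0 := by
  unfold pull
  rw [Ext.comp_zero]

theorem zero_pull {n : ℕ} (x : EX R B Y n) : pull (0 : A →ₗ[R] B) x = 0 := by
  unfold pull
  rw [ModuleCat.ofHom_zero, Ext.mk₀_zero, Ext.zero_comp]

theorem add_pull {n : ℕ} (f g : A →ₗ[R] B) (x : EX R B Y n) :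
    pull (f + g) x = pull f x + pull g x := by
  unfold pull
  rw [ModuleCat.ofHom_add, Ext.mk₀_add, Ext.add_comp]

theorem sum_pull {n : ℕ} {ι : Type*} (s : Finset ι) (f : ι → (A →ₗ[R] B)) (x : EX R B Y n) :
    pull (∑ i ∈ s, f i) x = ∑ i ∈ s, pull (f i) x := by
  classical
  induction s using Finset.induction_on with
  | empty => simp [zero_pull]
  | insert a s ha ih => rw [Finset.sum_insert ha, Finset.sum_insert ha, add_pull, ih]

theorem XV_pi {n : ℕ} (h : XV R A Y) : XV R (Fin n → A) Y := by
  intro i hi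
  refine subsingleton_of_forall_eq 0 fun x => ?_
  have := h i hi
  rw [← pull_id x, show (LinearMap.id : (Fin n → A) →ₗ[R] (Fin n → A)) =
    ∑ i, LinearMap.single R (fun _ => A) i ∘ₗ LinearMap.proj i by
      refine LinearMap.ext fun v => ?_
      simp [LinearMap.sum_apply, Finset.univ_sum_single], sum_pull]
  refine Finset.sum_eq_zero fun i _ => ?_
  rw [← pull_pull, show pull (LinearMap.single R (fun _ => A) i) x = 0 from
    Subsingleton.elim _ _, pull_zero]

/-- A retraction of a submodule of a projective module makes the quotient projective. -/
theorem proj_of_retraction [Module.Projective R B] {f : A →ₗ[R] B} {g : B →ₗ[R] C}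
    (hf : Function.Injective f) (hg : Function.Surjective g) (hfg : Function.Exact f g)
    (ρ : B →ₗ[R] A) (hρ : ρ ∘ₗ f = LinearMap.id) : Module.Projective R C := by
  obtain ⟨l, hl⟩ := ((Function.Exact.split_tfae' hfg).out 1 0 rfl rfl).1 ⟨hg, ρ, hρ⟩ |>.2
  exact Module.Projective.of_split l g hl

/-- Projective dimension at most `n`, via vanishing of Ext. -/
def PV (R : Type u) [CommRing R] (n : ℕ) (A : Type u) [AddCommGroup A] [Module R A] : Prop :=
  ∀ (Y : Type u) [AddCommGroup Y] [Module R Y] (i : ℕ), n < i → Subsingleton (EX R A Y i)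

theorem PV_of_PdLE (n : ℕ) (E : ModuleCat.{u} R) (h : PdLE R n E) : PV R n E := by
  induction n generalizing E with
  | zero =>
    intro Y _ _ i hi
    have : Module.Projective R E := h
    exact XV_proj i hi
  | succ n ih =>
    obtain ⟨G, g, hG, hg, hk⟩ := h
    intro Y _ _ i hi
    obtain ⟨h1, h2⟩ := ker_exact g
    obtain ⟨j, rfl⟩ : ∃ j, i = j + 1 := ⟨i - 1, by lia⟩
    exact con_vanish_right h1 hg h2 (ih _ hk Y j (by lia)) (XV_proj (j+1) (by lia))

variable [IsLocalRing R]

theorem DV_subsingleton [Subsingleton A] {j : ℕ} : DV R j A := by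
  intro i hi
  refine subsingleton_of_forall_eq 0 fun x => ?_
  rw [← push_id x, show (LinearMap.id : A →ₗ[R] A) = 0 from
    LinearMap.ext fun _ => Subsingleton.elim _ _, zero_push]

theorem depth_facts {d : ℕ} (h : moduleDepth R (ModuleCat.of R R) = d) :
    DV R d R ∧ Nontrivial (EX R (IsLocalRing.ResidueField R) R d) := by
  constructor
  · intro i hi
    rw [← subsingleton_extMod_iff, ← not_nontrivial_iff_subsingleton]
    intro hn
    have : moduleDepth R (ModuleCat.of R R) ≤ i := sInf_le ⟨i, rfl, hn⟩
    rw [h] at this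
    have := Nat.cast_le.1 this
    lia
  · rw [← not_subsingleton_iff_nontrivial, ← subsingleton_extMod_iff,
      not_subsingleton_iff_nontrivial]
    have hne : {i : ℕ∞ | ∃ n : ℕ, i = n ∧ Nontrivial (ExtMod R (ModuleCat.of R
        (IsLocalRing.ResidueField R)) (ModuleCat.of R R) n)}.Nonempty := by
      by_contra H
      rw [Set.not_nonempty_iff_eq_empty] at H
      rw [moduleDepth, H, sInf_empty] at h
      exact ENat.top_ne_natCast d h
    obtain ⟨n, hn, hn'⟩ := csInf_mem hne
    have h2 : (d : ℕ∞) = n := h.symm.trans hn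
    rwa [Nat.cast_inj.1 h2]

variable [IsNoetherianRing R]
variable {d : ℕ} (hR : DV R d R) (hne : Nontrivial (EX R (IsLocalRing.ResidueField R) R d))
include hR hne

theorem key_dual [Module.Finite R A] [Module.Finite R B] {f : A →ₗ[R] B} {g : B →ₗ[R] C}
    (hf : Function.Injective f) (hg : Function.Surjective g) (hfg : Function.Exact f g)
    (eA : Function.Bijective (Module.Dual.eval R A))
    (eB : Function.Bijective (Module.Dual.eval R B))
    (xA : XV R (A →ₗ[R] R) R) (xB : XV R (B →ₗ[R] R) R) (hC : DV R d C) :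
    Function.Surjective (LinearMap.lcomp R R f) := by
  let e : B ≃ₗ[R] ((B →ₗ[R] R) →ₗ[R] R) := LinearEquiv.ofBijective _ eB
  have hcomm : ∀ a, LinearMap.lcomp R R (LinearMap.lcomp R R f) (Module.Dual.eval R A a) =
    e (f a) := fun a => rfl
  refine key hR hne xB xA (LinearMap.lcomp R R f) (g ∘ₗ e.symm.toLinearMap) ?_ ?_ ?_ hC
  · intro x y hxy
    obtain ⟨x, rfl⟩ := eA.2 x
    obtain ⟨y, rfl⟩ := eA.2 y
    have : e (f x) = e (f y) := hxy
    rw [hf (e.injective this)]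
  · exact hg.comp e.symm.surjective
  · intro z
    obtain ⟨b, rfl⟩ := e.surjective z
    have : (g ∘ₗ e.symm.toLinearMap) (e b) = g b := by simp
    rw [this, hfg b]
    constructor
    · rintro ⟨a, rfl⟩
      exact ⟨Module.Dual.eval R A a, rfl⟩
    · rintro ⟨z, hz⟩
      obtain ⟨a, rfl⟩ := eA.2 z
      exact ⟨a, e.injective hz⟩

theorem proj_of_PV (n : ℕ) (E : Type u) [AddCommGroup E] [Module R E] [Module.Finite R E]
    (hE : DV R d E) (h : PV R n E) : Module.Projective R E := by
  induction n generalizing E with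
  | zero =>
    obtain ⟨n, g, hg⟩ := Module.Finite.exists_fin' R E
    obtain ⟨h1, h2⟩ := ker_exact g
    obtain ⟨ρ, hρ⟩ := con_extend h1 hg h2 (h _ 1 one_pos) LinearMap.id
    exact proj_of_retraction h1 hg h2 ρ hρ
  | succ n ih =>
    obtain ⟨m, g, hg⟩ := Module.Finite.exists_fin' R E
    obtain ⟨h1, h2⟩ := ker_exact g
    have hF : DV R d (Fin m → R) := DV_pi hR
    have hP : Module.Projective R (LinearMap.ker g) := by
      refine ih _ (DV_ker' h1 hg h2 hF hE) ?_
      intro Y _ _ i hi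
      exact con_vanish_left h1 hg h2 (XV_proj i (by lia)) (h Y (i+1) (by lia))
    have hs := key_dual hR hne h1 hg h2 (Module.bijective_dual_eval R _)
      (Module.bijective_dual_eval R _) XV_proj XV_proj hE
    obtain ⟨k, s, hs'⟩ := Module.Finite.exists_fin' R (LinearMap.ker g)
    obtain ⟨t, ht⟩ := Module.projective_lifting_property s LinearMap.id hs'
    choose T hT using fun i : Fin k => hs (LinearMap.proj i ∘ₗ t)
    refine proj_of_retraction h1 hg h2 (s ∘ₗ LinearMap.pi T) ?_
    rw [LinearMap.comp_assoc, ← ht]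
    congr 1
    refine LinearMap.ext fun x => funext fun i => ?_
    exact LinearMap.congr_fun (hT i) x

omit hR hne in
theorem dual_finite [Module.Finite R A] : Module.Finite R (A →ₗ[R] R) := inferInstance

omit [IsLocalRing R] [IsNoetherianRing R] hR hne in
/-- Unbundled version of total reflexivity. -/
theorem tr_bridge (h : TotallyReflexive R A) : Function.Bijective (Module.Dual.eval R A) ∧
    XV R A R ∧ XV R (A →ₗ[R] R) R :=
  ⟨h.1, fun i hi => (subsingleton_extMod_iff _ _ _ _).1 (h.2 i hi).1,
    fun i hi => (subsingleton_extMod_iff _ _ _ _).1 (h.2 i hi).2⟩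

theorem gdim_zero (n : ℕ) (K : ModuleCat.{u} R) (hf : Module.Finite R K) (hK : DV R d K)
    (h : GdimLE R n K) : Function.Bijective (Module.Dual.eval R K) ∧
    XV R K R ∧ XV R (K →ₗ[R] R) R := by
  induction n generalizing K with
  | zero => exact tr_bridge h
  | succ n ih =>
    obtain ⟨G, g, hGf, hG, hg, hk⟩ := h
    obtain ⟨eG, xG, xG'⟩ := tr_bridge hG
    obtain ⟨h1, h2⟩ := ker_exact g
    have hDG : DV R d G := by
      have : Module.Finite R (G →ₗ[R] R) := dual_finite
      have := DV_hom hR (G →ₗ[R] R) xG'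
      exact DV_equiv (LinearEquiv.ofBijective _ eG).symm this
    obtain ⟨eN, xN, xN'⟩ := ih (ModuleCat.of R (LinearMap.ker g))
      (inferInstanceAs (Module.Finite R (LinearMap.ker g))) (DV_ker' h1 hg h2 hDG hK) hk
    have hs := key_dual hR hne h1 hg h2 eN eG xN' xG' hK
    have hK1 : Subsingleton (EX R K R 1) := con_ext_one h1 hg h2 hs (xG 1 le_rfl)
    have xK : XV R K R := by
      intro i hi
      obtain ⟨j, rfl⟩ : ∃ j, i = j + 1 := ⟨i - 1, by lia⟩
      rcases Nat.eq_zero_or_pos j with rfl | hj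
      · exact hK1
      · exact con_vanish_right h1 hg h2 (xN j hj) (xG _ (by lia))
    obtain ⟨e1, e2, e3⟩ := hom_exact (Y := R) h1 hg h2 hK1
    have xK' : XV R (K →ₗ[R] R) R := XV_ker e1 e2 e3 xG' xN'
    refine ⟨⟨?_, ?_⟩, xK, xK'⟩
    · rw [injective_iff_map_eq_zero]
      intro z hz
      obtain ⟨y, rfl⟩ := hg z
      obtain ⟨f1, f2, f3⟩ := hom_exact (Y := R) e1 e2 e3 (xN' 1 le_rfl)
      have : LinearMap.lcomp R R (LinearMap.lcomp R R g) (Module.Dual.eval R G y) = 0 := hz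
      obtain ⟨ψ, hψ⟩ := (f3 _).1 this
      obtain ⟨k, rfl⟩ := eN.2 ψ
      have : Module.Dual.eval R G ((LinearMap.ker g).subtype k) = Module.Dual.eval R G y := hψ
      rw [← eG.1 this]
      exact k.2
    · intro z
      obtain ⟨f1, f2, f3⟩ := hom_exact (Y := R) e1 e2 e3 (xN' 1 le_rfl)
      obtain ⟨w, rfl⟩ := f2 z
      obtain ⟨y, rfl⟩ := eG.2 w
      exact ⟨g y, rfl⟩

theorem eval_bij (M : Type u) [AddCommGroup M] [Module R M] [Module.Finite R M]
    (xM : XV R M R) (eM : Function.Bijective (Module.Dual.eval R (M →ₗ[R] R)))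
    (xD : XV R ((M →ₗ[R] R) →ₗ[R] R) R) : Function.Bijective (Module.Dual.eval R M) := by
  let ev : M →ₗ[R] ((M →ₗ[R] R) →ₗ[R] R) := Module.Dual.eval R M
  have hid : ∀ f : M →ₗ[R] R, LinearMap.lcomp R R ev (Module.Dual.eval R (M →ₗ[R] R) f) = f :=
    fun f => rfl
  have hsur : Function.Surjective ev := by
    refine key (C := PUnit) hR hne xM xD ev 0 ?_ (fun x => ⟨0, Subsingleton.elim _ _⟩) ?_
      DV_subsingleton
    · intro x y hxy
      obtain ⟨x, rfl⟩ := eM.2 x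
      obtain ⟨y, rfl⟩ := eM.2 y
      rw [hid, hid] at hxy
      rw [hxy]
    · intro f
      exact ⟨fun _ => ⟨_, hid f⟩, fun _ => rfl⟩
  refine ⟨?_, hsur⟩
  obtain ⟨h1, h2⟩ := ker_exact ev
  have xK : XV R (LinearMap.ker ev) R := XV_ker h1 hsur h2 xM xD
  have hz : ∀ z : LinearMap.ker ev →ₗ[R] R, z = 0 := by
    intro z
    obtain ⟨ψ, rfl⟩ := con_extend h1 hsur h2 (xD 1 le_rfl) z
    ext k
    exact LinearMap.congr_fun (LinearMap.mem_ker.1 k.2) ψ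
  have hs : Function.Surjective (0 : PUnit.{u+1} →ₗ[R] LinearMap.ker ev) := by
    refine key (C := PUnit) hR hne XV_proj xK 0 0 ?_ (fun x => ⟨0, Subsingleton.elim _ _⟩) ?_
      DV_subsingleton
    · intro x y _
      ext k
      have : (x : LinearMap.ker ev → R) = y := by rw [hz (x : _), hz (y : _)]
      exact congrFun this k
    · intro f
      refine ⟨fun _ => ⟨0, ?_⟩, fun _ => rfl⟩
      ext x
      rw [show x = 0 from Subsingleton.elim _ _, map_zero, map_zero]
  change Function.Injective ev
  rw [injective_iff_map_eq_zero]
  intro m hm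
  obtain ⟨_, hx⟩ := hs ⟨m, hm⟩
  exact (congrArg Subtype.val hx).symm

theorem phi_surj (M : Type u) [AddCommGroup M] [Module R M] [Module.Finite R M]
    (eM : Function.Bijective (Module.Dual.eval R M)) (xD : XV R (M →ₗ[R] R) R)
    (dM : DV R d M) (xMM : XV R M M) [Module.Projective R (M →ₗ[R] M)] {n : ℕ}
    (g : (Fin n → R) →ₗ[R] M) (hg : Function.Surjective g) :
    Function.Surjective (∑ i, LinearMap.lcomp R R (LinearMap.applyₗ (g (Pi.single i 1)) :
      (M →ₗ[R] M) →ₗ[R] M) ∘ₗ LinearMap.proj i :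
      (Fin n → (M →ₗ[R] R)) →ₗ[R] ((M →ₗ[R] M) →ₗ[R] R)) := by
  classical
  set φ : (Fin n → (M →ₗ[R] R)) →ₗ[R] ((M →ₗ[R] M) →ₗ[R] R) :=
    ∑ i, LinearMap.lcomp R R (LinearMap.applyₗ (g (Pi.single i 1)) :
      (M →ₗ[R] M) →ₗ[R] M) ∘ₗ LinearMap.proj i with hφ
  let ε : M ≃ₗ[R] ((M →ₗ[R] R) →ₗ[R] R) := LinearEquiv.ofBijective _ eM
  let W : ((Fin n → (M →ₗ[R] R)) →ₗ[R] R) ≃ₗ[R] ((Fin n → R) →ₗ[R] M) :=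
    (LinearMap.lsum R (fun _ : Fin n => (M →ₗ[R] R)) R).symm ≪≫ₗ
      LinearEquiv.piCongrRight (fun _ => ε.symm) ≪≫ₗ (Pi.basisFun R (Fin n)).constr R
  obtain ⟨h1, h2⟩ := ker_exact g
  obtain ⟨e1, e2, e3⟩ := hom_exact (Y := M) h1 hg h2 (xMM 1 le_rfl)
  have hW : ∀ e : M →ₗ[R] M, W (LinearMap.lcomp R R φ (Module.Dual.eval R (M →ₗ[R] M) e)) =
      LinearMap.lcomp R M g e := by
    intro e
    refine (Pi.basisFun R (Fin n)).ext fun i => ?_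
    simp only [W, LinearEquiv.trans_apply, Module.Basis.constr_basis]
    simp only [LinearEquiv.piCongrRight_apply]
    rw [LinearEquiv.symm_apply_eq]
    ext f
    simp [ε, hφ, LinearMap.sum_apply, Pi.single_apply, apply_ite]
  have hE := Module.bijective_dual_eval R (M →ₗ[R] M)
  refine key hR hne (XV_pi xD) XV_proj φ
    (LinearMap.lcomp R M (LinearMap.ker g).subtype ∘ₗ W.toLinearMap) ?_ ?_ ?_
    (DV_hom dM _ (XV_ker h1 hg h2 XV_proj xMM))
  · intro x y hxy
    obtain ⟨x, rfl⟩ := hE.2 x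
    obtain ⟨y, rfl⟩ := hE.2 y
    have := congrArg W hxy
    rw [hW, hW] at this
    rw [e1 this]
  · exact e2.comp W.surjective
  · intro α
    rw [LinearMap.comp_apply]
    refine (e3 (W α)).trans ?_
    constructor
    · rintro ⟨e, he⟩
      exact ⟨Module.Dual.eval R (M →ₗ[R] M) e, W.injective ((hW e).trans he)⟩
    · rintro ⟨z, rfl⟩
      obtain ⟨e, rfl⟩ := hE.2 z
      exact ⟨e, (hW e).symm⟩

end Final

theorem stmt9 (R : Type u) [CommRing R] [IsLocalRing R] [IsNoetherianRing R]
    (hCM : ∃ d : ℕ, IsCMLocalOfDim R d)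
    (M : Type u) [AddCommGroup M] [Module R M] [Module.Finite R M]
    (hG : FiniteGdim R (M →ₗ[R] R))
    (hpd : FinitePd R (M →ₗ[R] M))
    (h : ∀ i : ℕ, 1 ≤ i →
      Subsingleton (ExtMod R (ModuleCat.of R M) (ModuleCat.of R M) i) ∧
      Subsingleton (ExtMod R (ModuleCat.of R M) (ModuleCat.of R R) i)) :
    Module.Free R M := by
  obtain ⟨d, -, hd⟩ := hCM
  obtain ⟨hR, hne⟩ := depth_facts hd
  have xMM : XV R M M := fun i hi => (subsingleton_extMod_iff _ _ _ _).1 (h i hi).1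
  have xM : XV R M R := fun i hi => (subsingleton_extMod_iff _ _ _ _).1 (h i hi).2
  obtain ⟨g, hg⟩ := hG
  obtain ⟨p, hp⟩ := hpd
  obtain ⟨eD, xD, xDD⟩ := gdim_zero hR hne g (ModuleCat.of R (M →ₗ[R] R))
    (inferInstanceAs (Module.Finite R (M →ₗ[R] R))) (DV_hom hR M xM) hg
  have eM := eval_bij hR hne M xM eD xDD
  have dM : DV R d M := DV_equiv (LinearEquiv.ofBijective _ eM).symm
    (DV_hom hR (M →ₗ[R] R) xD)
  have hE : Module.Projective R (M →ₗ[R] M) :=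
    proj_of_PV hR hne p (M →ₗ[R] M) (DV_hom dM M xMM) (PV_of_PdLE p _ hp)
  have hEf : Module.Free R (M →ₗ[R] M) := Module.free_of_flat_of_isLocalRing
  rcases subsingleton_or_nontrivial M with hM | hM
  · exact Module.Free.of_subsingleton R M
  suffices Module.Projective R M from Module.free_of_flat_of_isLocalRing
  have hEn : Nontrivial (M →ₗ[R] M) := by
    obtain ⟨x, hx⟩ := exists_ne (0 : M)
    exact ⟨LinearMap.id, 0, fun H => hx (LinearMap.congr_fun H x)⟩
  obtain ⟨ι, b⟩ := hEf.exists_basis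
  have hι : Nonempty ι := b.index_nonempty
  obtain ⟨i0⟩ := hι
  obtain ⟨n, q, hq⟩ := Module.Finite.exists_fin' R M
  obtain ⟨f, hf⟩ := phi_surj hR hne M eM xD dM xMM q hq (b.coord i0)
  have hf1 := LinearMap.congr_fun hf (b i0)
  simp [LinearMap.sum_apply] at hf1
  obtain ⟨i, hi⟩ : ∃ i, IsUnit (f i (b i0 (q (Pi.single i 1)))) := by
    by_contra! H
    have : (∑ i, f i (b i0 (q (Pi.single i 1)))) ∈ IsLocalRing.maximalIdeal R :=
      Ideal.sum_mem _ fun i _ => (IsLocalRing.mem_maximalIdeal _).2 (H i)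
    rw [hf1] at this
    exact (IsLocalRing.maximalIdeal.isMaximal R).ne_top ((Ideal.eq_top_iff_one _).2 this)
  obtain ⟨u, hu⟩ := hi
  let m : M := (↑u⁻¹ : R) • b i0 (q (Pi.single i 1))
  have hm : f i m = 1 := by simp [m, ← hu]
  refine Module.Projective.of_split (LinearMap.smulRightₗ (f i) : M →ₗ[R] (M →ₗ[R] M))
    (LinearMap.applyₗ m : (M →ₗ[R] M) →ₗ[R] M) ?_
  ext x
  simp [hm]
end

section
/- Let R be a Cohen-Macaulay local ring and C a semidualizing R-module. If the dual C* = Hom_R(C,R) has finite Gorenstein dimension, then C is isomorphic to R. -/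
open CategoryTheory Opposite

universe u

namespace SD

open CategoryTheory.Abelian

variable {R : Type u} [CommRing R]

/-- Vanishing of `Ext^i(M,N)`. -/
def EV (R : Type u) [CommRing R] (M N : Type u) [AddCommGroup M] [Module R M]
    [AddCommGroup N] [Module R N] (i : ℕ) : Prop :=
  Subsingleton (Abelian.Ext.{u} (ModuleCat.of R M) (ModuleCat.of R N) i)

theorem ev_of_extMod (M N : Type u) [AddCommGroup M] [Module R M]
    [AddCommGroup N] [Module R N] (i : ℕ) (hi : 1 ≤ i)
    (h : Subsingleton (ExtMod R (ModuleCat.of R M) (ModuleCat.of R N) i)) : EV R M N i := by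
  obtain ⟨p, rfl⟩ : ∃ p, i = p + 1 := ⟨i - 1, by omega⟩
  let P := projectiveResolution (ModuleCat.of R M)
  have e := P.isoExt (R := R) (p + 1) (ModuleCat.of R N)
  have hz : Limits.IsZero ((P.complex.linearYonedaObj R (ModuleCat.of R N)).homology (p+1)) := by
    refine Limits.IsZero.of_iso ?_ e.symm
    exact ModuleCat.isZero_of_iff_subsingleton.mpr h
  rw [← HomologicalComplex.exactAt_iff_isZero_homology,
    HomologicalComplex.exactAt_iff' _ p (p+1) (p+2) (by simp) (by simp),
    ShortComplex.moduleCat_exact_iff] at hz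
  refine ⟨fun a b => ?_⟩
  have key : ∀ a : Abelian.Ext.{u} (ModuleCat.of R M) (ModuleCat.of R N) (p+1), a = 0 := by
    intro a
    obtain ⟨f, hf, rfl⟩ := P.extMk_surjective a (p+2) rfl
    rw [P.extMk_eq_zero_iff _ _ _ _ p rfl]
    obtain ⟨g, hg⟩ := hz f hf
    exact ⟨g, hg⟩
  rw [key a, key b]

section

variable {A B E : Type u} [AddCommGroup A] [Module R A] [AddCommGroup B] [Module R B]
  [AddCommGroup E] [Module R E] (M : Type u) [AddCommGroup M] [Module R M]
  {f : A →ₗ[R] B} {g : B →ₗ[R] E}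

/-- Short exact data. -/
structure SES (f : A →ₗ[R] B) (g : B →ₗ[R] E) : Prop where
  inj : Function.Injective f
  ex : Function.Exact f g
  surj : Function.Surjective g

theorem SES.cat (h : SES f g) :
    (ShortComplex.mk (ModuleCat.ofHom f) (ModuleCat.ofHom g)
      (by rw [← ModuleCat.ofHom_comp, h.ex.linearMap_comp_eq_zero]; rfl)).ShortExact := by
  refine { exact := ?_, mono_f := ?_, epi_g := ?_ }
  · rw [ShortComplex.moduleCat_exact_iff]
    exact fun x hx => (h.ex x).mp hx
  · exact (ModuleCat.mono_iff_injective _).mpr h.inj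
  · exact (ModuleCat.epi_iff_surjective _).mpr h.surj

theorem cov3 (h : SES f g) {i : ℕ} (hB : EV R M B i) (hA : EV R M A (i+1)) : EV R M E i := by
  refine ⟨fun a b => ?_⟩
  have key : ∀ x : Abelian.Ext.{u} (ModuleCat.of R M) (ModuleCat.of R E) i, x = 0 := by
    intro x
    obtain ⟨y, rfl⟩ := Ext.covariant_sequence_exact₃ _ h.cat x rfl (hA.elim _ _)
    rw [hB.elim y 0, Ext.zero_comp]
  rw [key a, key b]

theorem cov_lift (h : SES f g) (hA : EV R M A 1) (u : M →ₗ[R] E) : ∃ v : M →ₗ[R] B, g ∘ₗ v = u := by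
  obtain ⟨y, hy⟩ := Ext.covariant_sequence_exact₃ (ModuleCat.of R M) h.cat
    (Ext.mk₀ (ModuleCat.ofHom u)) rfl (hA.elim _ _)
  obtain ⟨v, rfl⟩ := (Ext.mk₀_bijective _ _).2 y
  rw [Ext.mk₀_comp_mk₀] at hy
  have := (Ext.mk₀_bijective _ _).1 hy
  refine ⟨v.hom, ?_⟩
  have := congrArg ModuleCat.Hom.hom this
  simpa using this

theorem cov1 (h : SES f g) (hB : EV R M B 1)
    (hl : ∀ u : M →ₗ[R] E, ∃ v : M →ₗ[R] B, g ∘ₗ v = u) : EV R M A 1 := by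
  refine ⟨fun a b => ?_⟩
  have key : ∀ x : Abelian.Ext.{u} (ModuleCat.of R M) (ModuleCat.of R A) 1, x = 0 := by
    intro x
    obtain ⟨y, rfl⟩ := Ext.covariant_sequence_exact₁ (ModuleCat.of R M) h.cat x (hB.elim _ _) (zero_add 1)
    obtain ⟨v, rfl⟩ := (Ext.mk₀_bijective _ _).2 y
    obtain ⟨w, hw⟩ := hl v.hom
    have : v = ModuleCat.ofHom w ≫ ModuleCat.ofHom g := by
      exact ModuleCat.hom_ext hw.symm
    rw [this, ← Ext.mk₀_comp_mk₀]
    have := h.cat.comp_extClass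
    simp only at this
    rw [Ext.comp_assoc _ _ _ (zero_add 0) (zero_add 1) (by simp), this, Ext.comp_zero]
  rw [key a, key b]

theorem con1 (h : SES f g) {i : ℕ} (hB : EV R B M i) (hE : EV R E M (i+1)) : EV R A M i := by
  refine ⟨fun a b => ?_⟩
  have key : ∀ x : Abelian.Ext.{u} (ModuleCat.of R A) (ModuleCat.of R M) i, x = 0 := by
    intro x
    obtain ⟨y, rfl⟩ := Ext.contravariant_sequence_exact₁ h.cat _ x (add_comm 1 i) (hE.elim _ _)
    rw [hB.elim y 0, Ext.comp_zero]
  rw [key a, key b]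

theorem con2 (h : SES f g) {i : ℕ} (hA : EV R A M i) (hE : EV R E M i) : EV R B M i := by
  refine ⟨fun a b => ?_⟩
  have key : ∀ x : Abelian.Ext.{u} (ModuleCat.of R B) (ModuleCat.of R M) i, x = 0 := by
    intro x
    obtain ⟨y, rfl⟩ := Ext.contravariant_sequence_exact₂ h.cat _ x (hA.elim _ _)
    rw [hE.elim y 0, Ext.comp_zero]
  rw [key a, key b]

theorem con3 (h : SES f g) {i : ℕ} (hA : EV R A M i) (hB : EV R B M (i+1)) : EV R E M (i+1) := by
  refine ⟨fun a b => ?_⟩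
  have key : ∀ x : Abelian.Ext.{u} (ModuleCat.of R E) (ModuleCat.of R M) (i+1), x = 0 := by
    intro x
    obtain ⟨y, rfl⟩ := Ext.contravariant_sequence_exact₃ h.cat _ x (hB.elim _ _) (add_comm 1 i)
    rw [hA.elim y 0, Ext.comp_zero]
  rw [key a, key b]

theorem con_ext (h : SES f g) (hE : EV R E M 1) (u : A →ₗ[R] M) : ∃ v : B →ₗ[R] M, v ∘ₗ f = u := by
  obtain ⟨y, hy⟩ := Ext.contravariant_sequence_exact₁ h.cat (ModuleCat.of R M)
    (Ext.mk₀ (ModuleCat.ofHom u)) (add_zero 1) (hE.elim _ _)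
  obtain ⟨v, rfl⟩ := (Ext.mk₀_bijective _ _).2 y
  rw [Ext.mk₀_comp_mk₀] at hy
  have := (Ext.mk₀_bijective _ _).1 hy
  refine ⟨v.hom, ?_⟩
  have := congrArg ModuleCat.Hom.hom this
  simpa using this

theorem con3' (h : SES f g) (hB : EV R B M 1)
    (hl : ∀ u : A →ₗ[R] M, ∃ v : B →ₗ[R] M, v ∘ₗ f = u) : EV R E M 1 := by
  refine ⟨fun a b => ?_⟩
  have key : ∀ x : Abelian.Ext.{u} (ModuleCat.of R E) (ModuleCat.of R M) 1, x = 0 := by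
    intro x
    obtain ⟨y, rfl⟩ := Ext.contravariant_sequence_exact₃ h.cat _ x (hB.elim _ _) (add_zero 1)
    obtain ⟨v, rfl⟩ := (Ext.mk₀_bijective _ _).2 y
    obtain ⟨w, hw⟩ := hl v.hom
    have : v = ModuleCat.ofHom f ≫ ModuleCat.ofHom w := by
      exact ModuleCat.hom_ext hw.symm
    rw [this, ← Ext.mk₀_comp_mk₀]
    have := h.cat.extClass_comp
    simp only at this
    rw [← Ext.comp_assoc _ _ _ (add_zero 1) (zero_add 0) (by simp), this, Ext.zero_comp]
  rw [key a, key b]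

theorem ev_proj [Module.Projective R A] (i : ℕ) : EV R A M (i+1) := by
  have : Projective (ModuleCat.of R A) := (IsProjective.iff_projective A).mp inferInstance
  exact ⟨fun a b => by rw [Ext.eq_zero_of_projective a, Ext.eq_zero_of_projective b]⟩

theorem ev_retract_left {i : ℕ} (s : A →ₗ[R] B) (r : B →ₗ[R] A) (hrs : r ∘ₗ s = LinearMap.id)
    (h : EV R B M i) : EV R A M i := by
  refine ⟨fun a b => ?_⟩
  have key : ∀ x : Abelian.Ext.{u} (ModuleCat.of R A) (ModuleCat.of R M) i, x = 0 := by
    intro x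
    have h1 : (Ext.mk₀ (ModuleCat.ofHom s)).comp ((Ext.mk₀ (ModuleCat.ofHom r)).comp x (zero_add i))
      (zero_add i) = x := by
      rw [← Ext.comp_assoc _ _ _ (zero_add 0) (zero_add i) (by simp), Ext.mk₀_comp_mk₀,
        ← ModuleCat.ofHom_comp, hrs]
      exact Ext.mk₀_id_comp x
    rw [← h1, h.elim ((Ext.mk₀ (ModuleCat.ofHom r)).comp x (zero_add i)) 0, Ext.comp_zero]
  rw [key a, key b]

theorem ev_pi {ι : Type*} [Finite ι] {i : ℕ} (h : EV R M A i) (e : B ≃ₗ[R] (ι → A)) :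
    EV R M B i := by
  classical
  cases nonempty_fintype ι
  refine ⟨fun a b => ?_⟩
  have key : ∀ x : Abelian.Ext.{u} (ModuleCat.of R M) (ModuleCat.of R B) i, x = 0 := by
    intro x
    let p : ι → (ModuleCat.of R B ⟶ ModuleCat.of R A) := fun j =>
      ModuleCat.ofHom (LinearMap.proj j ∘ₗ e.toLinearMap)
    let s : ι → (ModuleCat.of R A ⟶ ModuleCat.of R B) := fun j =>
      ModuleCat.ofHom (e.symm.toLinearMap ∘ₗ LinearMap.single R (fun _ => A) j)
    have hid : ∑ j, p j ≫ s j = 𝟙 _ := by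
      ext y
      simp only [ModuleCat.hom_sum, LinearMap.sum_apply]
      apply e.injective
      rw [map_sum]
      ext k
      simp [p, s, Finset.sum_apply, Pi.single_apply]
    have h1 : x = x.comp (Ext.mk₀ (𝟙 _)) (add_zero i) := by simp
    rw [h1, ← hid, Ext.mk₀_sum, Ext.comp_sum]
    refine Finset.sum_eq_zero fun j _ => ?_
    rw [← Ext.mk₀_comp_mk₀, ← Ext.comp_assoc _ _ _ (add_zero i) (zero_add 0) (by simp),
      h.elim (x.comp (Ext.mk₀ (p j)) (add_zero i)) 0, Ext.zero_comp]
  rw [key a, key b]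

theorem ev_congr_right {i : ℕ} (h : EV R M A i) (e : B ≃ₗ[R] A) : EV R M B i :=
  ev_pi (ι := Unit) M h (e.trans (LinearEquiv.funUnique Unit R A).symm)

end

section TRsec

variable [IsNoetherianRing R]
variable {A B E : Type u} [AddCommGroup A] [Module R A] [AddCommGroup B] [Module R B]
  [AddCommGroup E] [Module R E]
  {f : A →ₗ[R] B} {g : B →ₗ[R] E}

/-- Totally reflexive, in terms of `EV`. -/
structure TR (R : Type u) [CommRing R] (M : Type u) [AddCommGroup M] [Module R M] : Prop where
  fin : Module.Finite R M
  refl : Function.Bijective (Module.Dual.eval R M)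
  e1 : ∀ i, EV R M R (i+1)
  e2 : ∀ i, EV R (Module.Dual R M) R (i+1)


theorem TR.of (M : Type u) [AddCommGroup M] [Module R M] (hM : Module.Finite R M)
    (h : TotallyReflexive R M) : TR R M :=
  ⟨hM, h.1, fun i => ev_of_extMod _ _ _ (by omega) (h.2 (i+1) (by omega)).1,
    fun i => ev_of_extMod _ _ _ (by omega) (h.2 (i+1) (by omega)).2⟩


theorem dualSES (h : SES f g) (hE : EV R E R 1) : SES g.dualMap f.dualMap := by
  refine ⟨?_, ?_, ?_⟩
  · exact LinearMap.dualMap_injective_of_surjective h.surj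
  · intro u
    constructor
    · intro hu
      have hk : LinearMap.ker g ≤ LinearMap.ker u := by
        intro b hb
        obtain ⟨a, rfl⟩ := (h.ex b).mp hb
        exact congrArg (fun l => l a) hu
      refine ⟨(Submodule.liftQ _ u hk) ∘ₗ (LinearMap.quotKerEquivOfSurjective g h.surj).symm, ?_⟩
      ext b
      have : (LinearMap.quotKerEquivOfSurjective g h.surj).symm (g b) = Submodule.Quotient.mk b := by
        rw [LinearEquiv.symm_apply_eq]; rfl
      simp [LinearMap.dualMap_apply, this]
    · rintro ⟨v, rfl⟩
      ext a
      have := h.ex.apply_apply_eq_zero a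
      simp [this]
  · intro u
    obtain ⟨v, hv⟩ := con_ext R h hE u
    exact ⟨v, hv⟩


theorem refl_dual {M : Type u} [AddCommGroup M] [Module R M]
    (h : Function.Bijective (Module.Dual.eval R M)) :
    Function.Bijective (Module.Dual.eval R (Module.Dual R M)) := by
  have : Module.IsReflexive R M := ⟨h⟩
  exact Module.bijective_dual_eval R (Module.Dual R M)

theorem TR.dual {M : Type u} [AddCommGroup M] [Module R M] (h : TR R M) :
    TR R (Module.Dual R M) := by
  have := h.fin
  refine ⟨inferInstance, refl_dual h.refl, h.e2, fun i => ?_⟩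
  let e := LinearEquiv.ofBijective _ h.refl
  exact ev_retract_left R e.symm.toLinearMap e.toLinearMap (by ext; simp) (h.e1 i)

theorem tr_ext (h : SES f g) (hA : TR R A) (hE : TR R E) : TR R B := by
  have h1 := dualSES h (hE.e1 0)
  have h2 := dualSES h1 (hA.e2 0)
  have := hA.fin
  have := hE.fin
  refine ⟨Module.Finite.of_exact h.ex h.surj, ?_, fun i => con2 R h (hA.e1 i) (hE.e1 i),
    fun i => con2 R h1 (hE.e2 i) (hA.e2 i)⟩
  have c1 : ∀ a, Module.Dual.eval R B (f a) = f.dualMap.dualMap (Module.Dual.eval R A a) :=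
    fun a => rfl
  have c2 : ∀ b, Module.Dual.eval R E (g b) = g.dualMap.dualMap (Module.Dual.eval R B b) :=
    fun a => rfl
  constructor
  · rw [injective_iff_map_eq_zero]
    intro b hb
    have : g b = 0 := hE.refl.1 (by rw [c2, hb, map_zero, map_zero])
    obtain ⟨a, rfl⟩ := (h.ex b).mp this
    rw [c1] at hb
    have := h2.inj (hb.trans (map_zero _).symm)
    have : a = 0 := hA.refl.1 (by rw [this, map_zero])
    rw [this, map_zero]
  · intro x
    obtain ⟨e, he⟩ := hE.refl.2 (g.dualMap.dualMap x)
    obtain ⟨b, rfl⟩ := h.surj e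
    rw [c2] at he
    have : g.dualMap.dualMap (x - Module.Dual.eval R B b) = 0 := by rw [map_sub, he, sub_self]
    obtain ⟨y, hy⟩ := (h2.ex _).mp this
    obtain ⟨a, rfl⟩ := hA.refl.2 y
    refine ⟨b + f a, ?_⟩
    rw [map_add, c1, hy]; abel

theorem tr_syz (h : SES f g) (hB : TR R B) (hE : TR R E) : TR R A := by
  have h1 := dualSES h (hE.e1 0)
  have := hB.fin
  have e20 : EV R (Module.Dual R A) R 1 := by
    refine con3' R h1 (hB.e2 0) fun u => ?_
    obtain ⟨e, rfl⟩ := hE.refl.2 u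
    obtain ⟨b, rfl⟩ := h.surj e
    exact ⟨Module.Dual.eval R B b, rfl⟩
  have h2 := dualSES h1 e20
  refine ⟨Module.Finite.of_injective f h.inj, ?_, fun i => con1 R h (hB.e1 i) (hE.e1 (i+1)), ?_⟩
  · have c1 : ∀ a, Module.Dual.eval R B (f a) = f.dualMap.dualMap (Module.Dual.eval R A a) :=
      fun a => rfl
    have c2 : ∀ b, Module.Dual.eval R E (g b) = g.dualMap.dualMap (Module.Dual.eval R B b) :=
      fun a => rfl
    constructor
    · intro a b hab
      apply h.inj
      apply hB.refl.1
      rw [c1, c1, hab]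
    · intro x
      obtain ⟨b, hb⟩ := hB.refl.2 (f.dualMap.dualMap x)
      have : g b = 0 := by
        apply hE.refl.1
        rw [c2, hb, map_zero]
        exact h2.ex.apply_apply_eq_zero x
      obtain ⟨a, rfl⟩ := (h.ex b).mp this
      exact ⟨a, h2.inj (by rw [← c1, hb])⟩
  · intro i
    cases i with
    | zero => exact e20
    | succ i => exact con3 R h1 (hE.e2 i) (hB.e2 (i+1))


theorem tr_free (F : Type u) [AddCommGroup F] [Module R F] [Module.Free R F] [Module.Finite R F] :
    TR R F :=
  ⟨inferInstance, Module.bijective_dual_eval R F, fun i => ev_proj R i, fun i => ev_proj R i⟩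


theorem ses_ker (g : B →ₗ[R] E) (hg : Function.Surjective g) :
    SES (LinearMap.ker g).subtype g :=
  ⟨Subtype.val_injective, LinearMap.exact_subtype_ker_map g, hg⟩

theorem tr_cosyz {M : Type u} [AddCommGroup M] [Module R M] (h : TR R M) :
    ∃ (L H : ModuleCat.{u} R) (f : M →ₗ[R] L) (g : L →ₗ[R] H), SES f g ∧ TR R H ∧
      Module.Free R L ∧ Module.Finite R L := by
  have := h.dual.fin
  obtain ⟨n, p, hp⟩ := Module.Finite.exists_fin' R (Module.Dual R M)
  have h1 := ses_ker p hp
  have hN := tr_syz h1 (tr_free _) h.dual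
  have h2 := dualSES h1 (h.e2 0)
  let e := LinearEquiv.ofBijective _ h.refl
  refine ⟨ModuleCat.of R (Module.Dual R (Fin n → R)), ModuleCat.of R (Module.Dual R (LinearMap.ker p)),
    p.dualMap ∘ₗ e.toLinearMap, (LinearMap.ker p).subtype.dualMap, ⟨?_, ?_, ?_⟩, hN.dual, ?_, ?_⟩
  · rw [LinearMap.coe_comp]
    exact h2.inj.comp e.injective
  · intro y
    rw [h2.ex y]
    constructor
    · rintro ⟨x, rfl⟩
      exact ⟨e.symm x, by simp⟩
    · rintro ⟨x, rfl⟩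
      exact ⟨e x, rfl⟩
  · exact h2.surj
  · change Module.Free R (Module.Dual R (Fin n → R)); infer_instance
  · change Module.Finite R (Module.Dual R (Fin n → R)); infer_instance

/-- Modules with a finite free resolution. -/
inductive FP (R : Type u) [CommRing R] : ∀ (Y : Type u) [AddCommGroup Y] [Module R Y], Prop
  | zero (Y : Type u) [AddCommGroup Y] [Module R Y] (h : Subsingleton Y) : FP R Y
  | step (Y' L Y : Type u) [AddCommGroup Y'] [Module R Y'] [AddCommGroup L] [Module R L]
      [AddCommGroup Y] [Module R Y] (f : Y' →ₗ[R] L) (g : L →ₗ[R] Y) (h : SES f g)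
      (hf : Module.Free R L) (hfin : Module.Finite R L) (h' : FP R Y') : FP R Y

theorem approx (n : ℕ) (M : ModuleCat.{u} R) (hM : Module.Finite R M) (hG : GdimLE R n M) :
    ∃ (Y H : ModuleCat.{u} R) (f : Y →ₗ[R] H) (g : H →ₗ[R] M), SES f g ∧ TR R H ∧ FP R Y := by
  induction n generalizing M with
  | zero =>
    refine ⟨ModuleCat.of R PUnit, M, 0, LinearMap.id, ⟨?_, ?_, ?_⟩, TR.of _ hM hG, FP.zero _ ?_⟩
    · intro a b _; exact Subsingleton.elim (α := PUnit) a b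
    · intro y
      simp [eq_comm]
    · exact Function.surjective_id
    · change Subsingleton PUnit; infer_instance
  | succ n ih =>
    obtain ⟨G, g0, hGf, hGT, hg0, hK⟩ := hG
    obtain ⟨Y, H, j, a, hs, hH, hY⟩ := ih (ModuleCat.of R (LinearMap.ker g0))
      (by change Module.Finite R (LinearMap.ker g0); infer_instance) hK
    obtain ⟨L, H', b, q, hs', hH', hL1, hL2⟩ := tr_cosyz hH
    let a' : H →ₗ[R] G := (LinearMap.ker g0).subtype ∘ₗ a
    have hga : ∀ x, g0 (a' x) = 0 := fun x => (a x).2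
    have hax : ∀ g, g0 g = 0 → ∃ x, a' x = g := by
      intro g hg
      obtain ⟨x, hx⟩ := hs.surj ⟨g, hg⟩
      exact ⟨x, congrArg Subtype.val hx⟩
    have hay : ∀ x, a' x = 0 → ∃ y, j y = x := by
      intro x hx
      exact (hs.ex x).mp (Subtype.ext hx)
    have haj : ∀ y, a' (j y) = 0 := by
      intro y
      exact congrArg Subtype.val (hs.ex.apply_apply_eq_zero y)
    let S := LinearMap.range (a'.prod b)
    let Z := (G × L) ⧸ S
    let mk : (G × L) →ₗ[R] Z := S.mkQ
    have hmk : ∀ w, mk w = 0 ↔ ∃ x, a' x = w.1 ∧ b x = w.2 := by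
      intro w
      rw [show mk w = 0 ↔ w ∈ S from Submodule.Quotient.mk_eq_zero S]
      constructor
      · rintro ⟨x, rfl⟩; exact ⟨x, rfl, rfl⟩
      · rintro ⟨x, h1, h2⟩; exact ⟨x, Prod.ext h1 h2⟩
    let i1 : G →ₗ[R] Z := mk ∘ₗ LinearMap.inl R G L
    let p1 : Z →ₗ[R] H' := S.liftQ (q ∘ₗ LinearMap.snd R G L) (by
      rintro _ ⟨x, rfl⟩
      exact hs'.ex.apply_apply_eq_zero x)
    let p2 : Z →ₗ[R] M := S.liftQ (g0 ∘ₗ LinearMap.fst R G L) (by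
      rintro _ ⟨x, rfl⟩
      exact hga x)
    have hp1 : ∀ w, p1 (mk w) = q w.2 := fun w => rfl
    have hp2 : ∀ w, p2 (mk w) = g0 w.1 := fun w => rfl
    have hmks : Function.Surjective mk := Submodule.mkQ_surjective S
    have ses1 : SES i1 p1 := by
      refine ⟨?_, ?_, ?_⟩
      · rw [injective_iff_map_eq_zero]
        intro g hg
        obtain ⟨x, h1, h2⟩ := (hmk _).mp hg
        have : x = 0 := hs'.inj (by rw [h2, map_zero]; rfl)
        rw [this, map_zero] at h1
        exact h1.symm
      · intro z
        obtain ⟨⟨g, l⟩, rfl⟩ := hmks z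
        rw [hp1]
        constructor
        · intro hl
          obtain ⟨x, rfl⟩ := (hs'.ex l).mp hl
          refine ⟨g - a' x, ?_⟩
          change mk (g - a' x, 0) = _
          rw [← sub_eq_zero, ← map_sub, hmk]
          exact ⟨-x, by simp, by simp⟩
        · rintro ⟨g', hg'⟩
          change mk (g', 0) = _ at hg'
          rw [← hp1, ← hg', hp1, map_zero]
      · intro h
        obtain ⟨l, rfl⟩ := hs'.surj h
        exact ⟨mk (0, l), rfl⟩
    have hZ : TR R Z := tr_ext ses1 (TR.of _ hGf hGT) hH'
    have hp2s : Function.Surjective p2 := by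
      intro m
      obtain ⟨g, rfl⟩ := hg0 m
      exact ⟨mk (g, 0), rfl⟩
    refine ⟨ModuleCat.of R (LinearMap.ker p2), ModuleCat.of R Z, (LinearMap.ker p2).subtype, p2,
      ses_ker p2 hp2s, hZ, ?_⟩
    let c : L →ₗ[R] LinearMap.ker p2 := LinearMap.codRestrict _ (mk ∘ₗ LinearMap.inr R G L) (by
      intro l
      change g0 0 = 0
      exact map_zero _)
    refine FP.step Y L (LinearMap.ker p2) (b ∘ₗ j) c ⟨?_, ?_, ?_⟩ hL1 hL2 hY
    · rw [LinearMap.coe_comp]; exact hs'.inj.comp hs.inj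
    · intro l
      have : c l = 0 ↔ mk (0, l) = 0 := by
        rw [← Subtype.coe_inj]; rfl
      rw [this, hmk]
      constructor
      · rintro ⟨x, h1, h2⟩
        obtain ⟨y, rfl⟩ := hay x h1
        exact ⟨y, h2⟩
      · rintro ⟨y, rfl⟩
        exact ⟨j y, haj y, rfl⟩
    · rintro ⟨z, hz⟩
      obtain ⟨⟨g, l⟩, rfl⟩ := hmks z
      obtain ⟨x, rfl⟩ := hax g hz
      refine ⟨l - b x, Subtype.ext ?_⟩
      change mk (0, l - b x) = _
      rw [← sub_eq_zero, ← map_sub, hmk]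
      exact ⟨-x, by simp, by simp⟩

end TRsec

section SDsec

open TensorProduct

variable [IsNoetherianRing R]

/-- Semidualizing, in terms of `EV`. -/
structure SDz (R : Type u) [CommRing R] (C : Type u) [AddCommGroup C] [Module R C] : Prop where
  fin : Module.Finite R C
  faithful : ∀ r : R, (∀ c : C, r • c = 0) → r = 0
  endo : ∀ u : C →ₗ[R] C, ∃ r : R, ∀ c, u c = r • c
  ev : ∀ i, EV R C C (i+1)

variable {C : Type u} [AddCommGroup C] [Module R C]

theorem SDz.of (h : Semidualizing R C) : SDz R C := by
  obtain ⟨h1, h2, h3⟩ := h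
  refine ⟨h1, fun r hr => h2.1 ?_, fun u => ?_, fun i => ev_of_extMod _ _ _ (by omega) (h3 _ (by omega))⟩
  · ext c
    simpa using hr c
  · obtain ⟨r, rfl⟩ := h2.2 u
    exact ⟨r, fun c => by simp⟩

theorem SDz.kill (h : SDz R C) (K : Type u) [AddCommGroup K] [Module R K] (hK : Module.Finite R K)
    (hu : ∀ u : C →ₗ[R] K, u = 0) : Subsingleton K := by
  have := h.fin
  have hs : Subsingleton (C →ₗ[R] K) := ⟨fun a b => by rw [hu a, hu b]⟩
  obtain ⟨r, hr, hreg⟩ := IsSMulRegular.subsingleton_linearMap_iff.mp hs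
  have : r = 0 := h.faithful r (fun c => Module.mem_annihilator.mp hr c)
  subst this
  exact ⟨fun a b => hreg (by simp)⟩

theorem SDz.ker_kill (h : SDz R C) {K N : Type u} [AddCommGroup K] [Module R K]
    [AddCommGroup N] [Module R N] (hK : Module.Finite R K) (a : K →ₗ[R] N)
    (hu : ∀ u : C →ₗ[R] K, a ∘ₗ u = 0 → u = 0) : Function.Injective a := by
  have := h.kill (LinearMap.ker a) inferInstance (fun u => by
    have := hu ((LinearMap.ker a).subtype ∘ₗ u) (by ext c; exact (u c).2)
    ext c
    exact congrArg (fun l => l c) this)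
  rw [← LinearMap.ker_eq_bot]
  exact Submodule.eq_bot_of_subsingleton

/-- Auslander class (the part needed). -/
structure InA (R : Type u) [CommRing R] (C : Type u) [AddCommGroup C] [Module R C]
    (Y : Type u) [AddCommGroup Y] [Module R Y] : Prop where
  fin : Module.Finite R Y
  inj : ∀ y : Y, (∀ c : C, c ⊗ₜ[R] y = 0) → y = 0
  surj : ∀ u : C →ₗ[R] C ⊗[R] Y, ∃ y, ∀ c, u c = c ⊗ₜ y
  ev : ∀ i, EV R C (C ⊗[R] Y) (i+1)

theorem inA_free (h : SDz R C) (L : Type u) [AddCommGroup L] [Module R L] [Module.Free R L]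
    [Module.Finite R L] : InA R C L := by
  classical
  let ι := Module.Free.ChooseBasisIndex R L
  let b : L ≃ₗ[R] (ι → R) := (Module.Free.chooseBasis R L).equivFun
  let e : C ⊗[R] L ≃ₗ[R] (ι → C) := (LinearEquiv.lTensor C b).trans (TensorProduct.piScalarRight R R C ι)
  have he : ∀ c l, e (c ⊗ₜ l) = fun j => b l j • c := by
    intro c l
    ext j
    simp [e]
  refine ⟨inferInstance, fun y hy => ?_, fun u => ?_, fun i => ev_pi C (h.ev i) e⟩
  · apply b.injective
    ext j
    rw [map_zero]
    refine h.faithful _ fun c => ?_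
    have := congrArg (fun t => e t j) (hy c)
    simpa [he] using this
  · have hj : ∀ j, ∃ r : R, ∀ c, e (u c) j = r • c := fun j =>
      h.endo (LinearMap.proj j ∘ₗ e.toLinearMap ∘ₗ u)
    choose r hr using hj
    refine ⟨b.symm r, fun c => e.injective ?_⟩
    ext j
    rw [hr, he]
    simp

variable {A B E : Type u} [AddCommGroup A] [Module R A] [AddCommGroup B] [Module R B]
  [AddCommGroup E] [Module R E]
  {f : A →ₗ[R] B} {g : B →ₗ[R] E}

theorem tensor_ses (hC : SDz R C) (h : SES f g) (hA : InA R C A) (hB : InA R C B) :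
    SES (f.lTensor C) (g.lTensor C) := by
  have := hC.fin
  have := hA.fin
  refine ⟨hC.ker_kill inferInstance _ fun u hu => ?_, lTensor_exact C h.ex h.surj,
    LinearMap.lTensor_surjective C h.surj⟩
  obtain ⟨y, hy⟩ := hA.surj u
  have : f y = 0 := hB.inj _ fun c => by
    have := congrArg (fun l => l c) hu
    simpa [hy] using this
  have : y = 0 := h.inj (by rw [this, map_zero])
  ext c
  simp [hy, this]

theorem inA_coker (hC : SDz R C) (h : SES f g) (hA : InA R C A) (hB : InA R C B) :
    InA R C E := by
  have hs := tensor_ses hC h hA hB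
  have := hB.fin
  refine ⟨Module.Finite.of_surjective g h.surj, fun y hy => ?_, fun u => ?_,
    fun i => cov3 C hs (hB.ev i) (hA.ev (i+1))⟩
  · obtain ⟨b, rfl⟩ := h.surj y
    have hb : ∀ c : C, ∃ t, f.lTensor C t = c ⊗ₜ[R] b := fun c =>
      (hs.ex _).mp (by simpa using hy c)
    let e := LinearEquiv.ofInjective _ hs.inj
    let w : C →ₗ[R] C ⊗[R] A := e.symm.toLinearMap ∘ₗ
      LinearMap.codRestrict (LinearMap.range (f.lTensor C)) ((TensorProduct.mk R C B).flip b)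
        (fun c => hb c)
    have hw : ∀ c, f.lTensor C (w c) = c ⊗ₜ b := by
      intro c
      have : e (w c) = ⟨c ⊗ₜ b, hb c⟩ := by simp only [w, LinearMap.comp_apply, LinearEquiv.coe_coe, LinearEquiv.apply_symm_apply]; rfl
      exact congrArg Subtype.val this
    obtain ⟨a, ha⟩ := hA.surj w
    have : b - f a = 0 := hB.inj _ fun c => by
      rw [tmul_sub, ← hw c, ha]; simp
    rw [sub_eq_zero.mp this]
    exact h.ex.apply_apply_eq_zero a
  · obtain ⟨v, hv⟩ := cov_lift C hs (hA.ev 0) u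
    obtain ⟨b, hb⟩ := hB.surj v
    refine ⟨g b, fun c => ?_⟩
    rw [← hv]
    simp [hb]

theorem inA_FP (hC : SDz R C) (Y : Type u) [AddCommGroup Y] [Module R Y] (hY : FP R Y) :
    InA R C Y := by
  induction hY with
  | zero Y h => exact inA_free hC Y
  | step Y' L Y f g h hf hfin h' ih => exact inA_coker hC h ih (inA_free hC L)

theorem ev_hom (hC : SDz R C) (D : Type u) [AddCommGroup D] [Module R D] [Module.Finite R D]
    (hD : EV R D R 1) : EV R C (D →ₗ[R] C) 1 := by
  obtain ⟨n, p, hp⟩ := Module.Finite.exists_fin' R D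
  let N := LinearMap.ker p
  have hs := ses_ker p hp
  let res : ((Fin n → R) →ₗ[R] C) →ₗ[R] (N →ₗ[R] C) := LinearMap.lcomp R C N.subtype
  have hs2 : SES (LinearMap.lcomp R C p) res.rangeRestrict := by
    refine ⟨?_, ?_, LinearMap.surjective_rangeRestrict res⟩
    · exact LinearMap.lcomp_injective_of_surjective p hp
    · intro u
      have h1 : res.rangeRestrict u = 0 ↔ res u = 0 := by rw [← Subtype.coe_inj]; rfl
      rw [h1]
      constructor
      · intro hu
        have hk : LinearMap.ker p ≤ LinearMap.ker u := fun b hb =>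
          (show u b = 0 from LinearMap.congr_fun hu (⟨b, hb⟩ : N))
        refine ⟨(Submodule.liftQ _ u hk) ∘ₗ (LinearMap.quotKerEquivOfSurjective p hp).symm, ?_⟩
        apply LinearMap.ext
        intro b
        have : (LinearMap.quotKerEquivOfSurjective p hp).symm (p b) = Submodule.Quotient.mk b := by
          rw [LinearEquiv.symm_apply_eq]; rfl
        simp [this]
      · rintro ⟨v, rfl⟩
        ext a
        have : p a = 0 := a.2
        simp [res, this]
  refine cov1 C hs2 (ev_pi C (hC.ev 0) ((Pi.basisFun R (Fin n)).constr R).symm) fun u => ?_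
  have hn : ∀ x : N, ∃ r : R, ∀ c, (u c : N →ₗ[R] C) x = r • c := fun x =>
    hC.endo (LinearMap.applyₗ x ∘ₗ (LinearMap.range res).subtype ∘ₗ u)
  choose r hr using hn
  have uniq : ∀ s t : R, (∀ c : C, s • c = t • c) → s = t := fun s t hst =>
    sub_eq_zero.mp (hC.faithful _ fun c => by rw [sub_smul, hst, sub_self])
  let ν : N →ₗ[R] R :=
    { toFun := r
      map_add' := fun x y => uniq _ _ fun c => by rw [← hr, add_smul, ← hr, ← hr, map_add]
      map_smul' := fun s x => uniq _ _ fun c => by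
        rw [← hr, RingHom.id_apply, smul_eq_mul, mul_smul, ← hr, map_smul] }
  obtain ⟨μ, hμ⟩ := con_ext R hs hD ν
  refine ⟨(LinearMap.lcomp R C μ) ∘ₗ (LinearMap.lsmul R C).flip, ?_⟩
  apply LinearMap.ext
  intro c
  apply Subtype.ext
  apply LinearMap.ext
  intro x
  rw [hr x c]
  have : μ x = r x := LinearMap.congr_fun hμ x
  rw [← this]
  rfl

theorem SDz.rep (hC : SDz R C) {D : Type u} [AddCommGroup D] [Module R D]
    (u : C →ₗ[R] D →ₗ[R] C) : ∃ ψ : D →ₗ[R] R, ∀ c d, u c d = ψ d • c := by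
  have hn : ∀ x : D, ∃ r : R, ∀ c, u c x = r • c := fun x => hC.endo (u.flip x)
  choose r hr using hn
  have uniq : ∀ s t : R, (∀ c : C, s • c = t • c) → s = t := fun s t hst =>
    sub_eq_zero.mp (hC.faithful _ fun c => by rw [sub_smul, hst, sub_self])
  refine ⟨{ toFun := r
            map_add' := fun x y => uniq _ _ fun c => by rw [← hr, add_smul, ← hr, ← hr, map_add]
            map_smul' := fun s x => uniq _ _ fun c => by
              rw [← hr, RingHom.id_apply, smul_eq_mul, mul_smul, ← hr, map_smul] },
    fun c d => hr d c⟩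

theorem ses_mkQ (f : A →ₗ[R] B) (hf : Function.Injective f) :
    SES f (LinearMap.range f).mkQ :=
  ⟨hf, LinearMap.exact_map_mkQ_range f, Submodule.mkQ_surjective _⟩

theorem splitting (hC : SDz R C) {Y H : Type u} [AddCommGroup Y] [Module R Y]
    [AddCommGroup H] [Module R H] {f : Y →ₗ[R] H} {g : H →ₗ[R] (C →ₗ[R] R)} (hs : SES f g)
    (hH : TR R H) (hY : InA R C Y) :
    ∃ (s : C →ₗ[R] Module.Dual R H) (h : Module.Dual R H →ₗ[R] C), h ∘ₗ s = LinearMap.id := by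
  have := hC.fin
  have := hY.fin
  have := hH.fin
  have hDf : Module.Finite R (Module.Dual R H) := hH.dual.fin
  let s : C →ₗ[R] Module.Dual R H := g.flip
  let α : C ⊗[R] Y →ₗ[R] (Module.Dual R H →ₗ[R] C) := TensorProduct.lift
    (LinearMap.mk₂ R (fun c y => (Module.Dual.eval R H (f y)).smulRight c)
      (fun c c' y => by ext; simp) (fun r c y => by ext; exact smul_comm _ _ _)
      (fun c y y' => by ext; simp [add_smul]) (fun r c y => by ext; simp [mul_smul]))
  have hα : ∀ c y φ, α (c ⊗ₜ y) φ = φ (f y) • c := fun c y φ => rfl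
  let β : (Module.Dual R H →ₗ[R] C) →ₗ[R] (C →ₗ[R] C) := LinearMap.lcomp R C s
  have hβ : ∀ h c, β h c = h (s c) := fun h c => rfl
  have repM : ∀ u : C →ₗ[R] (Module.Dual R H →ₗ[R] C), ∃ x : H, ∀ c φ, u c φ = φ x • c := by
    intro u
    obtain ⟨ψ, hψ⟩ := hC.rep u
    obtain ⟨x, rfl⟩ := hH.refl.2 ψ
    exact ⟨x, hψ⟩
  have hαi : Function.Injective α := by
    refine hC.ker_kill inferInstance α fun u hu => ?_
    obtain ⟨y, hy⟩ := hY.surj u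
    have h0 : f y = 0 := by
      apply hH.refl.1
      rw [map_zero]
      ext φ
      refine hC.faithful _ fun c => ?_
      have := LinearMap.congr_fun (LinearMap.congr_fun hu c) φ
      simpa [hy, hα] using this
    have : y = 0 := hs.inj (by rw [h0, map_zero])
    ext c
    simp [hy, this]
  have hs1 := ses_mkQ α hαi
  have hαβ : LinearMap.range α ≤ LinearMap.ker β := by
    rintro _ ⟨t, rfl⟩
    rw [LinearMap.mem_ker]
    induction t with
    | zero => simp
    | add a b ha hb => rw [map_add, map_add, ha, hb, add_zero]
    | tmul c y =>
      ext c'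
      rw [hβ, hα]
      have : s c' (f y) = 0 := LinearMap.congr_fun (hs.ex.apply_apply_eq_zero y) c'
      rw [this, zero_smul]; rfl
  let J := (Module.Dual R H →ₗ[R] C) ⧸ LinearMap.range α
  let β' : J →ₗ[R] (C →ₗ[R] C) := (LinearMap.range α).liftQ β hαβ
  have hβ' : ∀ h, β' ((LinearMap.range α).mkQ h) = β h := fun h => rfl
  have hMf : Module.Finite R (Module.Dual R H →ₗ[R] C) := inferInstance
  have hJf : Module.Finite R J := Module.Finite.quotient R _
  have hJe : EV R C J 1 :=
    cov3 C hs1 (ev_hom hC (Module.Dual R H) (hH.e2 0)) (hY.ev 1)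
  have hβi : Function.Injective β' := by
    refine hC.ker_kill hJf β' fun u hu => ?_
    obtain ⟨v, rfl⟩ := cov_lift C hs1 (hY.ev 0) u
    obtain ⟨x, hx⟩ := repM v
    have h0 : g x = 0 := by
      ext c'
      refine hC.faithful _ fun c => ?_
      have := LinearMap.congr_fun (LinearMap.congr_fun hu c) c'
      change v c (s c') = 0 at this
      rw [hx] at this
      exact this
    obtain ⟨y, rfl⟩ := (hs.ex x).mp h0
    ext c
    have : v c = α (c ⊗ₜ y) := by
      ext φ
      rw [hx, hα]
    rw [LinearMap.comp_apply, this]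
    exact hs1.ex.apply_apply_eq_zero _
  have hs2 := ses_mkQ β' hβi
  have hX : Subsingleton ((C →ₗ[R] C) ⧸ LinearMap.range β') := by
    refine hC.kill _ inferInstance fun u => ?_
    obtain ⟨v, rfl⟩ := cov_lift C hs2 hJe u
    obtain ⟨γ, hγ⟩ := hC.rep v
    obtain ⟨x, rfl⟩ := hs.surj γ
    ext c
    have : v c = β' ((LinearMap.range α).mkQ ((Module.Dual.eval R H x).smulRight c)) := by
      rw [hβ']
      ext c'
      rw [hγ]
      rfl
    rw [LinearMap.comp_apply, this]
    exact hs2.ex.apply_apply_eq_zero _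
  obtain ⟨j, hj⟩ : ∃ j, β' j = LinearMap.id :=
    (hs2.ex _).mp (Subsingleton.elim _ _)
  obtain ⟨h, rfl⟩ := Submodule.mkQ_surjective _ j
  exact ⟨s, h, hj⟩

end SDsec

section Bsec

open TensorProduct IsLocalRing

variable [IsNoetherianRing R]
variable {C : Type u} [AddCommGroup C] [Module R C]

theorem refl_retract {D : Type u} [AddCommGroup D] [Module R D]
    (hD : Function.Bijective (Module.Dual.eval R D)) (s : C →ₗ[R] D) (h : D →ₗ[R] C)
    (hs : h ∘ₗ s = LinearMap.id) : Function.Bijective (Module.Dual.eval R C) := by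
  have hs' : ∀ c, h (s c) = c := LinearMap.congr_fun hs
  constructor
  · rw [injective_iff_map_eq_zero]
    intro c hc
    have : Module.Dual.eval R D (s c) = 0 := by
      change s.dualMap.dualMap (Module.Dual.eval R C c) = 0
      rw [hc, map_zero]
    have : s c = 0 := hD.1 (by rw [this, map_zero])
    rw [← hs' c, this, map_zero]
  · intro x
    obtain ⟨d, hd⟩ := hD.2 (s.dualMap.dualMap x)
    refine ⟨h d, ?_⟩
    change h.dualMap.dualMap (Module.Dual.eval R D d) = x
    rw [hd]
    ext φ
    change x (s.dualMap (h.dualMap φ)) = x φ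
    congr 1
    ext c
    exact congrArg φ (hs' c)

variable (R C) in
/-- The evaluation map. -/
def theta (W : Type u) [AddCommGroup W] [Module R W] :
    C ⊗[R] W →ₗ[R] (Module.Dual R C →ₗ[R] W) := TensorProduct.lift
    (LinearMap.mk₂ R (fun c w => (Module.Dual.eval R C c).smulRight w)
      (fun c c' y => by ext; simp [add_smul]) (fun r c y => by ext; simp [mul_smul])
      (fun c y y' => by ext; simp) (fun r c y => by ext; exact smul_comm _ _ _))

theorem theta_tmul {W : Type u} [AddCommGroup W] [Module R W] (c : C) (w : W) (φ) :
    theta R C W (c ⊗ₜ w) φ = φ c • w := rfl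

theorem theta_nat {A B : Type u} [AddCommGroup A] [Module R A] [AddCommGroup B] [Module R B]
    (f : A →ₗ[R] B) (t : C ⊗[R] A) (φ : Module.Dual R C) :
    theta R C B (f.lTensor C t) φ = f (theta R C A t φ) := by
  induction t with
  | zero => simp
  | add a b ha hb => simp only [map_add, LinearMap.add_apply, ha, hb]
  | tmul c y => rw [LinearMap.lTensor_tmul, theta_tmul, theta_tmul, map_smul]

/-- The class of modules used in the counting argument. -/
structure InB (R : Type u) [CommRing R] (C : Type u) [AddCommGroup C] [Module R C]
    (W : Type u) [AddCommGroup W] [Module R W] : Prop where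
  inA : InA R C W
  bij : Function.Bijective (theta R C W)
  evd : ∀ i, EV R (Module.Dual R C) W (i+1)

theorem inB_R (hC : SDz R C) (hr : Function.Bijective (Module.Dual.eval R C))
    (he : ∀ i, EV R (Module.Dual R C) R (i+1)) : InB R C R := by
  refine ⟨inA_free hC R, ?_, he⟩
  have : (theta R C R : C ⊗[R] R → _) = Module.Dual.eval R C ∘ TensorProduct.rid R C := by
    funext t
    induction t with
    | zero => simp
    | add a b ha hb => rw [map_add, ha, hb]; simp
    | tmul c y =>
      ext φ
      rw [theta_tmul]
      simp [mul_comm]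
  rw [this]
  exact hr.comp (TensorProduct.rid R C).bijective

theorem SES.lift {A B E D : Type u} [AddCommGroup A] [Module R A] [AddCommGroup B] [Module R B]
    [AddCommGroup E] [Module R E] [AddCommGroup D] [Module R D]
    {f : A →ₗ[R] B} {g : B →ₗ[R] E} (h : SES f g) (v : D →ₗ[R] B) (hv : ∀ d, g (v d) = 0) :
    ∃ w : D →ₗ[R] A, ∀ d, f (w d) = v d := by
  let e := LinearEquiv.ofInjective _ h.inj
  refine ⟨e.symm.toLinearMap ∘ₗ LinearMap.codRestrict (LinearMap.range f) v
    (fun d => (h.ex _).mp (hv d)), fun d => ?_⟩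
  have : ∀ y, f (e.symm y) = y := fun y => congrArg Subtype.val (e.apply_symm_apply y)
  exact this _

theorem inB_coker {A B E : Type u} [AddCommGroup A] [Module R A] [AddCommGroup B] [Module R B]
    [AddCommGroup E] [Module R E] {f : A →ₗ[R] B} {g : B →ₗ[R] E}
    (hC : SDz R C) (h : SES f g) (hA : InB R C A) (hB : InB R C B) : InB R C E := by
  have ht := tensor_ses hC h hA.inA hB.inA
  refine ⟨inA_coker hC h hA.inA hB.inA, ⟨?_, ?_⟩, fun i => cov3 _ h (hB.evd i) (hA.evd (i+1))⟩
  · rw [injective_iff_map_eq_zero]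
    intro t ht0
    obtain ⟨t, rfl⟩ := ht.surj t
    obtain ⟨w, hw⟩ := h.lift (theta R C B t) fun φ => by
      rw [← theta_nat, ht0]; rfl
    obtain ⟨a, rfl⟩ := hA.bij.2 w
    have : f.lTensor C a = t := hB.bij.1 (by
      ext φ
      rw [theta_nat, hw])
    rw [← this]
    exact ht.ex.apply_apply_eq_zero a
  · intro u
    obtain ⟨v, hv⟩ := cov_lift _ h (hA.evd 0) u
    obtain ⟨t, rfl⟩ := hB.bij.2 v
    refine ⟨g.lTensor C t, ?_⟩
    rw [← hv]
    ext φ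
    rw [theta_nat]; rfl

variable [IsLocalRing R]

theorem exists_socle (hC : SDz R C) (hR : InB R C R) : ∃ (W : ModuleCat.{u} R),
    InB R C W ∧ Nontrivial ((R ⧸ maximalIdeal R) →ₗ[R] W) := by
  let P : Set (Ideal R) := {J | J ≠ ⊤ ∧ ∃ (W : ModuleCat.{u} R) (p : R →ₗ[R] W),
    Function.Surjective p ∧ LinearMap.ker p = J ∧ InB R C W}
  obtain ⟨J, ⟨hJ, W, p, hp, hk, hW⟩, hmax⟩ := set_has_maximal_iff_noetherian.mpr
    (inferInstanceAs (IsNoetherian R R)) P ⟨⊥, bot_ne_top, ModuleCat.of R R, LinearMap.id,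
      Function.surjective_id, LinearMap.ker_id, hR⟩
  refine ⟨W, hW, ?_⟩
  by_contra hn
  rw [not_nontrivial_iff_subsingleton] at hn
  have := hW.inA.fin
  have hp1 : p 1 ≠ 0 := fun h0 => hJ (by
    rw [← hk, Ideal.eq_top_iff_one, LinearMap.mem_ker, h0])
  obtain ⟨x, hx, hreg⟩ := IsSMulRegular.subsingleton_linearMap_iff.mp hn
  rw [Ideal.annihilator_quotient] at hx
  let f : W →ₗ[R] W := LinearMap.lsmul R W x
  have hf : Function.Injective f := hreg
  have hs := ses_mkQ f hf
  let p' : R →ₗ[R] (W ⧸ LinearMap.range f) := (LinearMap.range f).mkQ ∘ₗ p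
  have hle : LinearMap.ker p ≤ LinearMap.ker p' := LinearMap.ker_le_ker_comp _ _
  refine hmax (LinearMap.ker p') ⟨?_, ModuleCat.of R (W ⧸ LinearMap.range f), p',
    (Submodule.mkQ_surjective _).comp hp, rfl, inB_coker hC hs hW hW⟩ ?_
  · intro h
    have h1 : p' 1 = 0 := by rw [← LinearMap.mem_ker, h]; trivial
    obtain ⟨w, hw⟩ := (hs.ex (p 1)).mp h1
    obtain ⟨r, rfl⟩ := hp w
    have h2 : p (1 - x * r) = 0 := by
      rw [map_sub, ← hw, ← smul_eq_mul, map_smul]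
      exact sub_self _
    have hu : IsUnit (1 - x * r) := by
      by_contra hu
      have h3 : (1 - x * r) + x * r ∈ maximalIdeal R :=
        Ideal.add_mem _ ((mem_maximalIdeal _).mpr hu) (Ideal.mul_mem_right _ _ hx)
      rw [sub_add_cancel] at h3
      exact (Ideal.ne_top_iff_one _).mp (Ideal.IsPrime.ne_top inferInstance) h3
    obtain ⟨y, hy⟩ := hu.exists_left_inv
    apply hp1
    rw [← hy, ← smul_eq_mul, map_smul, h2, smul_zero]
  · rw [← hk]
    refine lt_of_le_of_ne hle fun h => ?_
    have h1 : x ∈ LinearMap.ker p' := by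
      rw [LinearMap.mem_ker]
      have : p x = f (p 1) := by
        change _ = x • p 1
        rw [← map_smul, smul_eq_mul, mul_one]
      change (LinearMap.range f).mkQ (p x) = 0
      rw [this]
      exact hs.ex.apply_apply_eq_zero _
    rw [← h, LinearMap.mem_ker] at h1
    apply hp1
    apply hreg
    change x • p 1 = x • 0
    rw [← map_smul, smul_eq_mul, mul_one, h1, smul_zero]

theorem coords (D : Type u) [AddCommGroup D] [Module R D] [Module.Finite R D] :
    ∃ (n : ℕ) (a : D →ₗ[R] (Fin n → R ⧸ maximalIdeal R)), Function.Surjective a ∧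
      LinearMap.ker a ≤ maximalIdeal R • (⊤ : Submodule R D) := by
  letI : Field (R ⧸ maximalIdeal R) := Ideal.Quotient.field _
  let V := D ⧸ (maximalIdeal R • (⊤ : Submodule R D))
  have : Module.Finite (R ⧸ maximalIdeal R) V := Module.Finite.of_restrictScalars_finite R _ _
  let b := Module.finBasis (R ⧸ maximalIdeal R) V
  let e := b.equivFun.restrictScalars R
  refine ⟨_, e.toLinearMap ∘ₗ Submodule.mkQ _, ?_, ?_⟩
  · exact e.surjective.comp (Submodule.mkQ_surjective _)
  · intro d hd
    rw [LinearMap.mem_ker] at hd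
    have : Submodule.mkQ (maximalIdeal R • (⊤ : Submodule R D)) d = 0 :=
      e.injective (hd.trans (map_zero _).symm)
    simpa using this

theorem soc_kill (N : Type u) [AddCommGroup N] [Module R N] (r : R) (hr : r ∈ maximalIdeal R)
    (l : (R ⧸ maximalIdeal R) →ₗ[R] N) : r • l = 0 := by
  ext
  change r • l (Ideal.Quotient.mk _ 1) = 0
  rw [← map_smul]
  have : r • (Ideal.Quotient.mk (maximalIdeal R) 1) = Ideal.Quotient.mk (maximalIdeal R) r := by
    rw [Algebra.smul_def, map_one, mul_one]; rfl
  rw [this, Ideal.Quotient.eq_zero_iff_mem.mpr hr, map_zero]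

theorem soc_le {X M : Type u} [AddCommGroup X] [Module R X] [AddCommGroup M] [Module R M]
    (F : X →ₗ[R] M) (hF : Function.Injective F) (hX : ∀ r ∈ maximalIdeal R, ∀ x : X, r • x = 0) :
    Module.length R X ≤ Module.length R ((R ⧸ maximalIdeal R) →ₗ[R] M) := by
  let G : X →ₗ[R] ((R ⧸ maximalIdeal R) →ₗ[R] M) :=
    { toFun := fun x => Submodule.liftQ (maximalIdeal R) (LinearMap.toSpanSingleton R M (F x))
        (fun r hr => by
          rw [LinearMap.mem_ker, LinearMap.toSpanSingleton_apply, ← map_smul, hX r hr, map_zero])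
      map_add' := fun x y => by
        apply Submodule.linearMap_qext
        ext
        change (1 : R) • F (x + y) = (1 : R) • F x + (1 : R) • F y
        rw [map_add, smul_add]
      map_smul' := fun r x => by
        apply Submodule.linearMap_qext
        ext
        change (1 : R) • F (r • x) = r • (1 : R) • F x
        rw [map_smul, smul_comm] }
  refine Module.length_le_of_injective G fun x y hxy => hF ?_
  have := LinearMap.congr_fun hxy (Submodule.Quotient.mk 1)
  change (1 : R) • F x = (1 : R) • F y at this
  simpa using this

theorem soc_fin (M : Type u) [AddCommGroup M] [Module R M] [Module.Finite R M] :
    Module.length R ((R ⧸ maximalIdeal R) →ₗ[R] M) ≠ ⊤ := by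
  letI : Field (R ⧸ maximalIdeal R) := Ideal.Quotient.field _
  have ht : Module.IsTorsionBySet R ((R ⧸ maximalIdeal R) →ₗ[R] M) (maximalIdeal R) := by
    intro l r
    exact soc_kill M r.1 r.2 l
  letI := ht.module
  haveI : IsScalarTower R (R ⧸ maximalIdeal R) ((R ⧸ maximalIdeal R) →ₗ[R] M) := ht.isScalarTower
  haveI : Module.Finite (R ⧸ maximalIdeal R) ((R ⧸ maximalIdeal R) →ₗ[R] M) :=
    Module.Finite.of_restrictScalars_finite R _ _
  haveI : IsArtinian R ((R ⧸ maximalIdeal R) →ₗ[R] M) :=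
    isArtinian_of_surjective_algebraMap (R := R ⧸ maximalIdeal R) Ideal.Quotient.mk_surjective
  exact Module.length_ne_top

theorem count {D N M : Type u} [AddCommGroup D] [Module R D] [AddCommGroup N] [Module R N]
    [AddCommGroup M] [Module R M] (n : ℕ) (a : D →ₗ[R] (Fin n → R ⧸ maximalIdeal R))
    (ha : Function.Surjective a) (e : (D →ₗ[R] N) →ₗ[R] M) (he : Function.Injective e) :
    n * Module.length R ((R ⧸ maximalIdeal R) →ₗ[R] N) ≤
      Module.length R ((R ⧸ maximalIdeal R) →ₗ[R] M) := by
  classical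
  let q : (Fin n → ((R ⧸ maximalIdeal R) →ₗ[R] N)) →ₗ[R] (D →ₗ[R] N) :=
    LinearMap.lcomp R N a ∘ₗ (LinearMap.lsum R (fun _ : Fin n => R ⧸ maximalIdeal R) R).toLinearMap
  have hq : Function.Injective q := by
    exact (LinearMap.lcomp_injective_of_surjective a ha).comp (LinearEquiv.injective _)
  have := soc_le (e ∘ₗ q) (he.comp hq) (fun r hr x => by
    funext j
    exact soc_kill N r hr (x j))
  rw [Module.length_pi] at this
  simpa using this

theorem final (hC : SDz R C) (hr : Function.Bijective (Module.Dual.eval R C))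
    (he : ∀ i, EV R (Module.Dual R C) R (i+1)) : Nonempty (C ≃ₗ[R] R) := by
  have := hC.fin
  obtain ⟨W, hW, hnt⟩ := exists_socle hC (inB_R hC hr he)
  have := hW.inA.fin
  obtain ⟨n, a, ha, hak⟩ := coords (R := R) C
  obtain ⟨m, b, hb, hbk⟩ := coords (R := R) (Module.Dual R C)
  have hjac : maximalIdeal R ≤ Ideal.jacobson ⊥ := IsLocalRing.maximalIdeal_le_jacobson _
  have hm : m ≠ 0 := by
    rintro rfl
    have h1 : (⊤ : Submodule R (Module.Dual R C)) ≤ ⊥ := by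
      refine Submodule.le_of_le_smul_of_le_jacobson_bot Module.Finite.fg_top hjac ?_
      rw [bot_sup_eq]
      intro φ _
      exact hbk (LinearMap.mem_ker.mpr (Subsingleton.elim _ _))
    have h2 : ∀ φ : Module.Dual R C, φ = 0 := fun φ => (Submodule.mem_bot R).mp (h1 trivial)
    have h3 : ∀ c : C, c = 0 := fun c => hr.1 (by ext φ; rw [h2 φ]; simp)
    exact one_ne_zero (hC.faithful (1 : R) fun c => by rw [h3 c, smul_zero])
  let ρ : W →ₗ[R] (C →ₗ[R] C ⊗[R] W) := (TensorProduct.mk R C W).flip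
  have hρ : Function.Bijective ρ := by
    constructor
    · rw [injective_iff_map_eq_zero]
      intro w hw
      exact hW.inA.inj w fun c => LinearMap.congr_fun hw c
    · intro u
      obtain ⟨y, hy⟩ := hW.inA.surj u
      exact ⟨y, by ext c; exact (hy c).symm⟩
  have c1 := count n a ha (LinearEquiv.ofBijective _ hρ).symm.toLinearMap (LinearEquiv.injective _)
  have c2 := count m b hb (LinearEquiv.ofBijective _ hW.bij).symm.toLinearMap
    (LinearEquiv.injective _)
  have hfin := soc_fin (R := R) W
  have hpos : 0 < Module.length R ((R ⧸ maximalIdeal R) →ₗ[R] W) := Module.length_pos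
  have hn : n ≤ 1 := by
    generalize Module.length R ((R ⧸ maximalIdeal R) →ₗ[R] W) = L at *
    generalize Module.length R ((R ⧸ maximalIdeal R) →ₗ[R] C ⊗[R] W) = L' at *
    by_contra hn
    lift L to ℕ using hfin
    have h1 : (2 : ℕ∞) ≤ n := by exact_mod_cast (by omega : 2 ≤ n)
    have h2 : (1 : ℕ∞) ≤ m := by exact_mod_cast (by omega : 1 ≤ m)
    have h3 : (L : ℕ∞) ≤ L' := by
      calc (L : ℕ∞) = 1 * L := (one_mul _).symm
        _ ≤ m * L := by gcongr
        _ ≤ L' := c2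
    have h4 : (2 : ℕ∞) * L ≤ L := by
      calc (2 : ℕ∞) * L ≤ n * L' := by gcongr
        _ ≤ L := c1
    have h5 : 2 * L ≤ L := by exact_mod_cast h4
    have h6 : 0 < L := by exact_mod_cast hpos
    omega
  obtain ⟨c, hc⟩ := ha (fun _ => 1)
  have htop : (⊤ : Submodule R C) ≤ Submodule.span R {c} := by
    refine Submodule.le_of_le_smul_of_le_jacobson_bot Module.Finite.fg_top hjac ?_
    intro x _
    have hx : ∃ r : R, a x = a (r • c) := by
      by_cases h0 : n = 0
      · subst h0; exact ⟨0, Subsingleton.elim _ _⟩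
      · have h1 : n = 1 := by omega
        subst h1
        obtain ⟨r, hr⟩ := Ideal.Quotient.mk_surjective (a x 0)
        refine ⟨r, ?_⟩
        rw [map_smul, hc]
        funext j
        rw [Subsingleton.elim j 0, ← hr, Pi.smul_apply, Algebra.smul_def, mul_one]
        rfl
    obtain ⟨r, hr⟩ := hx
    have h2 : x - r • c ∈ maximalIdeal R • (⊤ : Submodule R C) :=
      hak (by rw [LinearMap.mem_ker, map_sub, hr, sub_self])
    rw [← add_sub_cancel (r • c) x]
    exact Submodule.add_mem_sup (Submodule.smul_mem _ _ (Submodule.mem_span_singleton_self c)) h2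
  refine ⟨(LinearEquiv.ofBijective (LinearMap.toSpanSingleton R C c) ⟨?_, ?_⟩).symm⟩
  · rw [injective_iff_map_eq_zero]
    intro r h0
    refine hC.faithful r fun x => ?_
    obtain ⟨t, rfl⟩ := Submodule.mem_span_singleton.mp (htop (show x ∈ ⊤ from trivial))
    rw [smul_comm]
    rw [LinearMap.toSpanSingleton_apply] at h0
    rw [h0, smul_zero]
  · intro x
    obtain ⟨t, rfl⟩ := Submodule.mem_span_singleton.mp (htop (show x ∈ ⊤ from trivial))
    exact ⟨t, rfl⟩

end Bsec

end SD

theorem stmt10 (R : Type u) [CommRing R] [IsLocalRing R] [IsNoetherianRing R]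
    (hCM : ∃ d : ℕ, IsCMLocalOfDim R d)
    (C : Type u) [AddCommGroup C] [Module R C]
    (hC : Semidualizing R C)
    (hG : FiniteGdim R (C →ₗ[R] R)) :
    Nonempty (C ≃ₗ[R] R) := by
  have hC' := SD.SDz.of hC
  have := hC'.fin
  obtain ⟨n, hn⟩ := hG
  obtain ⟨Y, H, f, g, hs, hH, hY⟩ := SD.approx n (ModuleCat.of R (C →ₗ[R] R))
    (by change Module.Finite R (C →ₗ[R] R); infer_instance) hn
  obtain ⟨s, h, hsh⟩ := SD.splitting hC' hs hH (SD.inA_FP hC' Y hY)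
  refine SD.final hC' (SD.refl_retract hH.dual.refl s h hsh) fun i => ?_
  refine SD.ev_retract_left R h.dualMap s.dualMap ?_ (hH.dual.e2 i)
  ext φ c
  exact congrArg φ (LinearMap.congr_fun hsh c)
end

section
/- Let R be a Cohen-Macaulay local ring with canonical module ω. If Hom_R(ω,R) has finite projective dimension over R, then R is Gorenstein. -/
open CategoryTheory Opposite

universe u

open TensorProduct

section Helpers

variable {R : Type u} [CommRing R]

/-- Elementary vanishing of the degree `i+1` cohomology of `Hom(P, N)`. -/
def EV {P : ℕ → Type u} [∀ i, AddCommGroup (P i)] [∀ i, Module R (P i)]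
    (d : ∀ i, P (i+1) →ₗ[R] P i) (N : Type u) [AddCommGroup N] [Module R N] (i : ℕ) : Prop :=
  ∀ g : P (i+1) →ₗ[R] N, g ∘ₗ d (i+1) = 0 → ∃ h : P i →ₗ[R] N, h ∘ₗ d i = g

theorem factor_inj {P A B : Type u} [AddCommGroup P] [Module R P]
    [AddCommGroup A] [Module R A] [AddCommGroup B] [Module R B]
    (f : A →ₗ[R] B) (hf : Function.Injective f) (g : P →ₗ[R] B)
    (h : ∀ x, g x ∈ LinearMap.range f) : ∃ k : P →ₗ[R] A, f ∘ₗ k = g := by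
  refine ⟨(LinearEquiv.ofInjective f hf).symm.toLinearMap ∘ₗ g.codRestrict _ h, ?_⟩
  ext x
  have := LinearEquiv.apply_symm_apply (LinearEquiv.ofInjective f hf) (g.codRestrict _ h x)
  exact congrArg Subtype.val this

theorem factor_surj {P C B : Type u} [AddCommGroup P] [Module R P]
    [AddCommGroup C] [Module R C] [AddCommGroup B] [Module R B]
    (p : P →ₗ[R] C) (hp : Function.Surjective p) (g : P →ₗ[R] B)
    (h : LinearMap.ker p ≤ LinearMap.ker g) : ∃ k : C →ₗ[R] B, k ∘ₗ p = g := by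
  refine ⟨(LinearMap.ker p).liftQ g h ∘ₗ (p.quotKerEquivOfSurjective hp).symm.toLinearMap, ?_⟩
  ext x
  have : (p.quotKerEquivOfSurjective hp).symm (p x) = Submodule.Quotient.mk x := by
    rw [LinearEquiv.symm_apply_eq]; rfl
  simp [this]

section seq

variable {P : ℕ → Type u} [∀ i, AddCommGroup (P i)] [∀ i, Module R (P i)]
    (d : ∀ i, P (i+1) →ₗ[R] P i) (hd : ∀ i, d i ∘ₗ d (i+1) = 0)
    (hP : ∀ i, Module.Projective R (P i))
    {A B D : Type u} [AddCommGroup A] [Module R A] [AddCommGroup B] [Module R B]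
    [AddCommGroup D] [Module R D]
    (f : A →ₗ[R] B) (g : B →ₗ[R] D) (hf : Function.Injective f) (hfg : Function.Exact f g)
    (hg : Function.Surjective g)

include hd hP hf hfg hg

theorem EV_quot (i : ℕ) (hB : EV d B i) (hA : EV d A (i+1)) : EV d D i := by
  intro φ hφ
  have := hP (i+1)
  obtain ⟨φ', hφ'⟩ := Module.projective_lifting_property g φ hg
  obtain ⟨ψ, hψ⟩ := factor_inj f hf (φ' ∘ₗ d (i+1)) (fun x => by
    apply (hfg _).1
    have := LinearMap.congr_fun hφ x
    rw [← hφ'] at this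
    simpa using this)
  obtain ⟨χ, hχ⟩ := hA ψ (by
    ext x
    apply hf
    have h1 := LinearMap.congr_fun hψ (d (i+2) x)
    have h2 := LinearMap.congr_fun (hd (i+1)) x
    simp only [LinearMap.comp_apply] at h1 h2
    simp [h1, h2])
  obtain ⟨h, hh⟩ := hB (φ' - f ∘ₗ χ) (by
    rw [LinearMap.sub_comp, LinearMap.comp_assoc, hχ, hψ, sub_self])
  refine ⟨g ∘ₗ h, ?_⟩
  rw [LinearMap.comp_assoc, hh, LinearMap.comp_sub, hφ', ← LinearMap.comp_assoc,
    hfg.linearMap_comp_eq_zero]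
  simp

theorem Hom_surj {C : Type u} [AddCommGroup C] [Module R C] (p : P 0 →ₗ[R] C)
    (hp : Function.Surjective p) (hdp : Function.Exact (d 0) p) (hA : EV d A 0)
    (φ : C →ₗ[R] D) : ∃ h : C →ₗ[R] B, g ∘ₗ h = φ := by
  have := hP 0
  obtain ⟨φ', hφ'⟩ := Module.projective_lifting_property g (φ ∘ₗ p) hg
  obtain ⟨ψ, hψ⟩ := factor_inj f hf (φ' ∘ₗ d 0) (fun x => by
    apply (hfg _).1
    have := LinearMap.congr_fun hφ' (d 0 x)
    simp only [LinearMap.comp_apply, hdp.apply_apply_eq_zero] at this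
    simpa using this)
  obtain ⟨χ, hχ⟩ := hA ψ (by
    ext x
    apply hf
    have h1 := LinearMap.congr_fun hψ (d 1 x)
    have h2 := LinearMap.congr_fun (hd 0) x
    simp only [LinearMap.comp_apply] at h1 h2
    simp [h1, h2])
  obtain ⟨h, hh⟩ := factor_surj p hp (φ' - f ∘ₗ χ) (by
    intro x hx
    obtain ⟨y, rfl⟩ := (hdp x).1 hx
    have h1 := LinearMap.congr_fun hψ y
    have h2 := LinearMap.congr_fun hχ y
    simp only [LinearMap.comp_apply] at h1 h2
    simp [h1, h2])
  refine ⟨h, ?_⟩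
  rw [← LinearMap.cancel_right hp, LinearMap.comp_assoc, hh, LinearMap.comp_sub, hφ',
    ← LinearMap.comp_assoc, hfg.linearMap_comp_eq_zero]
  simp

end seq

theorem EV_equiv_finsupp {P : ℕ → Type u} [∀ i, AddCommGroup (P i)] [∀ i, Module R (P i)]
    (d : ∀ i, P (i+1) →ₗ[R] P i) {N M : Type u} [AddCommGroup N] [Module R N]
    [AddCommGroup M] [Module R M] {ι : Type u} [Finite ι] (e : M ≃ₗ[R] (ι →₀ N)) (i : ℕ)
    (hN : EV d N i) : EV d M i := by
  intro g hg
  have hx : ∀ j : ι, ∃ h : P i →ₗ[R] N, h ∘ₗ d i = Finsupp.lapply j ∘ₗ e.toLinearMap ∘ₗ g := by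
    intro j
    apply hN
    rw [LinearMap.comp_assoc, LinearMap.comp_assoc, hg]; simp
  choose h hh using hx
  refine ⟨e.symm.toLinearMap ∘ₗ (Finsupp.linearEquivFunOnFinite R N ι).symm.toLinearMap ∘ₗ
    LinearMap.pi h, ?_⟩
  ext x
  apply e.injective
  ext j
  have := LinearMap.congr_fun (hh j) x
  simpa using this

theorem eq_zero_of_hom [IsNoetherianRing R] {C L : Type u} [AddCommGroup C] [Module R C]
    [AddCommGroup L] [Module R L] [Module.Finite R C] [Module.Finite R L]
    (hC : Function.Injective (LinearMap.toSpanSingleton R (C →ₗ[R] C) LinearMap.id))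
    (h : ∀ φ : C →ₗ[R] L, φ = 0) : ∀ x : L, x = 0 := by
  obtain ⟨r, hr, hreg⟩ := IsSMulRegular.subsingleton_linearMap_iff.1
    (subsingleton_of_forall_eq (0 : C →ₗ[R] L) h)
  have : r = 0 := by
    apply hC
    ext x
    simp [Module.mem_annihilator.1 hr x]
  subst this
  intro x
  apply hreg
  simp

theorem base_bij {C X : Type u} [AddCommGroup C] [Module R C] [AddCommGroup X] [Module R X]
    (hC : Function.Bijective (LinearMap.toSpanSingleton R (C →ₗ[R] C) LinearMap.id))
    {ι : Type u} [Finite ι] (b : Module.Basis ι R X) :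
    Function.Bijective ((TensorProduct.mk R C X).flip) := by
  classical
  let e := TensorProduct.equivFinsuppOfBasisRight (M := C) b
  have he : ∀ (c : C) (x : X) (j : ι), e (c ⊗ₜ x) j = b.repr x j • c := fun c x j =>
    TensorProduct.equivFinsuppOfBasisRight_apply_tmul_apply b c x j
  constructor
  · rw [injective_iff_map_eq_zero]
    intro x hx
    apply b.repr.injective
    ext j
    rw [map_zero]
    apply hC.1
    ext c
    have h1 : c ⊗ₜ[R] x = 0 := LinearMap.congr_fun hx c
    have := he c x j
    rw [h1] at this
    simpa using this.symm
  · intro φ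
    have hx : ∀ j : ι, ∃ r : R, ∀ c, r • c = e (φ c) j := by
      intro j
      obtain ⟨r, hr⟩ := hC.2 (Finsupp.lapply j ∘ₗ e.toLinearMap ∘ₗ φ)
      refine ⟨r, fun c => ?_⟩
      have := LinearMap.congr_fun hr c
      simpa using this
    choose r hr using hx
    refine ⟨b.repr.symm ((Finsupp.linearEquivFunOnFinite R R ι).symm r), ?_⟩
    ext c
    apply e.injective
    ext j
    have := he c (b.repr.symm ((Finsupp.linearEquivFunOnFinite R R ι).symm r)) j
    simp only [LinearMap.flip_apply, TensorProduct.mk_apply]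
    rw [this]
    simp [hr]

theorem PdLE_hasPD (n : ℕ) : ∀ (M : ModuleCat.{u} R), PdLE R n M →
    HasProjectiveDimensionLT M (n+1) := by
  induction n with
  | zero =>
    intro M h
    have h : Module.Projective R M := h
    have : Projective M := (IsProjective.iff_projective M).1 h
    infer_instance
  | succ n ih =>
    rintro M ⟨G, g, hG, hg, hk⟩
    have hpk := ih _ hk
    have : Projective G := (IsProjective.iff_projective G).1 hG
    let S : ShortComplex (ModuleCat.{u} R) := ShortComplex.mk
      (ModuleCat.ofHom (LinearMap.ker g).subtype) (ModuleCat.ofHom g) (by ext x; exact x.2)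
    have hS : S.ShortExact := by
      refine { exact := ?_, mono_f := ?_, epi_g := ?_ }
      · rw [ShortComplex.ShortExact.moduleCat_exact_iff_function_exact]
        exact LinearMap.exact_subtype_ker_map g
      · exact (ModuleCat.mono_iff_injective _).2 (Submodule.injective_subtype _)
      · exact (ModuleCat.epi_iff_surjective _).2 hg
    exact (hS.hasProjectiveDimensionLT_X₃_iff n ‹_›).2 hpk

theorem main_ind [IsLocalRing R] [IsNoetherianRing R]
    {C : Type u} [AddCommGroup C] [Module R C] [Module.Finite R C]
    (hC : Function.Bijective (LinearMap.toSpanSingleton R (C →ₗ[R] C) LinearMap.id))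
    {P : ℕ → Type u} [∀ i, AddCommGroup (P i)] [∀ i, Module R (P i)]
    (d : ∀ i, P (i+1) →ₗ[R] P i) (hd : ∀ i, d i ∘ₗ d (i+1) = 0)
    (hP : ∀ i, Module.Projective R (P i)) (p : P 0 →ₗ[R] C)
    (hp : Function.Surjective p) (hdp : Function.Exact (d 0) p)
    (hE : ∀ i, EV d C i) (n : ℕ) :
    ∀ (X : Type u) [AddCommGroup X] [Module R X] [Module.Finite R X],
      HasProjectiveDimensionLT (ModuleCat.of R X) (n+1) →
      Function.Bijective ((TensorProduct.mk R C X).flip) ∧ ∀ i, EV d (C ⊗[R] X) i := by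
  have base : ∀ (X : Type u) [AddCommGroup X] [Module R X] [Module.Finite R X],
      Module.Projective R X →
      Function.Bijective ((TensorProduct.mk R C X).flip) ∧ ∀ i, EV d (C ⊗[R] X) i := by
    intro X _ _ _ hX
    have : Module.Free R X := Module.free_of_flat_of_isLocalRing
    let b := Module.Free.chooseBasis R X
    exact ⟨base_bij hC b, fun i =>
      EV_equiv_finsupp d (TensorProduct.equivFinsuppOfBasisRight (M := C) b) i (hE i)⟩
  induction n with
  | zero =>
    intro X _ _ _ hX
    apply base
    have hX : HasProjectiveDimensionLT (ModuleCat.of R X) 1 := hX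
    exact (IsProjective.iff_projective (ModuleCat.of R X)).2
      (projective_iff_hasProjectiveDimensionLT_one.2 hX)
  | succ n ih =>
    intro X _ _ _ hX
    obtain ⟨m, g, hg⟩ := Module.Finite.exists_fin' R X
    let G := Fin m → R
    have hK : HasProjectiveDimensionLT (ModuleCat.of R (LinearMap.ker g)) (n+1) := by
      have : Projective (ModuleCat.of R G) :=
        (IsProjective.iff_projective (ModuleCat.of R G)).1
          (inferInstanceAs (Module.Projective R (Fin m → R)))
      let S : ShortComplex (ModuleCat.{u} R) := ShortComplex.mk
        (ModuleCat.ofHom (LinearMap.ker g).subtype) (ModuleCat.ofHom g) (by ext x; exact x.2)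
      have hS : S.ShortExact := by
        refine { exact := ?_, mono_f := ?_, epi_g := ?_ }
        · rw [ShortComplex.ShortExact.moduleCat_exact_iff_function_exact]
          exact LinearMap.exact_subtype_ker_map g
        · exact (ModuleCat.mono_iff_injective _).2 (Submodule.injective_subtype _)
        · exact (ModuleCat.epi_iff_surjective _).2 hg
      exact (hS.hasProjectiveDimensionLT_X₃_iff n ‹_›).1 hX
    obtain ⟨hKb, hKE⟩ := ih (LinearMap.ker g) hK
    obtain ⟨hGb, hGE⟩ := base (Fin m → R) inferInstance
    set κ := (LinearMap.ker g).subtype with hκ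
    have hκi : Function.Injective κ := Submodule.injective_subtype _
    have hinj : Function.Injective (κ.lTensor C) := by
      rw [injective_iff_map_eq_zero]
      intro x hx
      have := eq_zero_of_hom (C := C) (L := LinearMap.ker (κ.lTensor C)) hC.1 (by
        intro φ
        obtain ⟨k, hk⟩ := hKb.2 ((LinearMap.ker (κ.lTensor C)).subtype ∘ₗ φ)
        have hk0 : k = 0 := by
          apply hκi
          apply hGb.1
          ext c
          have h1 : c ⊗ₜ[R] k = (φ c : C ⊗[R] _) := LinearMap.congr_fun hk c
          have h2 := (φ c).2
          rw [LinearMap.mem_ker, ← h1] at h2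
          simpa using h2
        ext c
        have h1 : c ⊗ₜ[R] k = (φ c : C ⊗[R] _) := LinearMap.congr_fun hk c
        rw [← h1, hk0]
        simp) ⟨x, hx⟩
      exact congrArg Subtype.val this
    have hex : Function.Exact (κ.lTensor C) (g.lTensor C) :=
      lTensor_exact C (LinearMap.exact_subtype_ker_map g) hg
    have hsur : Function.Surjective (g.lTensor C) := LinearMap.lTensor_surjective C hg
    refine ⟨⟨?_, ?_⟩, fun i => EV_quot d hd hP _ _ hinj hex hsur i (hGE i) (hKE (i+1))⟩
    · rw [injective_iff_map_eq_zero]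
      intro x hx
      obtain ⟨y, rfl⟩ := hg x
      obtain ⟨φ, hφ⟩ := factor_inj (κ.lTensor C) hinj ((TensorProduct.mk R C _).flip y) (by
        intro c
        apply (hex _).1
        have := LinearMap.congr_fun hx c
        simpa using this)
      obtain ⟨k, rfl⟩ := hKb.2 φ
      have : κ k = y := by
        apply hGb.1
        rw [← hφ]
        ext c
        simp
      rw [← this]
      exact k.2
    · intro φ
      obtain ⟨ψ, rfl⟩ := Hom_surj d hd hP _ _ hinj hex hsur p hp hdp (hKE 0) φ
      obtain ⟨y, rfl⟩ := hGb.2 ψ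
      refine ⟨g y, ?_⟩
      ext c
      simp

theorem EV_of_ext {C : ModuleCat.{u} R} (P : ProjectiveResolution C) (N : ModuleCat.{u} R) (i : ℕ)
    (h : Subsingleton (ExtMod R C N (i+1))) :
    EV (P := fun i => P.complex.X i) (fun i => (P.complex.d (i+1) i).hom) N i := by
  have h0 : Limits.IsZero ((P.complex.linearYonedaObj R N).homology (i+1)) := by
    refine Limits.IsZero.of_iso ?_ (P.isoExt (R := R) (i+1) N).symm
    have : Subsingleton (((Ext R (ModuleCat.{u} R) (i+1)).obj (op C)).obj N) := h
    exact ModuleCat.isZero_of_subsingleton _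
  rw [← HomologicalComplex.exactAt_iff_isZero_homology,
    HomologicalComplex.exactAt_iff' _ i (i+1) (i+2) (by simp) (by simp),
    ShortComplex.moduleCat_exact_iff] at h0
  intro g hg
  obtain ⟨k, hk⟩ := h0 (ModuleCat.ofHom g) (by
    change P.complex.d (i+2) (i+1) ≫ ModuleCat.ofHom g = 0
    ext x
    exact LinearMap.congr_fun hg x)
  refine ⟨(show P.complex.X i ⟶ N from k).hom, ?_⟩
  have hk : P.complex.d (i+1) i ≫ (show P.complex.X i ⟶ N from k) = ModuleCat.ofHom g := hk
  exact congrArg ModuleCat.Hom.hom hk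

end Helpers

theorem stmt11 (R : Type u) [CommRing R] [IsLocalRing R] [IsNoetherianRing R]
    (hCM : ∃ d : ℕ, IsCMLocalOfDim R d)
    (w : Type u) [AddCommGroup w] [Module R w]
    (hw : IsCanonicalModule R w)
    (hpd : FinitePd R (w →ₗ[R] R)) :
    FiniteInjDim R R := by
  obtain ⟨⟨hfin, hbij, hext⟩, hinj⟩ := hw
  obtain ⟨n, hn⟩ := hpd
  let Q : ProjectiveResolution (ModuleCat.of R w) := projectiveResolution _
  let d := fun i => (Q.complex.d (i+1) i).hom
  have hd : ∀ i, d i ∘ₗ d (i+1) = 0 := fun i =>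
    congrArg ModuleCat.Hom.hom (Q.complex.d_comp_d (i+2) (i+1) i)
  have hP : ∀ i, Module.Projective R (Q.complex.X i) := fun i =>
    (IsProjective.iff_projective _).2 (Q.projective i)
  let π : Q.complex.X 0 ⟶ ModuleCat.of R w := Q.π.f 0
  let p : Q.complex.X 0 →ₗ[R] w := π.hom
  have hp : Function.Surjective p :=
    (ModuleCat.epi_iff_surjective π).1 (inferInstanceAs (Epi (Q.π.f 0)))
  have hdp : Function.Exact (d 0) p := by
    have := Q.exact₀
    rw [ShortComplex.ShortExact.moduleCat_exact_iff_function_exact] at this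
    exact this
  have hE : ∀ i, EV (P := fun i => Q.complex.X i) d w i := fun i =>
    EV_of_ext Q (ModuleCat.of R w) i (hext (i+1) (by omega))
  have : Module.Finite R (w →ₗ[R] R) := inferInstance
  obtain ⟨hb, hT⟩ := main_ind hbij (P := fun i => Q.complex.X i) d hd hP p hp hdp hE n
    (w →ₗ[R] R) (PdLE_hasPD n _ hn)
  -- the trace map
  let tr : w ⊗[R] (w →ₗ[R] R) →ₗ[R] R := TensorProduct.lift (LinearMap.id.flip)
  have htr : ∀ (x : w) (f : w →ₗ[R] R), tr (x ⊗ₜ f) = f x := fun x f => by simp [tr]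
  have htri : Function.Injective tr := by
    rw [injective_iff_map_eq_zero]
    intro x hx
    have := eq_zero_of_hom (C := w) (L := LinearMap.ker tr) hbij.1 (by
      intro φ
      obtain ⟨f, hf⟩ := hb.2 ((LinearMap.ker tr).subtype ∘ₗ φ)
      have hf' : ∀ c, c ⊗ₜ[R] f = (φ c : w ⊗[R] _) := fun c => LinearMap.congr_fun hf c
      have hf0 : f = 0 := by
        ext c
        rw [← htr, hf']
        exact (φ c).2
      ext c
      rw [← hf', hf0]
      simp) ⟨x, hx⟩
    exact congrArg Subtype.val this
  have hquot := eq_zero_of_hom (C := w) (L := R ⧸ LinearMap.range tr) hbij.1 (by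
    intro φ
    obtain ⟨f, rfl⟩ := Hom_surj (P := fun i => Q.complex.X i) d hd hP tr
      (LinearMap.range tr).mkQ htri (LinearMap.exact_map_mkQ_range tr)
      (Submodule.mkQ_surjective _) p hp hdp (hT 0) φ
    ext c
    simp only [LinearMap.comp_apply, LinearMap.zero_apply, Submodule.mkQ_apply,
      Submodule.Quotient.mk_eq_zero]
    exact ⟨c ⊗ₜ f, htr c f⟩)
  have htrs : (1 : R) ∈ LinearMap.range tr :=
    (Submodule.Quotient.mk_eq_zero _).1 (hquot (Submodule.Quotient.mk 1))
  -- some `f` takes a unit value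
  have hunit : ∃ (f : w →ₗ[R] R) (x : w), IsUnit (f x) := by
    by_contra! hcon
    have hle : LinearMap.range tr ≤ IsLocalRing.maximalIdeal R := by
      rintro _ ⟨t, rfl⟩
      induction t with
      | zero => simp
      | tmul x f => rw [htr]; exact hcon f x
      | add a b ha hb => rw [map_add]; exact Ideal.add_mem _ ha hb
    exact (Ideal.ne_top_iff_one _).1 (IsLocalRing.maximalIdeal.isMaximal R).ne_top (hle htrs)
  obtain ⟨f, x, hx⟩ := hunit
  obtain ⟨v, hv⟩ := hx.exists_left_inv
  let s : ModuleCat.of R R ⟶ ModuleCat.of R w :=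
    ModuleCat.ofHom (LinearMap.toSpanSingleton R w (v • x))
  let r : ModuleCat.of R w ⟶ ModuleCat.of R R := ModuleCat.ofHom f
  have hsr : s ≫ r = 𝟙 _ := by
    ext
    simp [s, r, hv]
  obtain ⟨m, hm⟩ := hinj
  refine ⟨m, fun N i hi => ?_⟩
  have hs := hm N i hi
  let F := (Ext R (ModuleCat.{u} R) i).obj (op N)
  have hF : F.map s ≫ F.map r = 𝟙 _ := by rw [← F.map_comp, hsr, F.map_id]
  refine Function.Injective.subsingleton (β := ExtMod R N (ModuleCat.of R w) i)
    (f := (F.map s).hom) ?_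
  intro a b hab
  have h1 : ∀ a, (F.map r).hom ((F.map s).hom a) = a := fun a =>
    LinearMap.congr_fun (congrArg ModuleCat.Hom.hom hF) a
  rw [← h1 a, ← h1 b, hab]
end
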